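/- Let X be a complex space and let (u_n)_{n∈ℕ} ⊆ PSH(X) be a decreasing sequence. If u := inf_n u_n is not identically −∞ on any irreducible component of X, then u is plurisubharmonic on X. -/

import Mathlib

open Set Filter Topology Metric

noncomputable section

abbrev Cn (n : ℕ) : Type := Fin n → ℂ

def HarmonicOnCC (h : ℂ → ℝ) (Ω : Set ℂ) : Prop :=
  ∀ z ∈ Ω, ∃ W : Set ℂ, IsOpen W ∧ z ∈ W ∧ W ⊆ Ω ∧
    ∃ f : ℂ → ℂ, DifferentiableOn ℂ f W ∧ ∀ w ∈ W, h w = (f w).re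

def SubharmonicOnCC (u : ℂ → EReal) (Ω : Set ℂ) : Prop :=
  UpperSemicontinuousOn u Ω ∧
  ∀ (a : ℂ) (r : ℝ), 0 < r → closedBall a r ⊆ Ω →
    ∀ h : ℂ → ℝ, ContinuousOn h (closedBall a r) → HarmonicOnCC h (ball a r) →
      (∀ z ∈ sphere a r, u z ≤ (h z : EReal)) →
      ∀ z ∈ closedBall a r, u z ≤ (h z : EReal)

section NormedE

variable {E : Type*} [NormedAddCommGroup E] [NormedSpace ℂ E]

def PSHOnE (u : E → EReal) (Ω : Set E) : Prop :=
  (∀ z ∈ Ω, u z < ⊤) ∧ UpperSemicontinuousOn u Ω ∧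
  (¬ ∃ U : Set E, U ⊆ Ω ∧ IsOpen U ∧ U.Nonempty ∧ ∀ z ∈ U, u z = ⊥) ∧
  ∀ a b : E, SubharmonicOnCC (fun w : ℂ => u (a + w • b)) {w : ℂ | a + w • b ∈ Ω}

def StronglyPSHOnE (u : E → ℝ) (Ω : Set E) : Prop :=
  ∀ x ∈ Ω, ∃ ε : ℝ, 0 < ε ∧ ∃ U : Set E, IsOpen U ∧ x ∈ U ∧ U ⊆ Ω ∧
    PSHOnE (fun z => ((u z - ε * ‖z‖ ^ 2 : ℝ) : EReal)) U

def IsSubvariety (B V : Set E) : Prop :=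
  IsOpen V ∧ B ⊆ V ∧
  ∀ z ∈ V, ∃ W : Set E, IsOpen W ∧ z ∈ W ∧ W ⊆ V ∧
    ∃ (m : ℕ) (F : Fin m → E → ℂ), (∀ i, DifferentiableOn ℂ (F i) W) ∧
      B ∩ W = {w ∈ W | ∀ i, F i w = 0}

end NormedE

structure CChart (X : Type*) [TopologicalSpace X] where
  E : Type
  [nacg : NormedAddCommGroup E]
  [nsp : NormedSpace ℂ E]
  [fd : FiniteDimensional ℂ E]
  U : Set X
  V : Set E
  B : Set E
  φ : X → E
  openU : IsOpen U
  subvariety : IsSubvariety B V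
  mapsToB : ∀ x ∈ U, φ x ∈ B
  injOn : Set.InjOn φ U
  image_eq : φ '' U = B
  contOn : ContinuousOn φ U
  open_image : ∀ W : Set X, W ⊆ U → IsOpen W → ∃ V'' : Set E, IsOpen V'' ∧ φ '' W = B ∩ V''

attribute [instance] CChart.nacg CChart.nsp CChart.fd

def ChartCompat {X : Type*} [TopologicalSpace X] (c d : CChart X) : Prop :=
  ∀ x ∈ c.U ∩ d.U, ∃ W : Set c.E, IsOpen W ∧ c.φ x ∈ W ∧
    ∃ F : c.E → d.E, DifferentiableOn ℂ F W ∧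
      ∀ y ∈ c.U ∩ d.U, c.φ y ∈ W → F (c.φ y) = d.φ y

structure CSpace (X : Type*) [TopologicalSpace X] where
  atlas : Set (CChart X)
  chart_cover : ∀ x : X, ∃ c ∈ atlas, x ∈ c.U
  compat : ∀ c ∈ atlas, ∀ d ∈ atlas, ChartCompat c d

section Space

variable {X : Type*} [TopologicalSpace X]

def SpaceHolOn (S : CSpace X) (f : X → ℂ) (D : Set X) : Prop :=
  ∀ x ∈ D, ∃ c ∈ S.atlas, x ∈ c.U ∧ ∃ V' : Set c.E, IsOpen V' ∧ V' ⊆ c.V ∧ c.φ x ∈ V' ∧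
    {y ∈ c.U | c.φ y ∈ V'} ⊆ D ∧
    ∃ F : c.E → ℂ, DifferentiableOn ℂ F V' ∧ ∀ y ∈ c.U, c.φ y ∈ V' → F (c.φ y) = f y

def HolMapTo (S : CSpace X) (f : ℂ → X) (Ω : Set ℂ) : Prop :=
  ContinuousOn f Ω ∧
  ∀ c ∈ S.atlas, DifferentiableOn ℂ (fun w => c.φ (f w)) (Ω ∩ f ⁻¹' c.U)

def IsAnalyticIn (S : CSpace X) (A D : Set X) : Prop :=
  A ⊆ D ∧ ∀ x ∈ D, ∃ c ∈ S.atlas, x ∈ c.U ∧ ∃ V' : Set c.E, IsOpen V' ∧ V' ⊆ c.V ∧ c.φ x ∈ V' ∧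
    ∃ (m : ℕ) (F : Fin m → c.E → ℂ), (∀ i, DifferentiableOn ℂ (F i) V') ∧
      ∀ y ∈ c.U, c.φ y ∈ V' → y ∈ D → (y ∈ A ↔ ∀ i, F i (c.φ y) = 0)

def IsIrreducibleIn (S : CSpace X) (D : Set X) : Prop :=
  D.Nonempty ∧ ∀ A₁ A₂ : Set X, IsAnalyticIn S A₁ D → IsAnalyticIn S A₂ D →
    A₁ ∪ A₂ = D → A₁ = D ∨ A₂ = D

def IsIrreducibleAnalyticIn (S : CSpace X) (C D : Set X) : Prop :=
  IsAnalyticIn S C D ∧ C.Nonempty ∧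
  ∀ A₁ A₂ : Set X, IsAnalyticIn S A₁ D → IsAnalyticIn S A₂ D →
    C ⊆ A₁ ∪ A₂ → C ⊆ A₁ ∨ C ⊆ A₂

def IsIrredComponentIn (S : CSpace X) (C D : Set X) : Prop :=
  IsIrreducibleAnalyticIn S C D ∧
  ∀ C' : Set X, IsIrreducibleAnalyticIn S C' D → C ⊆ C' → C' = C

def IsLocallyIrreducibleIn (S : CSpace X) (D : Set X) : Prop :=
  ∀ x ∈ D, ∀ W : Set X, IsOpen W → x ∈ W →
    ∃ D' : Set X, IsOpen D' ∧ x ∈ D' ∧ D' ⊆ W ∩ D ∧ IsIrreducibleIn S D'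

def SpacePSHOn (S : CSpace X) (u : X → EReal) (D : Set X) : Prop :=
  (∀ x ∈ D, u x < ⊤) ∧
  (∀ C : Set X, IsIrredComponentIn S C D → ∃ x ∈ C, u x ≠ ⊥) ∧
  ∀ x ∈ D, ∃ c ∈ S.atlas, x ∈ c.U ∧ ∃ V' : Set c.E, IsOpen V' ∧ V' ⊆ c.V ∧ c.φ x ∈ V' ∧
    {y ∈ c.U | c.φ y ∈ V'} ⊆ D ∧
    ∃ ψ : c.E → EReal, PSHOnE ψ V' ∧ ∀ y ∈ c.U, c.φ y ∈ V' → ψ (c.φ y) = u y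

def SpaceRealAnalyticOn (S : CSpace X) (f : X → ℝ) (D : Set X) : Prop :=
  ∀ x ∈ D, ∃ c ∈ S.atlas, x ∈ c.U ∧ ∃ V' : Set c.E, IsOpen V' ∧ V' ⊆ c.V ∧ c.φ x ∈ V' ∧
    {y ∈ c.U | c.φ y ∈ V'} ⊆ D ∧
    ∃ g : c.E → ℝ, AnalyticOnNhd ℝ g V' ∧ ∀ y ∈ c.U, c.φ y ∈ V' → g (c.φ y) = f y

def SpaceStronglyPSHOn (S : CSpace X) (f : X → ℝ) (D : Set X) : Prop :=
  ∀ x ∈ D, ∃ c ∈ S.atlas, x ∈ c.U ∧ ∃ V' : Set c.E, IsOpen V' ∧ V' ⊆ c.V ∧ c.φ x ∈ V' ∧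
    {y ∈ c.U | c.φ y ∈ V'} ⊆ D ∧
    ∃ g : c.E → ℝ, StronglyPSHOnE g V' ∧ ∀ y ∈ c.U, c.φ y ∈ V' → g (c.φ y) = f y

def IsExhaustionOn (ψ : X → ℝ) (D : Set X) : Prop :=
  ∀ c : ℝ, IsCompact (closure {x ∈ D | ψ x < c}) ∧ closure {x ∈ D | ψ x < c} ⊆ D

def holHull (S : CSpace X) (K G : Set X) : Set X :=
  {x ∈ G | ∀ f : X → ℂ, SpaceHolOn S f G → ‖f x‖ ≤ sSup ((fun y => ‖f y‖) '' K)}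

def IsSteinIn (S : CSpace X) (G : Set X) : Prop :=
  (∀ K : Set X, K ⊆ G → IsCompact K → IsCompact (holHull S K G)) ∧
  ∀ x ∈ G, ∀ y ∈ G, x ≠ y → ∃ f : X → ℂ, SpaceHolOn S f G ∧ f x ≠ f y

def IsManifoldIn (S : CSpace X) (D : Set X) : Prop :=
  ∀ x ∈ D, ∃ c ∈ S.atlas, x ∈ c.U ∧ c.B = c.V

def relExtRaw (S : CSpace X) (A D : Set X) : X → EReal := fun z =>
  ⨆ u ∈ {u : X → EReal | SpacePSHOn S u D ∧ (∀ x ∈ D, u x ≤ 1) ∧ ∀ x ∈ A, u x ≤ 0}, u z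

def relExt (S : CSpace X) (A D : Set X) : X → EReal := fun z =>
  limsup (relExtRaw S A D) (𝓝[D] z)

def IsPluripolarIn (S : CSpace X) (P D : Set X) : Prop :=
  ∀ x ∈ P, ∃ U : Set X, IsOpen U ∧ x ∈ U ∧ U ⊆ D ∧
    ∃ u : X → EReal, SpacePSHOn S u U ∧ ∀ y ∈ P ∩ U, u y = ⊥

def PluriregularAt (S : CSpace X) (A : Set X) (a : X) : Prop :=
  a ∈ closure A ∧ ∀ U : Set X, IsOpen U → a ∈ U → relExt S (A ∩ U) U a = 0

def LocallyPluriregular (S : CSpace X) (A : Set X) : Prop :=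
  A.Nonempty ∧ ∀ a ∈ A, PluriregularAt S A a

def IsJosefsonManifold (S : CSpace X) : Prop :=
  IsManifoldIn S univ ∧ ∀ P : Set X, IsPluripolarIn S P univ →
    ∃ u : X → EReal, SpacePSHOn S u univ ∧ ∀ x ∈ P, u x = ⊥

def LocBoundedOn (u : X → EReal) (D : Set X) : Prop :=
  ∀ x ∈ D, ∃ U : Set X, IsOpen U ∧ x ∈ U ∧
    ∃ m M : ℝ, ∀ y ∈ U ∩ D, (m : EReal) ≤ u y ∧ u y ≤ (M : EReal)

def BoundedOn (u : X → EReal) (D : Set X) : Prop :=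
  ∃ m M : ℝ, ∀ y ∈ D, (m : EReal) ≤ u y ∧ u y ≤ (M : EReal)

def LocallyLRegular (S : CSpace X) (E : Set X) : Prop :=
  ∀ x ∈ E, ∀ W : Set X, IsOpen W → x ∈ W →
    ∃ U₀ : Set X, IsOpen U₀ ∧ x ∈ U₀ ∧ U₀ ⊆ W ∧
      ContinuousOn (relExt S (E ∩ U₀) U₀) U₀ ∧
      ∀ y ∈ E ∩ U₀, relExt S (E ∩ U₀) U₀ y = 0

end Space

open MeasureTheory

def d2 {n : ℕ} (u : Cn n → ℝ) (z v w : Cn n) : ℝ :=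
  fderiv ℝ (fun x => fderiv ℝ u x v) z w

def cHess {n : ℕ} (u : Cn n → ℝ) (z : Cn n) : Matrix (Fin n) (Fin n) ℂ :=
  Matrix.of fun j k =>
    (((d2 u z (Pi.single j 1) (Pi.single k 1) +
        d2 u z (Pi.single j Complex.I) (Pi.single k Complex.I) : ℝ) : ℂ) +
      Complex.I * ((d2 u z (Pi.single j 1) (Pi.single k Complex.I) -
        d2 u z (Pi.single j Complex.I) (Pi.single k 1) : ℝ) : ℂ)) / 4

def maDensity {n : ℕ} (u : Cn n → ℝ) (z : Cn n) : ℝ :=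
  (4 : ℝ) ^ n * (n.factorial : ℝ) * ((cHess u z).det).re

def smoothMA {n : ℕ} (u : Cn n → ℝ) : Measure (Cn n) :=
  volume.withDensity fun z => ENNReal.ofReal (maDensity u z)

def IsMAOn {n : ℕ} (u : Cn n → EReal) (Ω : Set (Cn n)) (μ : Measure (Cn n)) : Prop :=
  (∀ A : Set (Cn n), MeasurableSet A → Disjoint A Ω → μ A = 0) ∧
  ∀ v : ℕ → Cn n → ℝ, (∀ j, ContDiff ℝ (⊤ : ℕ∞) (v j)) →
    (∀ j, PSHOnE (fun z => ((v j z : ℝ) : EReal)) Ω) →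
    (∀ z ∈ Ω, Antitone fun j => v j z) →
    (∀ z ∈ Ω, Tendsto (fun j => ((v j z : ℝ) : EReal)) atTop (𝓝 (u z))) →
    ∀ f : Cn n → ℝ, Continuous f → HasCompactSupport f → tsupport f ⊆ Ω →
      Tendsto (fun j => ∫ z, f z ∂(smoothMA (v j))) atTop (𝓝 (∫ z, f z ∂μ))

section SpaceMA

variable {X : Type*} [TopologicalSpace X]

def IsLocalCoord (S : CSpace X) (n : ℕ) (U₀ : Set X) (ρ : X → Cn n) (Ω₀ : Set (Cn n)) :
    Prop :=
  IsOpen U₀ ∧ IsOpen Ω₀ ∧ ρ '' U₀ = Ω₀ ∧ InjOn ρ U₀ ∧ ContinuousOn ρ U₀ ∧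
  (∀ W : Set X, W ⊆ U₀ → IsOpen W → IsOpen (ρ '' W)) ∧
  (∀ j : Fin n, SpaceHolOn S (fun x => ρ x j) U₀) ∧
  ∀ f : X → ℂ, SpaceHolOn S f U₀ →
    ∃ F : Cn n → ℂ, DifferentiableOn ℂ F Ω₀ ∧ ∀ x ∈ U₀, F (ρ x) = f x

def RegLocus (S : CSpace X) (n : ℕ) : Set X :=
  {x | ∃ (U₀ : Set X) (ρ : X → Cn n) (Ω₀ : Set (Cn n)), IsLocalCoord S n U₀ ρ Ω₀ ∧ x ∈ U₀}

def PureDimensionIn (S : CSpace X) (D : Set X) (n : ℕ) : Prop :=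
  D ⊆ closure (RegLocus S n ∩ D) ∧ ∀ k : ℕ, (RegLocus S k ∩ D).Nonempty → k = n

def IsMAOnSpace [MeasurableSpace X] (S : CSpace X) (n : ℕ) (u : X → EReal) (D : Set X)
    (μ : Measure X) : Prop :=
  (∀ A : Set X, MeasurableSet A → Disjoint A D → μ A = 0) ∧
  (∀ A : Set X, MeasurableSet A → A ⊆ D → Disjoint A (RegLocus S n) → μ A = 0) ∧
  ∀ (U₀ : Set X) (ρ : X → Cn n) (Ω₀ : Set (Cn n)), IsLocalCoord S n U₀ ρ Ω₀ → U₀ ⊆ D →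
    ∃ (uu : Cn n → EReal) (ν : Measure (Cn n)),
      (∀ x ∈ U₀, uu (ρ x) = u x) ∧ IsMAOn uu Ω₀ ν ∧
      ∀ A : Set X, MeasurableSet A → A ⊆ U₀ → μ A = ν (ρ '' A)

def elog (t : ℝ) : EReal := if t ≤ 0 then ⊥ else ((Real.log t : ℝ) : EReal)

def WeaklyParabolicIn [MeasurableSpace X] (S : CSpace X) (n : ℕ) (g : X → ℝ) (D : Set X) :
    Prop :=
  (∀ x ∈ D, 0 ≤ g x) ∧ ContinuousOn g D ∧
  SpacePSHOn S (fun x => ((g x : ℝ) : EReal)) D ∧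
  IsExhaustionOn g D ∧
  SpacePSHOn S (fun x => elog (g x)) D ∧
  IsMAOnSpace S n (fun x => elog (g x)) {x ∈ D | g x ≠ 0} (0 : Measure X)

end SpaceMA

section Pi

variable {ι : Type*} [Fintype ι] {Z : ι → Type*} [∀ i, TopologicalSpace (Z i)]

def PiHolOn (T : ∀ i, CSpace (Z i)) (f : (∀ i, Z i) → ℂ) (Ω : Set (∀ i, Z i)) : Prop :=
  ∀ w ∈ Ω, ∃ c : ∀ i, CChart (Z i), (∀ i, c i ∈ (T i).atlas) ∧ (∀ i, w i ∈ (c i).U) ∧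
    ∃ V' : Set (∀ i, (c i).E), IsOpen V' ∧ (fun i => (c i).φ (w i)) ∈ V' ∧
      {y : ∀ i, Z i | (∀ i, y i ∈ (c i).U) ∧ (fun i => (c i).φ (y i)) ∈ V'} ⊆ Ω ∧
      ∃ F : (∀ i, (c i).E) → ℂ, DifferentiableOn ℂ F V' ∧
        ∀ y : ∀ i, Z i, (∀ i, y i ∈ (c i).U) → ((fun i => (c i).φ (y i)) ∈ V') →
          F (fun i => (c i).φ (y i)) = f y

def PiPSHOn (T : ∀ i, CSpace (Z i)) (u : (∀ i, Z i) → EReal) (Ω : Set (∀ i, Z i)) : Prop :=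
  (∀ z ∈ Ω, u z < ⊤) ∧
  (¬ ∃ U : Set (∀ i, Z i), U ⊆ Ω ∧ IsOpen U ∧ U.Nonempty ∧ ∀ z ∈ U, u z = ⊥) ∧
  ∀ w ∈ Ω, ∃ c : ∀ i, CChart (Z i), (∀ i, c i ∈ (T i).atlas) ∧ (∀ i, w i ∈ (c i).U) ∧
    ∃ V' : Set (∀ i, (c i).E), IsOpen V' ∧ (fun i => (c i).φ (w i)) ∈ V' ∧
      {y : ∀ i, Z i | (∀ i, y i ∈ (c i).U) ∧ (fun i => (c i).φ (y i)) ∈ V'} ⊆ Ω ∧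
      ∃ ψ : (∀ i, (c i).E) → EReal, PSHOnE ψ V' ∧
        ∀ y : ∀ i, Z i, (∀ i, y i ∈ (c i).U) → ((fun i => (c i).φ (y i)) ∈ V') →
          ψ (fun i => (c i).φ (y i)) = u y

def PiRelExtRaw (T : ∀ i, CSpace (Z i)) (A D : Set (∀ i, Z i)) : (∀ i, Z i) → EReal :=
  fun z =>
    ⨆ u ∈ {u : (∀ i, Z i) → EReal |
      PiPSHOn T u D ∧ (∀ x ∈ D, u x ≤ 1) ∧ ∀ x ∈ A, u x ≤ 0}, u z

def PiRelExt (T : ∀ i, CSpace (Z i)) (A D : Set (∀ i, Z i)) : (∀ i, Z i) → EReal :=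
  fun z => limsup (PiRelExtRaw T A D) (𝓝[D] z)

def PiPluripolar (T : ∀ i, CSpace (Z i)) (P : Set (∀ i, Z i)) : Prop :=
  ∀ w ∈ P, ∃ U : Set (∀ i, Z i), IsOpen U ∧ w ∈ U ∧
    ∃ u : (∀ i, Z i) → EReal, PiPSHOn T u U ∧ ∀ y ∈ P ∩ U, u y = ⊥

end Pi

section Cross

variable {N : ℕ} {X : Fin N → Type*}

def idxCard (α : Fin N → Bool) : ℕ := (Finset.univ.filter fun j => α j = true).card

def insertCoords (α : Fin N → Bool) (a : ∀ j : {j : Fin N // α j = false}, X j.1)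
    (z : ∀ j : {j : Fin N // α j = true}, X j.1) : ∀ j, X j :=
  fun j => if h : α j = true then z ⟨j, h⟩ else a ⟨j, Bool.eq_false_iff.mpr h⟩

def proj0 (α : Fin N → Bool) (w : ∀ j, X j) : ∀ j : {j : Fin N // α j = false}, X j.1 :=
  fun j => w j.1

def piASet (A : ∀ j, Set (X j)) (α : Fin N → Bool) :
    Set (∀ j : {j : Fin N // α j = false}, X j.1) :=
  {a | ∀ j, a j ∈ A j.1}

def crossT (A : ∀ j, Set (X j)) (k : ℕ)
    (Sig : ∀ α : Fin N → Bool, Set (∀ j : {j : Fin N // α j = false}, X j.1)) :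
    Set (∀ j, X j) :=
  {w | ∃ α : Fin N → Bool, idxCard α = k ∧
    (∀ j : {j : Fin N // α j = false}, w j.1 ∈ A j.1) ∧ proj0 α w ∉ Sig α}

variable [∀ j, TopologicalSpace (X j)]

def SepHol (S : ∀ j, CSpace (X j)) (A : ∀ j, Set (X j)) (k : ℕ)
    (Sig : ∀ α : Fin N → Bool, Set (∀ j : {j : Fin N // α j = false}, X j.1))
    (f : (∀ j, X j) → ℂ) : Prop :=
  ∀ α : Fin N → Bool, idxCard α = k →
    ∀ a : ∀ j : {j : Fin N // α j = false}, X j.1, a ∈ piASet A α → a ∉ Sig α →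
      PiHolOn (fun j : {j : Fin N // α j = true} => S j.1)
        (fun z => f (insertCoords α a z)) univ

def SepHolC (S : ∀ j, CSpace (X j)) (A : ∀ j, Set (X j)) (k : ℕ)
    (Sig : ∀ α : Fin N → Bool, Set (∀ j : {j : Fin N // α j = false}, X j.1))
    (f : (∀ j, X j) → ℂ) : Prop :=
  SepHol S A k Sig f ∧
  ∀ α : Fin N → Bool, idxCard α = k →
    ∀ b : ∀ j : {j : Fin N // α j = true}, X j.1,
      ContinuousOn (fun a : ∀ j : {j : Fin N // α j = false}, X j.1 =>
        f (insertCoords α a b)) (piASet A α \ Sig α)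

def crossEnvelope (S : ∀ j, CSpace (X j)) (A : ∀ j, Set (X j))
    (k : ℝ) : Set (∀ j, X j) :=
  {z | (∑ j, relExt (S j) (A j) univ (z j)) < ((k : ℝ) : EReal)}

end Cross

set_option linter.all false
section
def SubV (φ : ℂ → ℝ) : Prop :=
  ∀ f : ℂ → ℂ, AnalyticAt ℂ f 0 → ∀ ε : ℝ, 0 < ε → (f 0).re = φ 0 →
    ¬ ∀ᶠ t in 𝓝 (0 : ℂ), φ t ≤ (f t).re - ε * ‖t‖ ^ 2

def LowH (ρ : ℂ → ℝ) : Prop :=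
  ∃ g : ℂ → ℂ, AnalyticAt ℂ g 0 ∧ (g 0).re = ρ 0 ∧
    ∀ δ : ℝ, 0 < δ → ∀ᶠ t in 𝓝 (0 : ℂ), (g t).re - δ * ‖t‖ ^ 2 ≤ ρ t

lemma SubV.of_le {φ ψ : ℂ → ℝ} (h : SubV φ) (h0 : φ 0 = ψ 0)
    (hle : ∀ᶠ t in 𝓝 (0 : ℂ), φ t ≤ ψ t) : SubV ψ := by
  intro f hf ε hε h1 h2
  refine h f hf ε hε (h1.trans h0.symm) ?_
  filter_upwards [hle, h2] with t a b using a.trans b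

lemma SubV.congr {φ ψ : ℂ → ℝ} (h : SubV φ) (hle : ∀ᶠ t in 𝓝 (0 : ℂ), φ t = ψ t) : SubV ψ :=
  h.of_le hle.self_of_nhds (hle.mono fun _ h => h.le)

lemma SubV.addLow {φ ρ : ℂ → ℝ} (h : SubV φ) (hρ : LowH ρ) : SubV (fun t => φ t + ρ t) := by
  obtain ⟨g, hg, hg0, hg1⟩ := hρ
  intro f hf ε hε h1 h2
  refine h (fun t => f t - g t) (hf.sub hg) (ε / 2) (by positivity) ?_ ?_
  · simp [h1, hg0]
  · filter_upwards [h2, hg1 (ε / 2) (by positivity)] with t a b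
    simp only [Complex.sub_re]; linarith

lemma LowH.re {g : ℂ → ℂ} (hg : AnalyticAt ℂ g 0) : LowH (fun t => (g t).re) :=
  ⟨g, hg, rfl, fun δ hδ => Eventually.of_forall fun t => by
    have : 0 ≤ δ * ‖t‖ ^ 2 := by positivity
    linarith⟩

lemma LowH.const (c : ℝ) : LowH (fun _ => c) := by
  simpa using LowH.re (g := fun _ => (c : ℂ)) analyticAt_const

lemma LowH.of_le {φ ψ : ℂ → ℝ} (h : LowH φ) (h0 : φ 0 = ψ 0)
    (hle : ∀ᶠ t in 𝓝 (0 : ℂ), φ t ≤ ψ t) : LowH ψ := by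
  obtain ⟨g, hg, hg0, hg1⟩ := h
  exact ⟨g, hg, hg0.trans h0, fun δ hδ => by
    filter_upwards [hle, hg1 δ hδ] with t a b using b.trans a⟩

lemma LowH.add {φ ψ : ℂ → ℝ} (h : LowH φ) (h' : LowH ψ) : LowH (fun t => φ t + ψ t) := by
  obtain ⟨g, hg, hg0, hg1⟩ := h
  obtain ⟨g', hg', hg0', hg1'⟩ := h'
  refine ⟨fun t => g t + g' t, hg.add hg', by simp [hg0, hg0'], fun δ hδ => ?_⟩
  filter_upwards [hg1 (δ / 2) (by positivity), hg1' (δ / 2) (by positivity)] with t a b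
  simp only [Complex.add_re]; linarith

lemma LowH.smul {φ : ℂ → ℝ} (h : LowH φ) {c : ℝ} (hc : 0 ≤ c) : LowH (fun t => c * φ t) := by
  obtain ⟨g, hg, hg0, hg1⟩ := h
  refine ⟨fun t => (c : ℂ) * g t, analyticAt_const.mul hg, by simp [hg0], fun δ hδ => ?_⟩
  filter_upwards [hg1 (δ / (c + 1)) (by positivity)] with t a
  have h1 : c * (δ / (c + 1)) ≤ δ := by
    rw [← mul_div_assoc, div_le_iff₀ (by positivity)]; nlinarith
  have h2 := mul_le_mul_of_nonneg_left a hc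
  have h3 := mul_le_mul_of_nonneg_right h1 (sq_nonneg ‖t‖)
  simp only [Complex.re_ofReal_mul]; linarith

lemma LowH.sum {ι : Type*} (s : Finset ι) {φ : ι → ℂ → ℝ} (h : ∀ i ∈ s, LowH (φ i)) :
    LowH (fun t => ∑ i ∈ s, φ i t) := by
  classical
  induction s using Finset.induction_on with
  | empty => simpa using LowH.const 0
  | insert a s ha ih =>
    simp only [Finset.sum_insert ha]
    exact (h _ (by simp)).add (ih fun i hi => h i (by simp [hi]))

lemma LowH.normSq {g : ℂ → ℂ} (hg : AnalyticAt ℂ g 0) : LowH (fun t => ‖g t‖ ^ 2) := by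
  have h1 : AnalyticAt ℂ (fun t => 2 * (starRingEnd ℂ (g 0)) * g t - (‖g 0‖ ^ 2 : ℝ)) 0 :=
    (analyticAt_const.mul hg).sub analyticAt_const
  refine (LowH.re h1).of_le ?_ (Eventually.of_forall fun t => ?_)
  · simp [Complex.sq_norm, Complex.normSq_apply]; ring
  · simp only [Complex.sq_norm, Complex.normSq_apply, Complex.sub_re, Complex.mul_re,
      Complex.mul_im, Complex.conj_re, Complex.conj_im, Complex.ofReal_re, Complex.re_ofNat,
      Complex.im_ofNat]
    nlinarith [sq_nonneg ((g 0).re - (g t).re), sq_nonneg ((g 0).im - (g t).im)]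

lemma subV_const (c : ℝ) : SubV (fun _ => c) := by
  intro f hf ε hε h0 h
  have h1 : IsLocalMax (norm ∘ fun t => Complex.exp (- f t)) 0 := by
    filter_upwards [h] with t ht
    have : 0 ≤ ε * ‖t‖ ^ 2 := by positivity
    have h3 : (f 0).re ≤ (f t).re := by linarith
    simpa [Function.comp, Complex.norm_exp] using h3
  have h2 := Complex.eventually_eq_of_isLocalMax_norm
    (hf.neg.cexp.eventually_analyticAt.mono fun z hz => hz.differentiableAt) h1
  have h3 : ∀ᶠ t in 𝓝 (0 : ℂ), ‖t‖ ^ 2 ≤ 0 := by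
    filter_upwards [h, h2] with t a b
    have := congrArg norm b
    have : (f t).re = (f 0).re := by simpa [Complex.norm_exp] using this
    have : ε * ‖t‖ ^ 2 ≤ 0 := by linarith
    by_contra hc
    push Not at hc
    nlinarith [mul_pos hε hc]
  have h4 : ∀ᶠ t in 𝓝 (0 : ℂ), t = 0 := h3.mono fun t ht => by
    have := sq_nonneg ‖t‖
    have : ‖t‖ ^ 2 = 0 := le_antisymm ht this
    simpa using this
  have h5 : ({0} : Set ℂ) ∈ 𝓝 0 := h4
  have := (mem_interior_iff_mem_nhds.2 h5)
  simp [interior_singleton] at this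

lemma LowH.subV {ρ : ℂ → ℝ} (h : LowH ρ) : SubV ρ := by
  simpa using (subV_const 0).addLow h

lemma SubV.max {φ ψ : ℂ → ℝ} (h : SubV φ) (h' : SubV ψ) : SubV (fun t => max (φ t) (ψ t)) := by
  rcases le_total (φ 0) (ψ 0) with h0 | h0
  · exact h'.of_le (by simp [h0]) (Eventually.of_forall fun t => le_max_right _ _)
  · exact h.of_le (by simp [h0]) (Eventually.of_forall fun t => le_max_left _ _)

lemma tendsto_add0 {E : Type*} [NormedAddCommGroup E] (z : E) :
    Tendsto (fun t : E => z + t) (𝓝 0) (𝓝 z) := by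
  have : Continuous fun t : E => z + t := by fun_prop
  simpa using this.tendsto 0

lemma maxPrinciple {K U : Set ℂ} (hK : IsCompact K) {φ : ℂ → ℝ} (hφ : UpperSemicontinuousOn φ K)
    (hU : IsOpen U) (hUK : U ⊆ K) (h : ∀ z ∈ U, SubV (fun t => φ (z + t)))
    (hb : ∀ z ∈ K \ U, φ z ≤ 0) : ∀ z ∈ K, φ z ≤ 0 := by
  intro z1 hz1
  by_contra hc
  push Not at hc
  obtain ⟨R, hR0, hR⟩ : ∃ R : ℝ, 0 < R ∧ ∀ z ∈ K, ‖z‖ ≤ R := by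
    obtain ⟨R, hR⟩ := hK.isBounded.exists_norm_le
    exact ⟨max R 1, by positivity, fun z hz => (hR z hz).trans (le_max_left _ _)⟩
  set ε := φ z1 / (2 * R ^ 2) with hε
  have hε0 : 0 < ε := by positivity
  have hεR : ε * R ^ 2 < φ z1 := by
    rw [hε]; field_simp; linarith
  have husc : UpperSemicontinuousOn (fun z => φ z + ε * ‖z‖ ^ 2) K :=
    hφ.add (ContinuousOn.upperSemicontinuousOn (by fun_prop))
  obtain ⟨z0, hz0, hmax⟩ := husc.exists_isMaxOn ⟨z1, hz1⟩ hK
  have hmax : ∀ z ∈ K, φ z + ε * ‖z‖ ^ 2 ≤ φ z0 + ε * ‖z0‖ ^ 2 := fun z hz => hmax hz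
  have h1 := hmax z1 hz1
  have h2 : ε * ‖z0‖ ^ 2 ≤ ε * R ^ 2 := by gcongr; exact hR z0 hz0
  have h3 : 0 ≤ ε * ‖z1‖ ^ 2 := by positivity
  have hz0U : z0 ∈ U := by
    by_contra hn
    linarith [hb z0 ⟨hz0, hn⟩]
  refine h z0 hz0U (fun t => φ z0 - 2 * ε * starRingEnd ℂ z0 * t) (by fun_prop) ε hε0 (by simp) ?_
  have h4 : ∀ᶠ t in 𝓝 (0 : ℂ), z0 + t ∈ U := by
    exact tendsto_add0 z0 (hU.mem_nhds hz0U)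
  filter_upwards [h4] with t ht
  have h5 := hmax _ (hUK ht)
  have h6 : ‖z0 + t‖ ^ 2 = ‖z0‖ ^ 2 + 2 * (starRingEnd ℂ z0 * t).re + ‖t‖ ^ 2 := by
    simp only [Complex.sq_norm, Complex.normSq_apply, Complex.add_re, Complex.add_im,
      Complex.mul_re, Complex.conj_re, Complex.conj_im]; ring
  have h7 : ((φ z0 : ℂ) - 2 * ε * starRingEnd ℂ z0 * t).re
      = φ z0 - 2 * ε * (starRingEnd ℂ z0 * t).re := by
    rw [Complex.sub_re, Complex.ofReal_re, mul_assoc,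
      show (2 : ℂ) * (ε : ℂ) = ((2 * ε : ℝ) : ℂ) by push_cast; ring, Complex.re_ofReal_mul]
  rw [h7]
  rw [h6] at h5
  linarith

section RP
variable {E : Type*} [NormedAddCommGroup E] [NormedSpace ℂ E] [CompleteSpace E]
variable {E' : Type*} [NormedAddCommGroup E'] [NormedSpace ℂ E'] [CompleteSpace E']

def RP (v : E → ℝ) (G : Set E) : Prop :=
  UpperSemicontinuousOn v G ∧
    ∀ γ : ℂ → E, AnalyticAt ℂ γ 0 → γ 0 ∈ G → SubV (fun t => v (γ t))

lemma analyticAt_comp {F : E → E'} {W : Set E} (hW : IsOpen W) (hF : DifferentiableOn ℂ F W)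
    {γ : ℂ → E} {c : ℂ} (hγ : AnalyticAt ℂ γ c) (h0 : γ c ∈ W) : AnalyticAt ℂ (fun t => F (γ t)) c := by
  have h1 : ∀ᶠ t in 𝓝 c, DifferentiableAt ℂ (fun t => F (γ t)) t := by
    filter_upwards [hγ.eventually_analyticAt, hγ.continuousAt (hW.mem_nhds h0)] with t a b
    exact ((hF _ b).differentiableAt (hW.mem_nhds b)).comp t a.differentiableAt
  exact (Complex.analyticAt_iff_eventually_differentiableAt).2 h1

lemma RP.mono {v : E → ℝ} {G G' : Set E} (h : RP v G) (hG : G' ⊆ G) : RP v G' :=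
  ⟨h.1.mono hG, fun γ a b => h.2 γ a (hG b)⟩

lemma RP.congr {v w : E → ℝ} {G : Set E} (h : RP v G) (hG : IsOpen G) (hvw : ∀ z ∈ G, v z = w z) :
    RP w G :=
  ⟨fun z hz => (h.1 z hz).congr_of_eventuallyEq hz (eventually_mem_nhdsWithin.mono fun z hz y => by rw [hvw z hz]),
    fun γ a b => (h.2 γ a b).congr
    ((show ∀ᶠ t in 𝓝 0, γ t ∈ G from a.continuousAt (hG.mem_nhds b)).mono fun t ht => hvw _ ht)⟩

lemma RP.max {v w : E → ℝ} {G : Set E} (h : RP v G) (h' : RP w G) : RP (fun z => max (v z) (w z)) G :=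
  ⟨h.1.sup h'.1, fun γ a b => (h.2 γ a b).max (h'.2 γ a b)⟩

lemma RP.const (c : ℝ) (G : Set E) : RP (fun _ => c) G :=
  ⟨upperSemicontinuousOn_const, fun _ _ _ => subV_const c⟩

lemma RP.add_low {v g : E → ℝ} {G : Set E} (h : RP v G) (hg : ContinuousOn g G)
    (hl : ∀ γ : ℂ → E, AnalyticAt ℂ γ 0 → γ 0 ∈ G → LowH (fun t => g (γ t))) :
    RP (fun z => v z + g z) G :=
  ⟨h.1.add hg.upperSemicontinuousOn, fun γ a b => (h.2 γ a b).addLow (hl γ a b)⟩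

lemma RP.add_const {v : E → ℝ} {G : Set E} (h : RP v G) (c : ℝ) : RP (fun z => v z + c) G :=
  h.add_low continuousOn_const fun _ _ _ => LowH.const c

lemma RP.comp {v : E → ℝ} {G : Set E} (h : RP v G) {W : Set E'} (hW : IsOpen W) {F : E' → E}
    (hF : DifferentiableOn ℂ F W) (hm : MapsTo F W G) : RP (fun z => v (F z)) W := by
  refine ⟨fun z hz => ?_, fun γ a b => h.2 _ (analyticAt_comp hW hF a b) (hm b)⟩
  intro y hy
  exact ((hF.continuousOn z hz).tendsto_nhdsWithin hm) (h.1 (F z) (hm hz) y hy)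

lemma RP.of_local {v : E → ℝ} {G : Set E} (h : ∀ z ∈ G, ∃ U, IsOpen U ∧ z ∈ U ∧ RP v U) : RP v G := by
  refine ⟨fun z hz => ?_, fun γ a b => ?_⟩
  · obtain ⟨U, hU, hz', hv⟩ := h z hz
    have := hv.1 z hz'
    intro y hy
    have h2 := this y hy
    rw [hU.nhdsWithin_eq hz'] at h2
    exact h2.filter_mono nhdsWithin_le_nhds
  · obtain ⟨U, hU, hz', hv⟩ := h _ b
    exact hv.2 γ a hz'

lemma RP.disc {v : E → ℝ} {G : Set E} (h : RP v G) {K U : Set ℂ} (hK : IsCompact K) (hU : IsOpen U)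
    (hUK : U ⊆ K) {γ : ℂ → E} (hγ : ContinuousOn γ K) (hγU : DifferentiableOn ℂ γ U)
    (hm : MapsTo γ K G) {ρ : ℂ → ℝ} (hρc : ContinuousOn ρ K)
    (hρ : ∀ z ∈ U, LowH (fun t => ρ (z + t))) (hb : ∀ z ∈ K \ U, v (γ z) + ρ z ≤ 0) :
    ∀ z ∈ K, v (γ z) + ρ z ≤ 0 := by
  refine maxPrinciple hK (φ := fun z => v (γ z) + ρ z) ?_ hU hUK (fun z hz => ?_) hb
  · refine UpperSemicontinuousOn.add (fun z hz => ?_) hρc.upperSemicontinuousOn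
    intro y hy
    exact ((hγ z hz).tendsto_nhdsWithin hm) (h.1 (γ z) (hm hz) y hy)
  · refine SubV.addLow (h.2 (fun t => γ (z + t)) ?_ (by simpa using hm (hUK hz))) (hρ z hz)
    refine analyticAt_comp hU hγU (γ := fun t => z + t) (by fun_prop) (by simpa using hz)

lemma LowH.of_harmonic {h : ℂ → ℝ} {U : Set ℂ} (hh : HarmonicOnCC h U) {z : ℂ} (hz : z ∈ U) :
    LowH (fun t => - h (z + t)) := by
  obtain ⟨W, hW, hzW, -, f, hf, hfe⟩ := hh z hz
  have h1 : AnalyticAt ℂ (fun t => f (z + t)) 0 :=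
    analyticAt_comp hW hf (γ := fun t => z + t) (by fun_prop) (by simpa using hzW)
  refine (LowH.re h1.neg).of_le (by simp [hfe z hzW]) ?_
  filter_upwards [tendsto_add0 z (hW.mem_nhds hzW)] with t ht
  simp [hfe _ ht]

lemma RP.dom {v : E → ℝ} {G : Set E} (hv : RP v G) (a b : E) {c : ℂ} {r : ℝ}
    (hG : ∀ w ∈ closedBall c r, a + w • b ∈ G) {h : ℂ → ℝ} (hc : ContinuousOn h (closedBall c r))
    (hh : HarmonicOnCC h (ball c r)) (hs : ∀ z ∈ sphere c r, v (a + z • b) ≤ h z) :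
    ∀ z ∈ closedBall c r, v (a + z • b) ≤ h z := by
  intro z hz
  have := hv.disc (K := closedBall c r) (U := ball c r) (isCompact_closedBall c r) isOpen_ball
    ball_subset_closedBall (γ := fun w => a + w • b) (by fun_prop) (by fun_prop) hG
    (ρ := fun z => - h z) hc.neg (fun z hz => LowH.of_harmonic hh hz) (fun z hz => ?_) z hz
  · linarith
  · rw [closedBall_sdiff_ball] at hz
    linarith [hs z hz]
end RP
end

section
section SC
variable {E : Type*} [NormedAddCommGroup E]

def scv (ψ : E → ℝ) (Q : Set E) (κ : ℝ) (x : E) : ℝ := sSup ((fun y => ψ y - κ * ‖y - x‖) '' Q)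

lemma scv_attain {ψ : E → ℝ} {Q : Set E} (hQ : IsCompact Q) (hne : Q.Nonempty)
    (hψ : UpperSemicontinuousOn ψ Q) (κ : ℝ) (x : E) :
    ∃ y ∈ Q, scv ψ Q κ x = ψ y - κ * ‖y - x‖ ∧ ∀ y' ∈ Q, ψ y' - κ * ‖y' - x‖ ≤ scv ψ Q κ x := by
  have h1 : UpperSemicontinuousOn (fun y => ψ y + -(κ * ‖y - x‖)) Q :=
    hψ.add (ContinuousOn.upperSemicontinuousOn (by fun_prop))
  obtain ⟨y, hy, hm⟩ := h1.exists_isMaxOn hne hQ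
  have hG : IsGreatest ((fun y => ψ y - κ * ‖y - x‖) '' Q) (ψ y - κ * ‖y - x‖) := by
    refine ⟨⟨y, hy, rfl⟩, ?_⟩
    rintro _ ⟨y', hy', rfl⟩
    simpa [sub_eq_add_neg] using hm hy'
  refine ⟨y, hy, hG.csSup_eq, fun y' hy' => ?_⟩
  exact (hG.2 ⟨_, hy', rfl⟩).trans hG.csSup_eq.ge

lemma scv_ge {ψ : E → ℝ} {Q : Set E} (hQ : IsCompact Q)
    (hψ : UpperSemicontinuousOn ψ Q) (κ : ℝ) {x : E} (hx : x ∈ Q) : ψ x ≤ scv ψ Q κ x := by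
  obtain ⟨y, hy, h1, h2⟩ := scv_attain hQ ⟨x, hx⟩ hψ κ x
  simpa using h2 x hx

lemma scv_lip {ψ : E → ℝ} {Q : Set E} (hQ : IsCompact Q) (hne : Q.Nonempty)
    (hψ : UpperSemicontinuousOn ψ Q) {κ : ℝ} (hκ : 0 ≤ κ) (x x' : E) :
    scv ψ Q κ x ≤ scv ψ Q κ x' + κ * ‖x - x'‖ := by
  obtain ⟨y, hy, h1, h2⟩ := scv_attain hQ hne hψ κ x
  obtain ⟨y', hy', h1', h2'⟩ := scv_attain hQ hne hψ κ x'
  have h3 := h2' y hy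
  have h4 : ‖y - x'‖ ≤ ‖y - x‖ + ‖x - x'‖ := by
    simpa using norm_add_le (y - x) (x - x')
  have h5 := mul_le_mul_of_nonneg_left h4 hκ
  linarith

lemma scv_cont {ψ : E → ℝ} {Q : Set E} (hQ : IsCompact Q) (hne : Q.Nonempty)
    (hψ : UpperSemicontinuousOn ψ Q) {κ : ℝ} (hκ : 0 ≤ κ) : Continuous (scv ψ Q κ) := by
  have : LipschitzWith ⟨κ, hκ⟩ (scv ψ Q κ) := by
    refine LipschitzWith.of_le_add_mul _ fun x y => ?_
    rw [dist_eq_norm]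
    exact scv_lip hQ hne hψ hκ x y
  exact this.continuous

lemma scv_near {ψ : E → ℝ} {Q : Set E} (hQ : IsCompact Q)
    (hψ : UpperSemicontinuousOn ψ Q) {κ M s : ℝ} (hκ : 0 < κ) (hM : ∀ y ∈ Q, |ψ y| ≤ M)
    (hs : 2 * M < κ * s) {x : E} (hx : x ∈ Q) :
    ∃ y ∈ Q, ‖y - x‖ < s ∧ scv ψ Q κ x = ψ y - κ * ‖y - x‖ := by
  obtain ⟨y, hy, h1, h2⟩ := scv_attain hQ ⟨x, hx⟩ hψ κ x
  refine ⟨y, hy, ?_, h1⟩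
  have h3 := h2 x hx
  have h4 := abs_le.1 (hM x hx)
  have h5 := abs_le.1 (hM y hy)
  simp at h3
  refine lt_of_mul_lt_mul_left (a := κ) ?_ hκ.le
  linarith

lemma scv_lt {ψ : E → ℝ} {Q Z : Set E} (hQ : IsCompact Q) (hZ : IsCompact Z) (hZQ : Z ⊆ Q)
    (hψ : UpperSemicontinuousOn ψ Q) {M : ℝ} (hM : ∀ y ∈ Q, |ψ y| ≤ M) {τ : E → ℝ}
    (hτ : LowerSemicontinuousOn τ Z) (hlt : ∀ z ∈ Z, ψ z < τ z) :
    ∃ κ0 : ℝ, 0 < κ0 ∧ ∀ κ, κ0 ≤ κ → ∀ x ∈ Z, scv ψ Q κ x < τ x := by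
  have key : ∀ x0 ∈ Z, ∃ δ : ℝ, 0 < δ ∧ ∃ κ0 : ℝ, 0 < κ0 ∧ ∀ κ, κ0 ≤ κ → ∀ x ∈ Z, x ∈ ball x0 δ →
      scv ψ Q κ x < τ x := by
    intro x0 hx0
    obtain ⟨c, hc1, hc2⟩ := exists_between (hlt x0 hx0)
    have h1 := hψ x0 (hZQ hx0) c hc1
    have h2 := hτ x0 hx0 c hc2
    obtain ⟨δ1, hδ1, h1⟩ := Metric.mem_nhdsWithin_iff.1 h1
    obtain ⟨δ2, hδ2, h2⟩ := Metric.mem_nhdsWithin_iff.1 h2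
    set δ := min (δ1 / 2) δ2
    have hδ : 0 < δ := by positivity
    have hM0 : 0 ≤ M := (abs_nonneg _).trans (hM x0 (hZQ hx0))
    refine ⟨δ, hδ, (2 * M + 1) / δ, by positivity, fun κ hκ x hx hxb => ?_⟩
    have hκ0 : 0 < κ := lt_of_lt_of_le (by positivity) hκ
    rw [div_le_iff₀ hδ] at hκ
    obtain ⟨y, hy, hy1, hy2⟩ := scv_near hQ hψ hκ0 hM (s := δ) (by linarith) (hZQ hx)
    have h3 : ψ y < c := by
      refine h1 ⟨?_, hy⟩
      have e1 : dist y x < δ := by rwa [dist_eq_norm]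
      have e2 : dist x x0 < δ := hxb
      have e3 : δ ≤ δ1 / 2 := min_le_left _ _
      rw [mem_ball]
      linarith [dist_triangle y x x0]
    have h4 : c < τ x := h2 ⟨ball_subset_ball (min_le_right _ _) hxb, hx⟩
    have h5 : 0 ≤ κ * ‖y - x‖ := by positivity
    rw [hy2]; linarith
  refine hZ.induction_on (p := fun Z' => ∃ κ0 : ℝ, 0 < κ0 ∧ ∀ κ, κ0 ≤ κ → ∀ x ∈ Z', x ∈ Z → scv ψ Q κ x < τ x)
    ⟨1, one_pos, by simp⟩ ?_ ?_ ?_ |>.imp fun κ0 h => ⟨h.1, fun κ hκ x hx => h.2 κ hκ x hx hx⟩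
  · rintro s t hst ⟨κ0, h0, h⟩
    exact ⟨κ0, h0, fun κ hκ x hx => h κ hκ x (hst hx)⟩
  · rintro s t ⟨κ0, h0, h⟩ ⟨κ1, h1, h'⟩
    refine ⟨max κ0 κ1, by positivity, fun κ hκ x hx hxZ => ?_⟩
    rcases hx with hx | hx
    · exact h κ ((le_max_left _ _).trans hκ) x hx hxZ
    · exact h' κ ((le_max_right _ _).trans hκ) x hx hxZ
  · intro x0 hx0
    obtain ⟨δ, hδ, κ0, h0, h⟩ := key x0 hx0
    exact ⟨ball x0 δ, mem_nhdsWithin_of_mem_nhds (ball_mem_nhds _ hδ), κ0, h0,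
      fun κ hκ x hx hxZ => h κ hκ x hxZ hx⟩

lemma scv_RP [NormedSpace ℂ E] {ψ : E → ℝ} {Q G : Set E} (hQ : IsCompact Q) {κ M s : ℝ}
    (hκ : 0 < κ) (hψ : RP ψ Q) (hM : ∀ y ∈ Q, |ψ y| ≤ M) (hs : 2 * M < κ * s)
    (hG : ∀ x ∈ G, x ∈ Q ∧ ball x s ⊆ interior Q) : RP (scv ψ Q κ) G := by
  rcases G.eq_empty_or_nonempty with rfl | ⟨g, hg⟩
  · exact ⟨by intro x hx; simp at hx, by simp⟩
  have hne : Q.Nonempty := ⟨g, (hG g hg).1⟩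
  refine ⟨(scv_cont hQ hne hψ.1 hκ.le).upperSemicontinuous.upperSemicontinuousOn _, fun γ a b => ?_⟩
  obtain ⟨y, hy, hy1, hy2⟩ := scv_near hQ hψ.1 hκ hM hs (hG _ b).1
  have hyI : y ∈ interior Q := (hG _ b).2 (by simpa [dist_eq_norm] using hy1)
  have h1 : AnalyticAt ℂ (fun t => y + (γ t - γ 0)) 0 := analyticAt_const.add (a.sub analyticAt_const)
  have h2 := (hψ.2 _ h1 (by simpa using hy)).addLow (LowH.const (-(κ * ‖y - γ 0‖)))
  refine h2.of_le (by simp [hy2]; ring) ?_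
  have h3 : ∀ᶠ t in 𝓝 (0 : ℂ), y + (γ t - γ 0) ∈ interior Q :=
    h1.continuousAt (isOpen_interior.mem_nhds (by simpa using hyI))
  filter_upwards [h3] with t ht
  obtain ⟨y', -, -, h5⟩ := scv_attain hQ hne hψ.1 κ (γ t)
  have := h5 _ (interior_subset ht)
  rw [show y + (γ t - γ 0) - γ t = y - γ 0 by abel] at this
  linarith
end SC
end

section
section LD

lemma fourier_approx {r : ℝ} (hr : 0 < r) {φ : ℂ → ℝ} (hφ : ContinuousOn φ (sphere 0 r)) {ε : ℝ} (hε : 0 < ε) :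
    ∃ f : ℂ → ℂ, Differentiable ℂ f ∧ ∀ z ∈ sphere (0 : ℂ) r, |φ z - (f z).re| < ε := by
  haveI : Fact (0 < 2 * Real.pi) := ⟨by positivity⟩
  have hcirc : ∀ θ : AddCircle (2 * Real.pi), (r : ℂ) * (AddCircle.toCircle θ : ℂ) ∈ sphere (0 : ℂ) r := by
    intro θ; rw [mem_sphere_zero_iff_norm, norm_mul, Circle.norm_coe]; simp [abs_of_pos hr]
  let Φ : C(AddCircle (2 * Real.pi), ℂ) := ⟨fun θ => (φ (r * (AddCircle.toCircle θ : ℂ)) : ℂ), by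
    refine Complex.continuous_ofReal.comp (hφ.comp_continuous ?_ hcirc)
    exact continuous_const.mul (continuous_subtype_val.comp AddCircle.continuous_toCircle)⟩
  have hΦ : Φ ∈ closure ((Submodule.span ℂ (range (@fourier (2 * Real.pi)))) : Set _) := by
    rw [← Submodule.topologicalClosure_coe, span_fourier_closure_eq_top]; trivial
  obtain ⟨P, hP, hd⟩ := Metric.mem_closure_iff.1 hΦ ε hε
  have key : ∃ f g : ℂ → ℂ, Differentiable ℂ f ∧ Differentiable ℂ g ∧ ∀ θ : AddCircle (2 * Real.pi),
      P θ = f (r * (AddCircle.toCircle θ : ℂ)) + starRingEnd ℂ (g (r * (AddCircle.toCircle θ : ℂ))) := by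
    clear hd
    have hr' : (r : ℂ) ≠ 0 := by exact_mod_cast hr.ne'
    induction hP using Submodule.span_induction with
    | mem x hx =>
      obtain ⟨n, rfl⟩ := hx
      obtain ⟨n, rfl | rfl⟩ := n.eq_nat_or_neg
      · refine ⟨fun z => (z / r) ^ n, fun _ => 0, by fun_prop, by fun_prop, fun θ => ?_⟩
        simp [fourier_apply, hr', AddCircle.toCircle_nsmul]
      · refine ⟨fun _ => 0, fun z => (z / r) ^ n, by fun_prop, by fun_prop, fun θ => ?_⟩
        rw [fourier_neg]
        simp [fourier_apply, hr', AddCircle.toCircle_nsmul]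
    | zero => exact ⟨fun _ => 0, fun _ => 0, by fun_prop, by fun_prop, by simp⟩
    | add x y _ _ hx hy =>
      obtain ⟨f, g, hf, hg, h⟩ := hx
      obtain ⟨f', g', hf', hg', h'⟩ := hy
      exact ⟨f + f', g + g', hf.add hf', hg.add hg', fun θ => by simp [h, h']; ring⟩
    | smul c x _ hx =>
      obtain ⟨f, g, hf, hg, h⟩ := hx
      exact ⟨fun z => c * f z, fun z => starRingEnd ℂ c * g z, by fun_prop, by fun_prop, fun θ => by
        simp [h]; ring⟩
  obtain ⟨f, g, hf, hg, h⟩ := key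
  refine ⟨fun z => f z + g z, hf.add hg, fun z hz => ?_⟩
  have hz' : ‖z‖ = r := by simpa using hz
  have hr' : (r : ℂ) ≠ 0 := by exact_mod_cast hr.ne'
  obtain ⟨θ, hθ⟩ : ∃ θ : AddCircle (2 * Real.pi), (r : ℂ) * (AddCircle.toCircle θ : ℂ) = z := by
    have hm : z / r ∈ Submonoid.unitSphere ℂ := by
      simp [Submonoid.unitSphere, hz', abs_of_pos hr, hr.ne']
    obtain ⟨θ, hθ⟩ := (AddCircle.homeomorphCircle (T := 2 * Real.pi) (by positivity)).surjective ⟨z / r, hm⟩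
    refine ⟨θ, ?_⟩
    rw [AddCircle.homeomorphCircle_apply] at hθ
    rw [hθ]; simp; field_simp
  have h1 := (ContinuousMap.dist_apply_le_dist (f := Φ) (g := P) θ).trans_lt hd
  rw [h θ, hθ, Complex.dist_eq] at h1
  have h2 := (Complex.abs_re_le_norm _).trans_lt h1
  simpa [Φ, hθ] using h2

lemma circleAvg_re {f : ℂ → ℂ} {r : ℝ} (hr : 0 < r) (hf : DiffContOnCl ℂ f (ball 0 r)) :
    Real.circleAverage (fun z => (f z).re) 0 r = (f 0).re := by
  have h1 := (DiffContOnCl.circleAverage (c := 0) (R := r) (by rwa [abs_of_pos hr]) : _ = f 0)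
  rw [← h1]
  have h2 : CircleIntegrable f 0 r := ContinuousOn.circleIntegrable hr.le
    (hf.continuousOn.mono (by rw [closure_ball _ hr.ne']; exact sphere_subset_closedBall))
  exact (Complex.reCLM).circleAverage_comp_comm h2

lemma submean_of_dom {r : ℝ} (hr : 0 < r) {φ : ℂ → ℝ} (hφ : ContinuousOn φ (sphere 0 r))
    (hd : ∀ h : ℂ → ℝ, ContinuousOn h (closedBall 0 r) → HarmonicOnCC h (ball 0 r) →
      (∀ z ∈ sphere (0 : ℂ) r, φ z ≤ h z) → φ 0 ≤ h 0) :
    φ 0 ≤ Real.circleAverage φ 0 r := by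
  refine le_of_forall_pos_le_add fun ε hε => ?_
  obtain ⟨f, hf, hfe⟩ := fourier_approx hr hφ (half_pos hε)
  have h1 := hd (fun z => (f z).re + ε / 2) (by have := hf.continuous; fun_prop)
    (fun z hz => ⟨ball 0 r, isOpen_ball, hz, Subset.rfl, fun z => f z + (ε / 2 : ℝ),
      by fun_prop, fun w _ => by simp⟩) (fun z hz => by linarith [abs_lt.1 (hfe z hz)])
  have h2 : Real.circleAverage (fun z => (f z).re + (-(ε / 2))) 0 r ≤ Real.circleAverage φ 0 r := by
    refine Real.circleAverage_mono (ContinuousOn.circleIntegrable hr.le (by have := hf.continuous; fun_prop))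
      (hφ.circleIntegrable hr.le) fun z hz => ?_
    rw [abs_of_pos hr] at hz
    linarith [abs_lt.1 (hfe z hz)]
  have h3 := circleAvg_re hr (f := fun z => f z + ((-(ε / 2) : ℝ) : ℂ))
    (Differentiable.diffContOnCl (by fun_prop))
  simp only [Complex.add_re, Complex.ofReal_re] at h3
  rw [h3] at h2
  linarith

variable {E : Type*} [NormedAddCommGroup E] [NormedSpace ℂ E]

def LineDom (v : E → ℝ) (V : Set E) : Prop :=
  ∀ (a b : E) (r : ℝ), 0 < r → (∀ w ∈ closedBall (0 : ℂ) r, a + w • b ∈ V) →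
    ∀ h : ℂ → ℝ, ContinuousOn h (closedBall 0 r) → HarmonicOnCC h (ball 0 r) →
      (∀ z ∈ sphere (0 : ℂ) r, v (a + z • b) ≤ h z) → v a ≤ h 0

def LineMean (v : E → ℝ) (V : Set E) : Prop :=
  ∀ (a b : E) (r : ℝ), 0 < r → (∀ w ∈ closedBall (0 : ℂ) r, a + w • b ∈ V) →
    v a ≤ Real.circleAverage (fun z => v (a + z • b)) 0 r

lemma scv_mean {g : E → ℝ} {Q V : Set E} (hQ : IsCompact Q) {κ M s : ℝ}
    (hκ : 0 < κ) (hg : UpperSemicontinuousOn g Q) (hgd : LineDom g Q) (hM : ∀ y ∈ Q, |g y| ≤ M)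
    (hs : 2 * M < κ * s) (hV : ∀ x ∈ V, ball x s ⊆ Q) (hVQ : V ⊆ Q) : LineMean (scv g Q κ) V := by
  intro a b r hr hw
  have haV : a ∈ V := by simpa using hw 0 (by simp [hr.le])
  have hc := scv_cont hQ ⟨a, hVQ haV⟩ hg hκ.le
  refine le_trans (le_of_eq (by simp)) (submean_of_dom hr (φ := fun z => scv g Q κ (a + z • b))
    (by fun_prop) fun h hh1 hh2 hh3 => ?_)
  obtain ⟨y, hy, hy1, hy2⟩ := scv_near hQ hg hκ hM hs (hVQ haV)
  have key : ∀ z : ℂ, z ∈ closedBall (0 : ℂ) r → y + z • b ∈ Q := fun z hz =>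
    hV _ (hw z hz) (by rw [mem_ball, dist_eq_norm]; simpa using hy1)
  have := hgd y b r hr key (fun z => h z + κ * ‖y - a‖) (by fun_prop) (fun z hz => ?_) (fun z hz => ?_)
  · simp only [zero_smul, add_zero]
    rw [hy2]; linarith
  · obtain ⟨W, h1, h2, h3, f, h4, h5⟩ := hh2 z hz
    exact ⟨W, h1, h2, h3, fun z => f z + (κ * ‖y - a‖ : ℝ), by fun_prop, fun w hw => by
      rw [Complex.add_re, Complex.ofReal_re, ← h5 w hw]⟩
  · obtain ⟨y', -, -, h5⟩ := scv_attain hQ ⟨a, hVQ haV⟩ hg κ (a + z • b)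
    have h6 := h5 _ (key z (sphere_subset_closedBall hz))
    have h7 := hh3 z hz
    rw [show y + z • b - (a + z • b) = y - a by abel] at h6
    linarith

lemma conv_mean [FiniteDimensional ℂ E] [MeasurableSpace E] [BorelSpace E] {v : E → ℝ} (hv : Continuous v)
    {V V' : Set E} (hm : LineMean v V) {χ : E → ℝ} (hχ : Continuous χ) (hχ0 : ∀ x, 0 ≤ χ x) {η : ℝ}
    (hχs : ∀ y, χ y ≠ 0 → ‖y‖ ≤ η) (hV : ∀ x ∈ V', ∀ y, ‖y‖ ≤ η → x - y ∈ V)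
    (μ : Measure E) [IsFiniteMeasureOnCompacts μ] :
    LineMean (fun x => ∫ y, χ y * v (x - y) ∂μ) V' := by
  haveI : FiniteDimensional ℝ E := FiniteDimensional.complexToReal E
  haveI : ProperSpace E := FiniteDimensional.proper ℝ E
  intro a b r hr hw
  have hpi : 0 < 2 * Real.pi := by positivity
  have hint : ∀ g : E → ℝ, Continuous g → Integrable (fun y => χ y * g y) μ := fun g hg => by
    refine Continuous.integrable_of_hasCompactSupport (hχ.mul hg) ?_
    exact HasCompactSupport.intro (isCompact_closedBall (0 : E) η) fun y hy => by
      by_contra h; exact hy (by simpa using hχs y (left_ne_zero_of_mul h))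
  let K : ℝ × E → ℝ := fun p => χ p.2 * v (a + circleMap 0 r p.1 • b - p.2)
  have hK : Continuous K := by
    have : Continuous fun p : ℝ × E => circleMap 0 r p.1 := (continuous_circleMap 0 r).comp continuous_fst
    fun_prop
  have hKi : Integrable K ((volume.restrict (Ioc 0 (2 * Real.pi))).prod μ) := by
    have h1 : IntegrableOn K (Icc 0 (2 * Real.pi) ×ˢ closedBall 0 η) (volume.prod μ) :=
      hK.continuousOn.integrableOn_compact (isCompact_Icc.prod (isCompact_closedBall _ _))
    have h2 : IntegrableOn K (Ioc 0 (2 * Real.pi) ×ˢ univ) (volume.prod μ) := by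
      refine h1.of_forall_diff_eq_zero (measurableSet_Ioc.prod MeasurableSet.univ) ?_
      rintro ⟨θ, y⟩ ⟨h3, h4⟩
      by_contra h
      exact h4 ⟨Ioc_subset_Icc_self h3.1, by simpa using hχs y (left_ne_zero_of_mul h)⟩
    rwa [IntegrableOn, ← Measure.prod_restrict, Measure.restrict_univ] at h2
  rw [Real.circleAverage_def, intervalIntegral.integral_of_le hpi.le]
  have hsw := integral_integral_swap (f := fun θ y => K (θ, y)) hKi
  simp only [K] at hsw
  simp only
  rw [hsw, smul_eq_mul, ← integral_const_mul]
  refine integral_mono (hint _ (by fun_prop)) (hKi.integral_prod_right.const_mul _) fun y => ?_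
  simp only [K]
  rw [integral_const_mul, mul_left_comm]
  by_cases hy : χ y = 0
  · simp [hy]
  refine mul_le_mul_of_nonneg_left ?_ (hχ0 y)
  have h5 := hm (a - y) b r hr fun w hw' => by
    have := hV _ (hw w hw') y (hχs y hy)
    rwa [show a - y + w • b = a + w • b - y by abel]
  rw [Real.circleAverage_def, intervalIntegral.integral_of_le hpi.le, smul_eq_mul] at h5
  simp only [show ∀ θ, a + circleMap 0 r θ • b - y = a - y + circleMap 0 r θ • b from
    fun θ => by abel]
  exact h5

lemma C1_subV [CompleteSpace E] {Φ : E → ℝ} (hΦ : ContDiff ℝ 1 Φ) {V : Set E} (hV : IsOpen V) (hm : LineMean Φ V)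
    {γ : ℂ → E} (hγ : AnalyticAt ℂ γ 0) (h0 : γ 0 ∈ V) : SubV (fun t => Φ (γ t)) := by
  intro f hf ε hε hf0 hle
  set b := deriv γ 0
  set β : ℂ → E := fun t => γ t - γ 0 - t • b with hβ
  have hβa : AnalyticAt ℂ β 0 := by
    exact (hγ.sub analyticAt_const).sub (analyticAt_id.smul analyticAt_const)
  have hβ0 : β 0 = 0 := by simp [hβ]
  obtain ⟨C, hC⟩ : ∃ C : ℝ, ∀ᶠ t in 𝓝 (0 : ℂ), ‖β t‖ ≤ C * ‖t‖ ^ 2 := by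
    have hβd : deriv β 0 = 0 := by
      have h1 : HasDerivAt β (b - (1 : ℂ) • b) 0 := by
        refine HasDerivAt.sub (hγ.differentiableAt.hasDerivAt.sub_const _) ?_
        exact (hasDerivAt_id (0 : ℂ)).smul_const b
      simpa using h1.deriv
    have h2 : (2 : ℕ) ≤ analyticOrderAt β 0 := by
      rw [natCast_le_analyticOrderAt_iff_iteratedDeriv_eq_zero hβa]
      intro i hi
      interval_cases i
      · simpa using hβ0
      · simpa [iteratedDeriv_one] using hβd
    obtain ⟨g, hg, hge⟩ := (natCast_le_analyticOrderAt hβa).1 h2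
    refine ⟨‖g 0‖ + 1, ?_⟩
    have h3 : ∀ᶠ t in 𝓝 (0 : ℂ), ‖g t‖ < ‖g 0‖ + 1 :=
      hg.continuousAt.norm.eventually (gt_mem_nhds (by simp))
    filter_upwards [hge, h3] with t h4 h5
    rw [h4, norm_smul, mul_comm]
    simp only [sub_zero, norm_pow]
    gcongr
  have hst := hΦ.contDiffAt.hasStrictFDerivAt (x := γ 0) one_ne_zero
  set D := fderiv ℝ Φ (γ 0)
  set c := ε / (2 * (|C| + 1))
  have hc : 0 < c := by positivity
  have hcC : c * C ≤ ε / 2 := by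
    have : c * (|C| + 1) = ε / 2 := by simp only [c]; field_simp
    nlinarith [le_abs_self C]
  have h3 := hst.isLittleO.def hc
  have h4 : Tendsto (fun t : ℂ => (γ t, γ 0 + t • b)) (𝓝 0) (𝓝 (γ 0, γ 0)) := by
    refine hγ.continuousAt.tendsto.prodMk_nhds ?_
    have : Continuous fun t : ℂ => γ 0 + t • b := by fun_prop
    simpa using this.tendsto 0
  have h5 := h4.eventually h3
  set DC : E →L[ℂ] ℂ := StrongDual.extendRCLike (𝕜 := ℂ) D
  have hDC : ∀ x, (DC x).re = D x := fun x => StrongDual.re_extendRCLike_apply (𝕜 := ℂ) D x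
  have hga : AnalyticAt ℂ (fun t => f t - DC (β t)) 0 :=
    hf.sub ((DC.analyticAt _).comp hβa)
  have h6 : ∀ᶠ t in 𝓝 (0 : ℂ), Φ (γ 0 + t • b) ≤ (f t - DC (β t)).re - ε / 2 * ‖t‖ ^ 2 := by
    filter_upwards [h5, hC, hle] with t h7 h8 h9
    simp only [show γ t - (γ 0 + t • b) = β t by simp [hβ]; abel, Real.norm_eq_abs] at h7
    have h10 := (abs_le.1 h7).1
    have h11 := mul_le_mul_of_nonneg_left h8 hc.le
    have h12 := mul_le_mul_of_nonneg_right hcC (sq_nonneg ‖t‖)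
    rw [Complex.sub_re, hDC]
    nlinarith
  have h7 : ∀ᶠ t in 𝓝 (0 : ℂ), γ 0 + t • b ∈ V := by
    have : Continuous fun t : ℂ => γ 0 + t • b := by fun_prop
    exact this.continuousAt (hV.mem_nhds (by simpa using h0))
  obtain ⟨r, hr, h8⟩ := Metric.nhds_basis_closedBall.eventually_iff.1
    (h6.and (h7.and (hga.eventually_analyticAt)))
  have h9 := hm (γ 0) b r hr fun w hw => (h8 hw).2.1
  have hdc : DiffContOnCl ℂ (fun t => f t - DC (β t) - ((ε / 2 * r ^ 2 : ℝ) : ℂ)) (ball 0 r) := by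
    refine DifferentiableOn.diffContOnCl ?_
    rw [closure_ball _ hr.ne']
    exact fun t ht => ((h8 ht).2.2.differentiableAt.sub_const _).differentiableWithinAt
  have h10 := circleAvg_re hr hdc
  have h11 : Real.circleAverage (fun z => Φ (γ 0 + z • b)) 0 r ≤
      Real.circleAverage (fun t => (f t - DC (β t) - ((ε / 2 * r ^ 2 : ℝ) : ℂ)).re) 0 r := by
    refine Real.circleAverage_mono (ContinuousOn.circleIntegrable hr.le
      (by have := hΦ.continuous; fun_prop)) (ContinuousOn.circleIntegrable hr.le ?_) fun z hz => ?_
    · refine Complex.continuous_re.comp_continuousOn (hdc.continuousOn.mono ?_)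
      rw [closure_ball _ hr.ne']; exact sphere_subset_closedBall
    · rw [abs_of_pos hr] at hz
      have h12 := (h8 (sphere_subset_closedBall hz)).1
      rw [mem_sphere_zero_iff_norm.1 hz] at h12
      rwa [Complex.sub_re, Complex.ofReal_re]
  rw [h10, hβ0, Complex.sub_re, Complex.ofReal_re, map_zero, sub_zero, hf0] at h11
  have : 0 < ε / 2 * r ^ 2 := by positivity
  linarith
end LD
end

section
section LD2
variable {E : Type*} [NormedAddCommGroup E] [NormedSpace ℂ E]

lemma smooth_approx [FiniteDimensional ℂ E] {v : E → ℝ} {κ : ℝ} (hκ : 0 < κ)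
    (hv : ∀ x x', v x ≤ v x' + κ * ‖x - x'‖) {V V' : Set E} (hm : LineMean v V) {η : ℝ} (hη : 0 < η)
    (hV : ∀ x ∈ V', ∀ y, ‖y‖ ≤ η → x - y ∈ V) :
    ∃ Φ : E → ℝ, ContDiff ℝ 1 Φ ∧ LineMean Φ V' ∧ ∀ x, |Φ x - v x| ≤ κ * η := by
  letI : MeasurableSpace E := borel E
  haveI : BorelSpace E := ⟨rfl⟩
  haveI : FiniteDimensional ℝ E := FiniteDimensional.complexToReal E
  haveI : ProperSpace E := FiniteDimensional.proper ℝ E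
  let μ : Measure E := Measure.addHaar
  have hvc : Continuous v := by
    have : LipschitzWith ⟨κ, hκ.le⟩ v := by
      refine LipschitzWith.of_le_add_mul _ fun x y => ?_
      rw [dist_eq_norm]; exact hv x y
    exact this.continuous
  let χ : ContDiffBump (0 : E) := ⟨η / 2, η, by positivity, by linarith⟩
  have hs : ∀ y, χ.normed μ y ≠ 0 → ‖y‖ ≤ η := fun y hy => by
    have : y ∈ Function.support (χ.normed μ) := hy
    rw [χ.support_normed_eq] at this
    exact (by simpa [χ] using this : ‖y‖ < η).le
  have he : (fun x => ∫ y, χ.normed μ y * v (x - y) ∂μ) =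
      convolution (χ.normed μ) v (ContinuousLinearMap.lsmul ℝ ℝ) μ := by
    ext x; rw [convolution_lsmul]; rfl
  refine ⟨fun x => ∫ y, χ.normed μ y * v (x - y) ∂μ, ?_, ?_, fun x => ?_⟩
  · rw [he]
    exact HasCompactSupport.contDiff_convolution_left _ χ.hasCompactSupport_normed χ.contDiff_normed
      hvc.locallyIntegrable
  · exact conv_mean hvc hm χ.continuous_normed χ.nonneg_normed hs hV μ
  · have := χ.dist_normed_convolution_le (μ := μ) (g := v) (x₀ := x) (ε := κ * η) hvc.aestronglyMeasurable
      (fun y hy => by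
        have hy' : ‖y - x‖ < η := by simpa [χ, dist_eq_norm] using hy
        rw [Real.dist_eq, abs_le]
        have h1 := hv x y
        have h2 := hv y x
        rw [norm_sub_rev] at h1
        constructor <;> nlinarith)
    rw [← he, Real.dist_eq] at this
    exact this

lemma usc_bdd {g : E → ℝ} {Q : Set E} (hQ : IsCompact Q) (hg : UpperSemicontinuousOn g Q) {N : ℝ}
    (hN : ∀ y ∈ Q, -N ≤ g y) : ∃ M, ∀ y ∈ Q, |g y| ≤ M := by
  obtain ⟨C, hC⟩ := hg.bddAbove_of_isCompact hQ
  refine ⟨max C N, fun y hy => abs_le.2 ⟨?_, ?_⟩⟩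
  · linarith [hN y hy, le_max_right C N]
  · exact (hC (mem_image_of_mem g hy)).trans (le_max_left _ _)

lemma LineDom.RP [FiniteDimensional ℂ E] {g : E → ℝ} {V : Set E} (hV : IsOpen V)
    (hg : UpperSemicontinuousOn g V) (hd : LineDom g V) {N : ℝ} (hN : ∀ y ∈ V, -N ≤ g y) :
    RP g V := by
  haveI : FiniteDimensional ℝ E := FiniteDimensional.complexToReal E
  haveI : ProperSpace E := FiniteDimensional.proper ℝ E
  haveI : CompleteSpace E := FiniteDimensional.complete ℂ E
  refine ⟨hg, fun γ hγ h0 f hf ε hε hf0 hle => ?_⟩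
  set z0 := γ 0 with hz0
  obtain ⟨ρ', hρ', hQV'⟩ := Metric.nhds_basis_closedBall.mem_iff.1 (hV.mem_nhds h0)
  set ρ := ρ' / 3 with hρdef
  have hρ : 0 < ρ := by positivity
  set Q := closedBall z0 (3 * ρ) with hQdef
  have hQV : Q ⊆ V := by rw [hQdef, hρdef, mul_div_cancel₀ _ (by norm_num)]; exact hQV'
  have hQ : IsCompact Q := isCompact_closedBall _ _
  have hgQ := hg.mono hQV
  obtain ⟨M, hM⟩ := usc_bdd hQ hgQ fun y hy => hN y (hQV hy)
  obtain ⟨r, hr, hr1⟩ := Metric.nhds_basis_closedBall.eventually_iff.1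
    (hle.and (((show ∀ᶠ t in 𝓝 0, γ t ∈ ball z0 ρ from hγ.continuousAt (ball_mem_nhds _ hρ))).and
      (hγ.eventually_analyticAt.and hf.eventually_analyticAt)))
  have hγc : ContinuousOn γ (closedBall 0 r) := fun t ht => (hr1 ht).2.2.1.continuousAt.continuousWithinAt
  have hfc : ContinuousOn f (closedBall 0 r) := fun t ht => (hr1 ht).2.2.2.continuousAt.continuousWithinAt
  set T := sphere (0 : ℂ) r
  have hT : IsCompact T := isCompact_sphere _ _
  set Z : Set (E × ℂ) := (fun t => (γ t, t)) '' T
  have hZ : IsCompact Z := hT.image_of_continuousOn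
    ((hγc.mono sphere_subset_closedBall).prodMk continuousOn_id)
  obtain ⟨κ0, hκ0, hκ⟩ := scv_lt (ψ := fun p : E × ℂ => g p.1) (hQ.prod hT) hZ (by
      rintro _ ⟨t, ht, rfl⟩
      refine ⟨?_, ht⟩
      have := (hr1 (sphere_subset_closedBall ht)).2.1
      exact closedBall_subset_closedBall (by linarith) (ball_subset_closedBall this))
    (by
      intro p hp y hy
      exact (continuous_fst.continuousWithinAt.tendsto_nhdsWithin (fun q hq => hq.1)) (hgQ p.1 hp.1 y hy))
    (M := M) (fun p hp => hM _ hp.1) (τ := fun p => (f p.2).re - ε * r ^ 2 / 2) (by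
      refine ContinuousOn.lowerSemicontinuousOn ?_
      have : ContinuousOn (fun p : E × ℂ => f p.2) Z := hfc.comp continuousOn_snd (by
        rintro _ ⟨t, ht, rfl⟩; exact sphere_subset_closedBall ht)
      exact (Complex.continuous_re.comp_continuousOn this).sub continuousOn_const)
    (by
      rintro _ ⟨t, ht, rfl⟩
      have := (hr1 (sphere_subset_closedBall ht)).1
      rw [mem_sphere_zero_iff_norm.1 ht] at this
      simp only
      have : 0 < ε * r ^ 2 := by positivity
      linarith)
  set κ := max κ0 (2 * (|M| + 1) / ρ) with hκdef
  have hκp : 0 < κ := lt_of_lt_of_le hκ0 (le_max_left _ _)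
  have hκs : 2 * M < κ * ρ := by
    have : 2 * (|M| + 1) / ρ ≤ κ := le_max_right _ _
    rw [div_le_iff₀ hρ] at this
    linarith [le_abs_self M]
  have hz0Q : z0 ∈ Q := mem_closedBall_self (by positivity)
  have hvT : ∀ t ∈ T, scv g Q κ (γ t) < (f t).re - ε * r ^ 2 / 2 := by
    intro t ht
    refine lt_of_le_of_lt ?_ (hκ κ (le_max_left _ _) (γ t, t) ⟨t, ht, rfl⟩)
    obtain ⟨y, hy, h1, -⟩ := scv_attain hQ ⟨z0, hz0Q⟩ hgQ κ (γ t)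
    obtain ⟨-, -, -, h4⟩ := scv_attain (ψ := fun p : E × ℂ => g p.1) (hQ.prod hT) ⟨(y, t), hy, ht⟩ (by
      intro p hp y hy
      exact (continuous_fst.continuousWithinAt.tendsto_nhdsWithin (fun q hq => hq.1)) (hgQ p.1 hp.1 y hy))
      κ (γ t, t)
    have := h4 (y, t) ⟨hy, ht⟩
    rw [h1]; simpa [Prod.norm_def] using this
  have hmean : LineMean (scv g Q κ) (ball z0 (2 * ρ)) := by
    refine scv_mean hQ hκp hgQ (fun a b r hr hw => hd a b r hr fun w h => hQV (hw w h)) hM hκs ?_ ?_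
    · intro x hx y hy
      have h1 := dist_triangle y x z0
      simp only [mem_ball, hQdef, mem_closedBall] at *
      linarith
    · exact fun x hx => closedBall_subset_closedBall (by linarith) (ball_subset_closedBall hx)
  set η := min (ρ / 2) (ε * r ^ 2 / 8 / κ) with hηdef
  have hη : 0 < η := by positivity
  have hκη : κ * η ≤ ε * r ^ 2 / 8 := by
    have : η ≤ ε * r ^ 2 / 8 / κ := min_le_right _ _
    rw [le_div_iff₀ hκp] at this; linarith
  obtain ⟨Φ, hΦ1, hΦ2, hΦ3⟩ := smooth_approx hκp (fun x x' => scv_lip hQ ⟨z0, hz0Q⟩ hgQ hκp.le x x')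
    hmean (V' := ball z0 (3 / 2 * ρ)) hη (by
      intro x hx y hy
      have h1 : ‖x - y - z0‖ ≤ ‖x - z0‖ + ‖y‖ := by
        rw [show x - y - z0 = (x - z0) - y by abel]; exact norm_sub_le _ _
      have : η ≤ ρ / 2 := min_le_left _ _
      simp only [mem_ball, dist_eq_norm] at *
      linarith)
  have hΦc := hΦ1.continuous
  have hmp := maxPrinciple (isCompact_closedBall (0 : ℂ) r) (U := ball 0 r)
    (φ := fun t => Φ (γ t) + (-(f t).re + 3 * ε * r ^ 2 / 8)) (by
      refine ContinuousOn.upperSemicontinuousOn ?_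
      exact (hΦc.comp_continuousOn hγc).add
        ((Complex.continuous_re.comp_continuousOn hfc).neg.add continuousOn_const))
    isOpen_ball ball_subset_closedBall (fun t ht => by
      have hm := hr1 (ball_subset_closedBall ht)
      have hg1 : AnalyticAt ℂ (fun s => γ (t + s)) 0 := by
        refine AnalyticAt.comp' (g := γ) (f := fun s => t + s) ?_ (by fun_prop)
        simpa using hm.2.2.1
      have hf1 : AnalyticAt ℂ (fun s => f (t + s)) 0 := by
        refine AnalyticAt.comp' (g := f) (f := fun s => t + s) ?_ (by fun_prop)
        simpa using hm.2.2.2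
      refine SubV.addLow (C1_subV hΦ1 isOpen_ball hΦ2 hg1 ?_) ?_
      · simp only [add_zero]; exact ball_subset_ball (by linarith) hm.2.1
      · have := (LowH.re hf1.neg).add (LowH.const (3 * ε * r ^ 2 / 8))
        simpa using this)
    (by
      intro t ht
      rw [closedBall_sdiff_ball] at ht
      have h1 := hvT t ht
      have h2 := (abs_le.1 (hΦ3 (γ t))).2
      linarith) 0 (mem_closedBall_self hr.le)
  beta_reduce at hmp
  rw [hf0, ← hz0] at hmp
  have h1 := (abs_le.1 (hΦ3 z0)).1
  have h2 := scv_ge hQ hgQ κ hz0Q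
  have : 0 < ε * r ^ 2 := by positivity
  linarith

lemma coe_trunc {x : EReal} (hx : x < ⊤) (N : ℝ) :
    (((max x ((-N : ℝ) : EReal)).toReal : ℝ) : EReal) = max x ((-N : ℝ) : EReal) := by
  refine EReal.coe_toReal ?_ ?_
  · exact (max_lt hx (EReal.coe_lt_top _)).ne
  · exact (lt_of_lt_of_le (EReal.bot_lt_coe _) (le_max_right _ _)).ne'

lemma trunc_RP [FiniteDimensional ℂ E] {V : Set E} (hV : IsOpen V) {ψ : E → EReal}
    (h1 : ∀ z ∈ V, ψ z < ⊤) (h2 : UpperSemicontinuousOn ψ V)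
    (h3 : ∀ a b : E, SubharmonicOnCC (fun w : ℂ => ψ (a + w • b)) {w : ℂ | a + w • b ∈ V}) (N : ℝ) :
    RP (fun z => (max (ψ z) ((-N : ℝ) : EReal)).toReal) V := by
  haveI : CompleteSpace E := FiniteDimensional.complete ℂ E
  refine LineDom.RP hV ?_ ?_ (N := N) ?_
  · intro z hz y hy
    have hy' : max (ψ z) ((-N : ℝ) : EReal) < (y : EReal) := by
      rw [← coe_trunc (h1 z hz) N]; exact_mod_cast hy
    rw [max_lt_iff] at hy'
    filter_upwards [h2 z hz y hy'.1, self_mem_nhdsWithin] with w hw hwV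
    have : max (ψ w) ((-N : ℝ) : EReal) < (y : EReal) := max_lt hw hy'.2
    rw [← coe_trunc (h1 w hwV) N] at this
    exact_mod_cast this
  · intro a b r hr hw h hc hh hs
    have haV : a ∈ V := by simpa using hw 0 (by simp [hr.le])
    have hs' : ∀ z ∈ sphere (0 : ℂ) r, max (ψ (a + z • b)) ((-N : ℝ) : EReal) ≤ h z := by
      intro z hz
      rw [← coe_trunc (h1 _ (hw z (sphere_subset_closedBall hz))) N]
      exact_mod_cast hs z hz
    have h4 := (h3 a b).2 0 r hr hw h hc hh (fun z hz => (le_max_left _ _).trans (hs' z hz)) 0 (by simp [hr.le])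
    have h5 := (RP.const (E := E) (-N) V).dom a b hw hc hh (fun z hz => by
      exact_mod_cast (le_max_right _ _).trans (hs' z hz)) 0 (by simp [hr.le])
    simp only [zero_smul, add_zero] at h4
    have : max (ψ a) ((-N : ℝ) : EReal) ≤ h 0 := max_le h4 (by exact_mod_cast h5)
    rw [← coe_trunc (h1 a haV) N] at this
    exact_mod_cast this
  · intro y hy
    have := le_max_right (ψ y) ((-N : ℝ) : EReal)
    rw [← coe_trunc (h1 y hy) N] at this
    exact_mod_cast this
end LD2
end

section
section BB
variable {H : Type*} [NormedAddCommGroup H] [InnerProductSpace ℂ H] [FiniteDimensional ℂ H]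

instance instCompleteFD [CompleteSpace ℂ] : CompleteSpace H := FiniteDimensional.complete ℂ H

lemma LowH_qnorm {γ : ℂ → H} (hγ : AnalyticAt ℂ γ 0) (a : H) : LowH (fun t => ‖γ t - a‖ ^ 2) := by
  set L : H →L[ℂ] ℂ := innerSL ℂ (γ 0 - a)
  have h1 : AnalyticAt ℂ (fun t => 2 * L (γ t - a) - (‖γ 0 - a‖ ^ 2 : ℝ)) 0 :=
    (analyticAt_const.mul ((L.analyticAt _).comp (hγ.sub analyticAt_const))).sub analyticAt_const
  refine (LowH.re h1).of_le ?_ (Eventually.of_forall fun t => ?_)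
  · have : (L (γ 0 - a)).re = ‖γ 0 - a‖ ^ 2 := by
      simp only [L, innerSL_apply_apply]
      exact inner_self_eq_norm_sq (𝕜 := ℂ) (γ 0 - a)
    rw [Complex.sub_re, Complex.ofReal_re, two_mul, Complex.add_re, this]; ring
  · rw [Complex.sub_re, Complex.ofReal_re, two_mul, Complex.add_re]
    have h2 := norm_sub_sq (𝕜 := ℂ) (γ 0 - a) (γ t - a)
    have h3 := sq_nonneg ‖γ 0 - a - (γ t - a)‖
    have h4 : (L (γ t - a)).re = RCLike.re (inner ℂ (γ 0 - a) (γ t - a)) := rfl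
    rw [h4]; linarith

lemma qdiff_low {γ : ℂ → H} (hγ : AnalyticAt ℂ γ 0) (z0 y : H) :
    LowH (fun t => ‖γ t - z0‖ ^ 2 - ‖γ t - y‖ ^ 2) := by
  set L : H →L[ℂ] ℂ := innerSL ℂ (y - z0)
  have h1 : AnalyticAt ℂ (fun t => 2 * L (γ t - y) + (‖y - z0‖ ^ 2 : ℝ)) 0 :=
    (analyticAt_const.mul ((L.analyticAt _).comp (hγ.sub analyticAt_const))).add analyticAt_const
  have h2 : (fun t => ‖γ t - z0‖ ^ 2 - ‖γ t - y‖ ^ 2) =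
      fun t => (2 * L (γ t - y) + (‖y - z0‖ ^ 2 : ℝ)).re := by
    ext t
    have h2 := norm_add_sq (𝕜 := ℂ) (y - z0) (γ t - y)
    rw [show y - z0 + (γ t - y) = γ t - z0 by abel] at h2
    have h4 : (L (γ t - y)).re = RCLike.re (inner ℂ (y - z0) (γ t - y)) := rfl
    rw [Complex.add_re, Complex.ofReal_re, two_mul, Complex.add_re, h4]; linarith
  rw [h2]; exact LowH.re h1

def SS (z0 : H) (R : ℝ) (v : H → ℝ) : Prop := ContinuousOn v (closedBall z0 R) ∧ RP v (ball z0 R)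

lemma SS.max {z0 : H} {R : ℝ} {v w : H → ℝ} (h : SS z0 R v) (h' : SS z0 R w) :
    SS z0 R (fun z => max (v z) (w z)) := ⟨ContinuousOn.sup h.1 h'.1, h.2.max h'.2⟩

lemma SS.add_norms {z0 : H} {R : ℝ} {v : H → ℝ} (h : SS z0 R v) {W : Set H} (hW : IsOpen W)
    (hKW : closedBall z0 R ⊆ W) {m : ℕ} {F : Fin m → H → ℂ} (hF : ∀ i, DifferentiableOn ℂ (F i) W)
    {A : ℝ} (hA : 0 ≤ A) : SS z0 R (fun z => v z + A * ∑ i, ‖F i z‖ ^ 2) := by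
  have hc : ContinuousOn (fun z => A * ∑ i, ‖F i z‖ ^ 2) (closedBall z0 R) := by
    refine continuousOn_const.mul (continuousOn_finset_sum _ fun i _ => ?_)
    exact (((hF i).continuousOn.mono hKW).norm).pow 2
  refine ⟨h.1.add hc, h.2.add_low (hc.mono ball_subset_closedBall) fun γ a b => ?_⟩
  refine LowH.smul (LowH.sum _ fun i _ => LowH.normSq ?_) hA
  exact analyticAt_comp hW (hF i) a (hKW (ball_subset_closedBall b))

lemma SS.glue {z0 : H} {R : ℝ} {a b d : H → ℝ} (ha : SS z0 R a) (hb : ContinuousOn b (closedBall z0 R))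
    {ρ : ℝ} (hd : ContinuousOn d (closedBall z0 R)) (hbR : RP b (ball z0 R ∩ {z | d z < ρ}))
    (hs : ∀ z ∈ closedBall z0 R, d z = ρ → b z < a z) :
    SS z0 R (fun z => if d z < ρ then Max.max (a z) (b z) else a z) := by
  have key : ∀ z ∈ closedBall z0 R, ¬ d z < ρ →
      ∀ᶠ x in 𝓝[closedBall z0 R] z, (if d x < ρ then Max.max (a x) (b x) else a x) = a x := by
    intro z hz hn
    rcases (not_lt.1 hn).eq_or_lt with h | h
    · have : ∀ᶠ x in 𝓝[closedBall z0 R] z, b x < a x :=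
        (hb z hz).eventually_lt (ha.1 z hz) (hs z hz h.symm)
      filter_upwards [this] with x hx
      split_ifs
      · exact max_eq_left hx.le
      · rfl
    · filter_upwards [(hd z hz).eventually (lt_mem_nhds h)] with x hx
      rw [if_neg (not_lt.2 hx.le)]
  constructor
  · intro z hz
    by_cases hn : d z < ρ
    · have h1 : ContinuousWithinAt (fun z => Max.max (a z) (b z)) (closedBall z0 R) z :=
        (ha.1 z hz).max (hb z hz)
      refine h1.congr_of_eventuallyEq ?_ (by simp [hn])
      filter_upwards [(hd z hz).eventually (gt_mem_nhds hn)] with x hx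
      rw [if_pos hx]
    · exact (ha.1 z hz).congr_of_eventuallyEq (key z hz hn) (by simp [hn])
  · refine RP.of_local fun z hz => ?_
    have h2 : 𝓝[closedBall z0 R] z = 𝓝 z :=
      nhdsWithin_eq_nhds.2 (mem_of_superset (isOpen_ball.mem_nhds hz) ball_subset_closedBall)
    by_cases hn : d z < ρ
    · have h1 := (hd z (ball_subset_closedBall hz)).eventually (gt_mem_nhds hn)
      rw [h2] at h1
      obtain ⟨U, hU1, hU2, hU3⟩ := _root_.eventually_nhds_iff.1 (h1.and (isOpen_ball.mem_nhds hz))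
      refine ⟨U, hU2, hU3, ?_⟩
      refine (RP.max (ha.2.mono fun x hx => (hU1 x hx).2) (hbR.mono fun x hx =>
        ⟨(hU1 x hx).2, (hU1 x hx).1⟩)).congr hU2 fun x hx => ?_
      rw [if_pos (hU1 x hx).1]
    · have h1 := key z (ball_subset_closedBall hz) hn
      rw [h2] at h1
      obtain ⟨U, hU1, hU2, hU3⟩ := _root_.eventually_nhds_iff.1 (h1.and (isOpen_ball.mem_nhds hz))
      exact ⟨U, hU2, hU3, (ha.2.mono fun x hx => (hU1 x hx).2).congr hU2 fun x hx => (hU1 x hx).1.symm⟩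

lemma exists_A {T : Set H} (hT : IsCompact T) {g n : H → ℝ} (hg : ContinuousOn g T)
    (hn : ContinuousOn n T) (hn0 : ∀ z ∈ T, 0 ≤ n z) (h : ∀ z ∈ T, n z = 0 → 0 < g z) :
    ∃ A : ℝ, 0 ≤ A ∧ ∀ z ∈ T, 0 < g z + A * n z := by
  have := hT.induction_on (p := fun s => ∃ A : ℝ, 0 ≤ A ∧ ∀ z ∈ s ∩ T, 0 < g z + A * n z)
    ⟨0, le_rfl, by simp⟩
    (fun s t hst ⟨A, h1, h2⟩ => ⟨A, h1, fun z hz => h2 z ⟨hst hz.1, hz.2⟩⟩)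
    (fun s t ⟨A, h1, h2⟩ ⟨A', h1', h2'⟩ => ⟨max A A', h1.trans (le_max_left _ _), ?_⟩)
    (fun z hz => ?_)
  · obtain ⟨A, h1, h2⟩ := this
    exact ⟨A, h1, fun z hz => h2 z ⟨hz, hz⟩⟩
  · rintro z ⟨hz | hz, hzT⟩
    · have := h2 z ⟨hz, hzT⟩
      nlinarith [hn0 z hzT, le_max_left A A']
    · have := h2' z ⟨hz, hzT⟩
      nlinarith [hn0 z hzT, le_max_right A A']
  · have : ∃ A : ℝ, 0 ≤ A ∧ 0 < g z + A * n z := by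
      rcases (hn0 z hz).eq_or_lt with h0 | h0
      · exact ⟨0, le_rfl, by simpa using h z hz h0.symm⟩
      · refine ⟨(|g z| + 1) / n z, by positivity, ?_⟩
        rw [div_mul_cancel₀ _ h0.ne']
        linarith [neg_abs_le (g z)]
    obtain ⟨A, hA, hA'⟩ := this
    have h2 : ContinuousWithinAt (fun z => g z + A * n z) T z :=
      (hg z hz).add (continuousWithinAt_const.mul (hn z hz))
    refine ⟨_, h2.eventually (lt_mem_nhds hA'), A, hA, fun x hx => hx.1⟩

def LocExt (Y : Set H) (O : Set H) (u : H → ℝ) : Prop :=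
  ∀ y ∈ Y ∩ O, ∃ G : Set H, IsOpen G ∧ y ∈ G ∧ ∃ ψ : H → ℝ, RP ψ G ∧
    (∃ N : ℝ, ∀ z ∈ G, -N ≤ ψ z) ∧ ∀ z ∈ Y ∩ G, ψ z = u z

lemma B1 {z0 : H} {R : ℝ} {W : Set H} (hW : IsOpen W) (hKW : closedBall z0 R ⊆ W) {m : ℕ}
    {F : Fin m → H → ℂ} (hF : ∀ i, DifferentiableOn ℂ (F i) W) {Y : Set H}
    (hY : Y = {z ∈ closedBall z0 R | ∀ i, F i z = 0}) {u f vs : H → ℝ} (hu : UpperSemicontinuousOn u Y)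
    (hLE : LocExt Y (ball z0 R) u) (hf : LowerSemicontinuousOn f Y) (huf : ∀ z ∈ Y, u z < f z)
    (hvs : SS z0 R vs) (hvf : ∀ z ∈ Y, vs z ≤ f z) (hvu : ∀ z ∈ Y ∩ sphere z0 R, u z ≤ vs z)
    {y0 : H} (hy0 : y0 ∈ Y) {a : ℝ} (ha : a < u y0) :
    ∃ v, SS z0 R v ∧ (∀ z ∈ Y, v z ≤ f z) ∧ a < v y0 := by
  haveI : FiniteDimensional ℝ H := FiniteDimensional.complexToReal H
  haveI : ProperSpace H := FiniteDimensional.proper ℝ H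
  by_contra! hcon
  set K := closedBall z0 R with hK
  set O := ball z0 R with hO
  have hYK : Y ⊆ K := by rw [hY]; exact fun z hz => hz.1
  have hYF : ∀ z ∈ Y, ∀ i, F i z = 0 := by rw [hY]; exact fun z hz => hz.2
  have hNc : ContinuousOn (fun z => ∑ i, ‖F i z‖ ^ 2) K :=
    continuousOn_finset_sum _ fun i _ => (((hF i).continuousOn.mono hKW).norm).pow 2
  have hN0 : ∀ z, (∑ i, ‖F i z‖ ^ 2 = 0) → ∀ i, F i z = 0 := by
    intro z hz i
    have := (Finset.sum_eq_zero_iff_of_nonneg (fun i _ => sq_nonneg _)).1 hz i (Finset.mem_univ i)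
    simpa using this
  have hYc : IsCompact Y := by
    have : Y = K ∩ (fun z => ∑ i, ‖F i z‖ ^ 2) ⁻¹' {0} := by
      ext z; rw [hY]
      constructor
      · rintro ⟨h1, h2⟩; exact ⟨h1, by simp [h2]⟩
      · rintro ⟨h1, h2⟩; exact ⟨h1, hN0 z h2⟩
    rw [this]
    exact (isCompact_closedBall z0 R).of_isClosed_subset
      (hNc.preimage_isClosed_of_isClosed isClosed_closedBall isClosed_singleton) inter_subset_left
  set 𝓕 : Set (H → ℝ) := {v | SS z0 R v ∧ (∀ z ∈ Y, v z ≤ f z) ∧ ∀ z, vs z ≤ v z} with h𝓕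
  have hvs𝓕 : vs ∈ 𝓕 := ⟨hvs, hvf, fun z => le_rfl⟩
  set P : H → ℝ := fun z => sSup ((fun v => v z) '' 𝓕) with hP
  have hPle : ∀ z ∈ Y, ∀ v ∈ 𝓕, v z ≤ P z := fun z hz v hv => by
    refine le_csSup ⟨f z, ?_⟩ ⟨v, hv, rfl⟩
    rintro _ ⟨v, hv, rfl⟩; exact hv.2.1 z hz
  have hPlt : ∀ z, ∀ c < P z, ∃ v ∈ 𝓕, c < v z := fun z c hc => by
    obtain ⟨_, ⟨v, hv, rfl⟩, h⟩ := exists_lt_of_lt_csSup (Set.Nonempty.image _ ⟨vs, hvs𝓕⟩) hc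
    exact ⟨v, hv, h⟩
  have hPl : LowerSemicontinuousOn P Y := by
    intro z hz c hc
    obtain ⟨v, hv, h⟩ := hPlt z c hc
    filter_upwards [((hv.1.1.mono hYK) z hz).eventually (lt_mem_nhds h), self_mem_nhdsWithin] with x hx hxY
    exact hx.trans_le (hPle x hxY v hv)
  have hPy0 : P y0 ≤ a := csSup_le (Set.Nonempty.image _ ⟨vs, hvs𝓕⟩) (by
    rintro _ ⟨v, hv, rfl⟩; exact hcon v hv.1 hv.2.1)
  set ε := (u y0 - a) / (R ^ 2 + 1) / 2 with hε
  have hεp : 0 < ε := by have : 0 < u y0 - a := by linarith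
                         positivity
  have hεR : ε * R ^ 2 < u y0 - a := by
    have h1 : ε * (R ^ 2 + 1) = (u y0 - a) / 2 := by rw [hε]; field_simp
    nlinarith
  have husc : UpperSemicontinuousOn (fun z => u z + (ε * (‖z - z0‖ ^ 2 - R ^ 2) + -P z)) Y := by
    refine hu.add (UpperSemicontinuousOn.add (ContinuousOn.upperSemicontinuousOn (by fun_prop)) ?_)
    intro z hz c hc
    filter_upwards [hPl z hz (-c) (by linarith)] with x hx
    linarith
  obtain ⟨y, hyY, hymax⟩ := husc.exists_isMaxOn ⟨y0, hy0⟩ hYc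
  set μ := u y + (ε * (‖y - z0‖ ^ 2 - R ^ 2) + -P y) with hμ
  have hmax : ∀ z ∈ Y, u z + (ε * (‖z - z0‖ ^ 2 - R ^ 2) + -P z) ≤ μ := fun z hz => hymax hz
  have hμp : 0 < μ := by
    have := hmax y0 hy0
    nlinarith [sq_nonneg ‖y0 - z0‖]
  have hR0 : ∀ z ∈ K, ‖z - z0‖ ≤ R := fun z hz => by simpa [hK, dist_eq_norm] using hz
  have hyO : y ∈ O := by
    by_contra hn
    have h1 : ‖y - z0‖ = R := le_antisymm (hR0 y (hYK hyY)) (by simpa [hO, dist_eq_norm] using hn)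
    have h2 := hvu y ⟨hyY, by simpa [dist_eq_norm] using h1⟩
    have h3 := hPle y hyY vs hvs𝓕
    rw [hμ, h1] at hμp
    linarith
  obtain ⟨G, hG, hyG, ψ, hψ, ⟨N, hN⟩, hψu⟩ := hLE y ⟨hyY, hyO⟩
  obtain ⟨ρ', hρ', hρG⟩ := Metric.nhds_basis_closedBall.mem_iff.1
    (Filter.inter_mem (hG.mem_nhds hyG) (isOpen_ball.mem_nhds hyO))
  set ρ := ρ' / 2 with hρdef
  have hρ : 0 < ρ := by positivity
  set Q := closedBall y (2 * ρ) with hQ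
  have hQG : Q ⊆ G ∩ O := by rw [hQ, hρdef, mul_div_cancel₀ _ (by norm_num)]; exact hρG
  have hQc : IsCompact Q := isCompact_closedBall _ _
  set ψ2 : H → ℝ := fun z => ψ z + (ε * (‖z - z0‖ ^ 2 - ‖z - y‖ ^ 2) + (- (ε * R ^ 2) - μ)) with hψ2
  have hψ2R : RP ψ2 Q := by
    refine (hψ.mono (hQG.trans inter_subset_left)).add_low (by fun_prop) fun γ a b => ?_
    exact ((qdiff_low a z0 y).smul hεp.le).add (LowH.const _)
  have hψ2Y : ∀ z ∈ Y ∩ Q, ψ2 z = u z + ε * (‖z - z0‖ ^ 2 - R ^ 2) - μ - ε * ‖z - y‖ ^ 2 := by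
    intro z hz
    simp only [hψ2]
    rw [hψu z ⟨hz.1, (hQG hz.2).1⟩]; ring
  have hψ2P : ∀ z ∈ Y ∩ Q, ψ2 z ≤ P z - ε * ‖z - y‖ ^ 2 := fun z hz => by
    rw [hψ2Y z hz]; linarith [hmax z hz.1]
  have hψ2f : ∀ z ∈ Y ∩ Q, ψ2 z < f z - μ := fun z hz => by
    rw [hψ2Y z hz]
    have h1 := huf z hz.1
    have h2 : ‖z - z0‖ ^ 2 ≤ R ^ 2 := pow_le_pow_left₀ (norm_nonneg _) (hR0 z (hYK hz.1)) 2
    have h3 := sq_nonneg ‖z - y‖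
    nlinarith
  have hyQ : y ∈ Q := mem_closedBall_self (by positivity)
  have hψ2y : ψ2 y = P y := by
    rw [hψ2Y y ⟨hyY, hyQ⟩, hμ]; simp
  have hψ2b : ∃ M, ∀ z ∈ Q, |ψ2 z| ≤ M := by
    obtain ⟨C, hC⟩ := (hQc.image_of_continuousOn (f := fun z => ε * (‖z - z0‖ ^ 2 - ‖z - y‖ ^ 2) + (- (ε * R ^ 2) - μ))
      (by fun_prop)).isBounded.exists_norm_le
    refine usc_bdd hQc hψ2R.1 (N := N + C) fun z hz => ?_
    have h1 := hN z (hQG hz).1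
    have h2 := neg_le_of_abs_le (hC _ (mem_image_of_mem _ hz))
    simp only [hψ2]
    linarith
  obtain ⟨M, hM⟩ := hψ2b
  set δ := min μ (ε * ρ ^ 2 / 2) with hδ
  have hδp : 0 < δ := by positivity
  have hδμ : δ ≤ μ := min_le_left _ _
  set T := Y ∩ sphere y ρ with hT
  have hTc : IsCompact T := hYc.inter_right isClosed_sphere
  have hsQ : closedBall y ρ ⊆ Q := closedBall_subset_closedBall (by linarith)
  have hTQ : T ⊆ Y ∩ Q := fun z hz => ⟨hz.1, hsQ (sphere_subset_closedBall hz.2)⟩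
  have hv0 : ∃ v ∈ 𝓕, ∀ z ∈ T ∩ T, ψ2 z + δ < v z := by
    refine hTc.induction_on (p := fun s => ∃ v ∈ 𝓕, ∀ z ∈ s ∩ T, ψ2 z + δ < v z)
      ⟨vs, hvs𝓕, by simp⟩ (fun s t hst ⟨v, h1, h2⟩ => ⟨v, h1, fun z hz => h2 z ⟨hst hz.1, hz.2⟩⟩)
      ?_ fun z hz => ?_
    · rintro s t ⟨v, h1, h2⟩ ⟨v', h1', h2'⟩
      refine ⟨fun z => max (v z) (v' z), ⟨h1.1.max h1'.1, fun z hz => max_le (h1.2.1 z hz) (h1'.2.1 z hz),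
        fun z => (h1.2.2 z).trans (le_max_left _ _)⟩, ?_⟩
      rintro z ⟨hz | hz, hzT⟩
      · exact (h2 z ⟨hz, hzT⟩).trans_le (le_max_left _ _)
      · exact (h2' z ⟨hz, hzT⟩).trans_le (le_max_right _ _)
    · have h1 := hψ2P z (hTQ hz)
      have h2 : ‖z - y‖ = ρ := by simpa [dist_eq_norm] using hz.2
      rw [h2] at h1
      have h3 : 0 < ε * ρ ^ 2 := by positivity
      have h4 : δ ≤ ε * ρ ^ 2 / 2 := min_le_right _ _
      obtain ⟨v, hv, hv'⟩ := hPlt z (ψ2 z + δ) (by linarith)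
      have h5 : UpperSemicontinuousOn (fun z => ψ2 z + (δ - v z)) T :=
        (hψ2R.1.mono (hTQ.trans inter_subset_right)).add
          (ContinuousOn.upperSemicontinuousOn (continuousOn_const.sub
            (hv.1.1.mono (inter_subset_left.trans hYK))))
      refine ⟨_, h5 z hz 0 (by linarith), v, hv, fun x hx => ?_⟩
      have := hx.1
      simp only [mem_setOf_eq] at this
      linarith
  obtain ⟨v0, hv0, hv0T⟩ := hv0
  obtain ⟨κ1, hκ1, hκ1'⟩ := scv_lt hQc (hYc.inter_right isClosed_closedBall)
    (inter_subset_right.trans hsQ : Y ∩ closedBall y ρ ⊆ Q) hψ2R.1 hM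
    (τ := fun z => f z + (-μ)) ((hf.mono inter_subset_left).add
      (ContinuousOn.lowerSemicontinuousOn continuousOn_const))
    (fun z hz => by have := hψ2f z ⟨hz.1, hsQ hz.2⟩; linarith)
  obtain ⟨κ2, hκ2, hκ2'⟩ := scv_lt hQc hTc (hTQ.trans inter_subset_right) hψ2R.1 hM
    (τ := fun z => v0 z - δ) (ContinuousOn.lowerSemicontinuousOn
      ((hv0.1.1.mono (inter_subset_left.trans hYK)).sub continuousOn_const))
    (fun z hz => by have := hv0T z ⟨hz, hz⟩; linarith)
  set κ := max (max κ1 κ2) (2 * (|M| + 1) / ρ) with hκdef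
  have hκp : 0 < κ := lt_of_lt_of_le hκ1 ((le_max_left _ _).trans (le_max_left _ _))
  have hκs : 2 * M < κ * ρ := by
    have : 2 * (|M| + 1) / ρ ≤ κ := le_max_right _ _
    rw [div_le_iff₀ hρ] at this
    linarith [le_abs_self M]
  set v1 := scv ψ2 Q κ with hv1
  have hv1c : Continuous v1 := scv_cont hQc ⟨y, hyQ⟩ hψ2R.1 hκp.le
  have hv1R : RP v1 (ball y ρ) := by
    refine scv_RP hQc hκp hψ2R hM hκs fun x hx => ⟨hsQ (ball_subset_closedBall hx), ?_⟩
    refine interior_maximal (fun z hz => ?_) isOpen_ball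
    have := dist_triangle z x y
    simp only [mem_ball, hQ, mem_closedBall] at *
    linarith
  have hsO : closedBall y ρ ⊆ O := hsQ.trans (hQG.trans inter_subset_right)
  obtain ⟨A, hA, hA'⟩ := exists_A (isCompact_sphere y ρ) (g := fun z => v0 z - (v1 z + δ))
    (n := fun z => ∑ i, ‖F i z‖ ^ 2)
    ((hv0.1.1.mono (sphere_subset_closedBall.trans (hsO.trans ball_subset_closedBall))).sub (by fun_prop))
    (hNc.mono (sphere_subset_closedBall.trans (hsO.trans ball_subset_closedBall)))
    (fun z hz => by positivity)
    (fun z hz h0 => by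
      have hzY : z ∈ Y := by
        rw [hY]; exact ⟨ball_subset_closedBall (hsO (sphere_subset_closedBall hz)), hN0 z h0⟩
      have := hκ2' κ ((le_max_right _ _).trans (le_max_left _ _)) z ⟨hzY, hz⟩
      simp only [← hv1] at this
      linarith)
  have hw := (hv0.1.add_norms hW hKW hF hA).glue (b := fun z => v1 z + δ)
    (d := fun z => dist z y) (ρ := ρ) (by fun_prop) (by fun_prop)
    ((hv1R.add_const δ).mono inter_subset_right) (fun z _ hz => by linarith [hA' z hz])
  set w : H → ℝ := fun z => if dist z y < ρ then max (v0 z + A * ∑ i, ‖F i z‖ ^ 2) (v1 z + δ) else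
    v0 z + A * ∑ i, ‖F i z‖ ^ 2 with hwdef
  have hge : ∀ z, v0 z ≤ v0 z + A * ∑ i, ‖F i z‖ ^ 2 := fun z => by
    have : 0 ≤ A * ∑ i, ‖F i z‖ ^ 2 := by positivity
    linarith
  have hw𝓕 : w ∈ 𝓕 := by
    refine ⟨hw, fun z hz => ?_, fun z => ?_⟩
    · have h0 : v0 z + A * ∑ i, ‖F i z‖ ^ 2 ≤ f z := by
        simp [hYF z hz]; exact hv0.2.1 z hz
      simp only [hwdef]
      split_ifs with h
      · refine max_le h0 ?_
        have := hκ1' κ ((le_max_left _ _).trans (le_max_left _ _)) z ⟨hz, h.le⟩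
        simp only [← hv1] at this
        linarith
      · exact h0
    · refine (hv0.2.2 z).trans ((hge z).trans ?_)
      simp only [hwdef]
      split_ifs
      · exact le_max_left _ _
      · rfl
  have h1 := hPle y hyY w hw𝓕
  have h2 : v1 y + δ ≤ w y := by
    simp only [hwdef, dist_self, hρ, if_true]; exact le_max_right _ _
  have h3 : ψ2 y ≤ v1 y := scv_ge hQc hψ2R.1 κ hyQ
  linarith
end BB
end

section
section BB2
variable {H : Type*} [NormedAddCommGroup H] [InnerProductSpace ℂ H] [FiniteDimensional ℂ H]

lemma SS.add_const {z0 : H} {R : ℝ} {v : H → ℝ} (h : SS z0 R v) (c : ℝ) : SS z0 R (fun z => v z + c) :=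
  ⟨h.1.add continuousOn_const, h.2.add_const c⟩

lemma SS.mono {z0 : H} {R R' : ℝ} {v : H → ℝ} (h : SS z0 R v) (hR : R' ≤ R) : SS z0 R' v :=
  ⟨h.1.mono (closedBall_subset_closedBall hR), h.2.mono (ball_subset_ball hR)⟩

lemma zeroset_compact {z0 : H} {R : ℝ} {W : Set H} (hKW : closedBall z0 R ⊆ W) {m : ℕ}
    {F : Fin m → H → ℂ} (hF : ∀ i, DifferentiableOn ℂ (F i) W) :
    IsCompact {z ∈ closedBall z0 R | ∀ i, F i z = 0} := by
  haveI : FiniteDimensional ℝ H := FiniteDimensional.complexToReal H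
  haveI : ProperSpace H := FiniteDimensional.proper ℝ H
  have : {z ∈ closedBall z0 R | ∀ i, F i z = 0} =
      closedBall z0 R ∩ (fun z i => F i z) ⁻¹' {0} := by
    ext z; simp [funext_iff]
  rw [this]
  exact (isCompact_closedBall z0 R).of_isClosed_subset
    ((continuousOn_pi.2 fun i => (hF i).continuousOn.mono hKW).preimage_isClosed_of_isClosed
      isClosed_closedBall isClosed_singleton) inter_subset_left

lemma B2 {z0 : H} {R R' : ℝ} (hR' : 0 < R') (hRR : R' < R) {W : Set H} (hW : IsOpen W)
    (hKW : closedBall z0 R ⊆ W) {m : ℕ}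
    {F : Fin m → H → ℂ} (hF : ∀ i, DifferentiableOn ℂ (F i) W) {Y : Set H}
    (hY : Y = {z ∈ closedBall z0 R | ∀ i, F i z = 0}) {u f : H → ℝ} (hu : UpperSemicontinuousOn u Y)
    (hLE : LocExt Y (ball z0 R) u) (hf : ContinuousOn f (Y ∩ closedBall z0 R'))
    (huf : ∀ z ∈ Y ∩ closedBall z0 R', u z < f z) :
    ∃ v, SS z0 R v ∧ ∀ z ∈ Y ∩ closedBall z0 R', u z < v z ∧ v z < f z := by
  have hYc : IsCompact Y := hY ▸ zeroset_compact hKW hF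
  set K' := closedBall z0 R' with hK'
  set Y' := Y ∩ K' with hY'
  have hY'c : IsCompact Y' := hYc.inter_right isClosed_closedBall
  have hY'Y : Y' ⊆ Y := inter_subset_left
  have hYK : Y ⊆ closedBall z0 R := by rw [hY]; exact fun z hz => hz.1
  obtain ⟨η, hη, hηf⟩ : ∃ η : ℝ, 0 < η ∧ ∀ z ∈ Y', u z + 3 * η ≤ f z := by
    rcases Y'.eq_empty_or_nonempty with h | h
    · exact ⟨1, one_pos, by simp [h]⟩
    · have h1 : UpperSemicontinuousOn (fun z => u z + -f z) Y' :=
        (hu.mono hY'Y).add (ContinuousOn.upperSemicontinuousOn hf.neg)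
      obtain ⟨y, hy, hmax⟩ := h1.exists_isMaxOn h hY'c
      refine ⟨(f y - u y) / 3, by linarith [huf y hy], fun z hz => ?_⟩
      have : u z + -f z ≤ u y + -f y := hmax hz
      linarith
  obtain ⟨M, hM⟩ : ∃ M, ∀ z ∈ Y, u z ≤ M := by
    obtain ⟨M, hM⟩ := hu.bddAbove_of_isCompact hYc
    exact ⟨M, fun z hz => hM (mem_image_of_mem u hz)⟩
  obtain ⟨C, hC⟩ : ∃ C, ∀ z ∈ Y', |f z| ≤ C := by
    obtain ⟨C, hC⟩ := (hY'c.image_of_continuousOn hf).isBounded.exists_norm_le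
    exact ⟨C, fun z hz => hC _ (mem_image_of_mem f hz)⟩
  classical
  set Hb := max (C + 1) (M + 1) with hHb
  set f2 : H → ℝ := fun z => if z ∈ K' then f z - 2 * η else Hb with hf2
  have hf2K : ∀ z ∈ K', f2 z = f z - 2 * η := fun z hz => if_pos hz
  have hf2n : ∀ z, z ∉ K' → f2 z = Hb := fun z hz => if_neg hz
  have hf2l : LowerSemicontinuousOn f2 Y := by
    intro z hz c hc
    by_cases hzK : z ∈ K'
    · rw [hf2K z hzK] at hc
      have h1 : ∀ᶠ x in 𝓝[Y'] z, c + 2 * η < f x :=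
        (hf z ⟨hz, hzK⟩).eventually (lt_mem_nhds (by linarith))
      rw [hY', nhdsWithin_inter', eventually_inf_principal] at h1
      have h2 := (abs_le.1 (hC z ⟨hz, hzK⟩)).2
      have h3 := le_max_left (C + 1) (M + 1)
      filter_upwards [h1] with x hx
      by_cases hxK : x ∈ K'
      · rw [hf2K x hxK]; linarith [hx hxK]
      · rw [hf2n x hxK]; linarith
    · rw [hf2n z hzK] at hc
      filter_upwards [nhdsWithin_le_nhds (isClosed_closedBall.isOpen_compl.mem_nhds hzK)] with x hx
      rwa [hf2n x hx]
  have huf2 : ∀ z ∈ Y, u z < f2 z := by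
    intro z hz
    by_cases hzK : z ∈ K'
    · rw [hf2K z hzK]; linarith [hηf z ⟨hz, hzK⟩]
    · rw [hf2n z hzK]; linarith [hM z hz, le_max_right (C + 1) (M + 1)]
  have hd : 0 < R ^ 2 - R' ^ 2 := by nlinarith
  set k := (|M| + |C| + 2 * η) / (R ^ 2 - R' ^ 2) with hk
  have hkp : 0 ≤ k := by positivity
  have hkd : k * (R ^ 2 - R' ^ 2) = |M| + |C| + 2 * η := by rw [hk, div_mul_cancel₀ _ hd.ne']
  set vs : H → ℝ := fun z => M + (k * ‖z - z0‖ ^ 2 + -(k * R ^ 2)) with hvs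
  have hvsS : SS z0 R vs := by
    refine ⟨by fun_prop, (RP.const M _).add_low (by fun_prop) fun γ a b => ?_⟩
    exact ((LowH_qnorm a z0).smul hkp).add (LowH.const _)
  have hvsf : ∀ z ∈ Y, vs z ≤ f2 z := by
    intro z hz
    by_cases hzK : z ∈ K'
    · rw [hf2K z hzK]
      have h1 : ‖z - z0‖ ≤ R' := by simpa [hK', dist_eq_norm] using hzK
      have h2 : ‖z - z0‖ ^ 2 ≤ R' ^ 2 := pow_le_pow_left₀ (norm_nonneg _) h1 2
      have h3 := (abs_le.1 (hC z ⟨hz, hzK⟩)).1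
      simp only [hvs]
      nlinarith [le_abs_self M, le_abs_self C]
    · rw [hf2n z hzK]
      have h1 : ‖z - z0‖ ≤ R := by simpa [dist_eq_norm] using hYK hz
      have h2 : ‖z - z0‖ ^ 2 ≤ R ^ 2 := pow_le_pow_left₀ (norm_nonneg _) h1 2
      simp only [hvs]
      nlinarith [le_max_right (C + 1) (M + 1)]
  have hvsu : ∀ z ∈ Y ∩ sphere z0 R, u z ≤ vs z := by
    intro z hz
    have : ‖z - z0‖ = R := by simpa [dist_eq_norm] using hz.2
    simp only [hvs, this]; linarith [hM z hz.1]
  have hfin : ∃ v, (SS z0 R v ∧ ∀ z ∈ Y, v z ≤ f2 z) ∧ ∀ z ∈ Y' ∩ Y', u z < v z + η := by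
    refine hY'c.induction_on (p := fun s => ∃ v, (SS z0 R v ∧ ∀ z ∈ Y, v z ≤ f2 z) ∧
      ∀ z ∈ s ∩ Y', u z < v z + η)
      ⟨vs, ⟨hvsS, hvsf⟩, by simp⟩ (fun s t hst ⟨v, h1, h2⟩ => ⟨v, h1, fun z hz => h2 z ⟨hst hz.1, hz.2⟩⟩)
      ?_ fun z hz => ?_
    · rintro s t ⟨v, h1, h2⟩ ⟨v', h1', h2'⟩
      refine ⟨fun z => max (v z) (v' z), ⟨h1.1.max h1'.1, fun z hz => max_le (h1.2 z hz) (h1'.2 z hz)⟩, ?_⟩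
      rintro z ⟨hz | hz, hzT⟩
      · linarith [h2 z ⟨hz, hzT⟩, le_max_left (v z) (v' z)]
      · linarith [h2' z ⟨hz, hzT⟩, le_max_right (v z) (v' z)]
    · obtain ⟨v, h1, h2, h3⟩ := B1 hW hKW hF hY hu hLE hf2l huf2 hvsS hvsf hvsu hz.1
        (show u z - η < u z by linarith)
      have h5 : UpperSemicontinuousOn (fun z => u z + (- v z - η)) Y' :=
        (hu.mono hY'Y).add (ContinuousOn.upperSemicontinuousOn
          ((h1.1.mono (hY'Y.trans hYK)).neg.sub continuousOn_const))
      refine ⟨_, h5 z hz 0 (by linarith), v, ⟨h1, h2⟩, fun x hx => ?_⟩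
      have := hx.1
      simp only [mem_setOf_eq] at this
      linarith
  obtain ⟨v, ⟨hv1, hv2⟩, hv3⟩ := hfin
  refine ⟨fun z => v z + η, hv1.add_const η, fun z hz => ⟨hv3 z ⟨hz, hz⟩, ?_⟩⟩
  have := hv2 z hz.1
  rw [hf2K z hz.2] at this
  linarith

lemma B3a {z0 : H} {R R' : ℝ} (hR' : 0 < R') (hRR : R' < R) {W : Set H} (hW : IsOpen W)
    (hKW : closedBall z0 R ⊆ W) {m : ℕ}
    {F : Fin m → H → ℂ} (hF : ∀ i, DifferentiableOn ℂ (F i) W) {Y : Set H}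
    (hY : Y = {z ∈ closedBall z0 R | ∀ i, F i z = 0}) (hz0 : z0 ∈ Y) {U : ℕ → H → ℝ}
    (hu : ∀ k, UpperSemicontinuousOn (U k) Y) {b : ℕ → ℝ} (hb : ∀ k, ∀ z ∈ Y, b k ≤ U k z)
    (hLE : ∀ k, LocExt Y (ball z0 R) (U k))
    (hdec : ∀ k, ∀ z ∈ Y, U (k + 1) z ≤ U k z) :
    ∃ v : ℕ → H → ℝ, (∀ k, SS z0 R (v k)) ∧ (∀ k, ∀ z ∈ Y ∩ closedBall z0 R', v (k + 1) z < v k z) ∧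
      ∀ z ∈ Y ∩ closedBall z0 R', (⨅ k, (v k z : EReal)) = ⨅ k, (U k z : EReal) := by
  have hYc : IsCompact Y := hY ▸ zeroset_compact hKW hF
  set Y' := Y ∩ closedBall z0 R' with hY'
  have hY'c : IsCompact Y' := hYc.inter_right isClosed_closedBall
  have hY'Y : Y' ⊆ Y := inter_subset_left
  have hYK : Y ⊆ closedBall z0 R := by rw [hY]; exact fun z hz => hz.1
  have hne : Y'.Nonempty := ⟨z0, hz0, mem_closedBall_self hR'.le⟩
  have hu' : ∀ k, UpperSemicontinuousOn (U k) Y' := fun k => (hu k).mono hY'Y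
  set f : ℕ → H → ℝ := fun k z => scv (U k) Y' k z + 1 / (k + 1 : ℝ) with hf
  have hfc : ∀ k, Continuous (f k) := fun k =>
    (scv_cont hY'c hne (hu' k) (Nat.cast_nonneg k)).add continuous_const
  have hfU : ∀ k, ∀ z ∈ Y', U k z < f k z := fun k z hz => by
    have h1 := scv_ge hY'c (hu' k) k hz
    have : (0 : ℝ) < 1 / (k + 1) := by positivity
    simp only [hf]; linarith
  have base := B2 hR' hRR hW hKW hF hY (hu 0) (hLE 0) (hfc 0).continuousOn (hfU 0)
  have step : ∀ k (v : {v : H → ℝ // SS z0 R v ∧ ∀ z ∈ Y', U k z < v z}),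
      ∃ v' : H → ℝ, SS z0 R v' ∧ ∀ z ∈ Y', U (k + 1) z < v' z ∧ v' z < min (f (k + 1) z) (v.1 z) := by
    intro k v
    refine B2 hR' hRR hW hKW hF hY (hu (k + 1)) (hLE (k + 1))
      ((hfc (k + 1)).continuousOn.inf (v.2.1.1.mono (hY'Y.trans hYK))) fun z hz => lt_min (hfU _ z hz) ?_
    exact (hdec k z hz.1).trans_lt (v.2.2 z hz)
  choose nx hnx1 hnx2 using step
  let sq : ∀ k, {v : H → ℝ // SS z0 R v ∧ ∀ z ∈ Y', U k z < v z} := fun k =>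
    Nat.rec (motive := fun k => {v : H → ℝ // SS z0 R v ∧ ∀ z ∈ Y', U k z < v z})
      ⟨base.choose, base.choose_spec.1, fun z hz => (base.choose_spec.2 z hz).1⟩
      (fun k v => ⟨nx k v, hnx1 k v, fun z hz => (hnx2 k v z hz).1⟩) k
  have hsqf : ∀ k, ∀ z ∈ Y', (sq k).1 z < f k z := by
    intro k z hz
    cases k with
    | zero => exact (base.choose_spec.2 z hz).2
    | succ k => exact (hnx2 k (sq k) z hz).2.trans_le (min_le_left _ _)
  refine ⟨fun k => (sq k).1, fun k => (sq k).2.1, fun k z hz =>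
    (hnx2 k (sq k) z hz).2.trans_le (min_le_right _ _), fun z hz => ?_⟩
  have hanti : ∀ n k, n ≤ k → ∀ z ∈ Y, U k z ≤ U n z := by
    intro n k hnk
    induction hnk with
    | refl => exact fun z _ => le_rfl
    | step _ ih => exact fun z hz => (hdec _ z hz).trans (ih z hz)
  refine le_antisymm (le_iInf fun n => ?_) (le_iInf fun k => (iInf_le _ k).trans
    (by exact_mod_cast ((sq k).2.2 z hz).le))
  refine EReal.le_of_forall_lt_iff_le.1 fun c hc => ?_
  have hc' : U n z < c := by exact_mod_cast hc
  obtain ⟨M, hM⟩ := usc_bdd (N := -b n) hY'c (hu' n) fun y hy => by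
    rw [neg_neg]; exact hb n y (hY'Y hy)
  set c' := (U n z + c) / 2
  obtain ⟨κ0, hκ0, hκ⟩ := scv_lt hY'c (isCompact_singleton (x := z)) (by simpa using hz) (hu' n) hM
    (τ := fun _ => c') lowerSemicontinuousOn_const (by rintro _ rfl; simp only [c']; linarith)
  obtain ⟨k1, hk1⟩ := exists_nat_ge κ0
  obtain ⟨k2, hk2⟩ := exists_nat_one_div_lt (show 0 < c - c' by simp only [c']; linarith)
  set k := max n (max k1 k2)
  refine (iInf_le _ k).trans ?_
  have h1 := hsqf k z hz
  have h2 := hκ k (hk1.trans (by exact_mod_cast (le_max_left _ _).trans (le_max_right _ _))) z rfl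
  have h3 : scv (U k) Y' k z ≤ scv (U n) Y' k z := by
    obtain ⟨y, hy, h4, -⟩ := scv_attain hY'c hne (hu' k) k z
    obtain ⟨-, -, -, h5⟩ := scv_attain hY'c hne (hu' n) k z
    have := h5 y hy
    have := hanti n k (le_max_left _ _) y (hY'Y hy)
    linarith
  have h4 : 1 / ((k : ℝ) + 1) ≤ 1 / ((k2 : ℝ) + 1) := by
    have : (k2 : ℝ) ≤ k := by exact_mod_cast (le_max_right _ _).trans (le_max_right _ _)
    gcongr
  have : (sq k).1 z ≤ c := by simp only [hf] at h1; linarith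
  exact_mod_cast this
end BB2
end

section
lemma LowH.max_left {φ ψ : ℂ → ℝ} (h : LowH φ) (h0 : ψ 0 ≤ φ 0) : LowH (fun t => max (φ t) (ψ t)) :=
  h.of_le (max_eq_left h0).symm (Eventually.of_forall fun t => le_max_left _ _)

lemma LowH.log_normSq {m : ℕ} {g : Fin m → ℂ → ℂ} (hg : ∀ i, AnalyticAt ℂ (g i) 0)
    (h0 : 0 < ∑ i, ‖g i 0‖ ^ 2) : LowH (fun t => Real.log (∑ i, ‖g i t‖ ^ 2)) := by
  set n := fun t => ∑ i, ‖g i t‖ ^ 2 with hn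
  set h : ℂ → ℂ := fun t => ∑ i, starRingEnd ℂ (g i 0) * g i t with hh
  have hha : AnalyticAt ℂ h 0 := by
    have := Finset.analyticAt_sum (𝕜 := ℂ) (c := (0:ℂ)) (N := Finset.univ) (f := fun i t => starRingEnd ℂ (g i 0) * g i t)
      (fun i _ => analyticAt_const.mul (hg i))
    convert this using 1
    ext t; simp [hh]
  have hh0 : h 0 = (n 0 : ℝ) := by
    simp only [hh, hn]; push_cast
    refine Finset.sum_congr rfl fun i _ => ?_
    rw [Complex.conj_mul']
  have hpos : 0 < n 0 := h0
  have hla : AnalyticAt ℂ (fun t => 2 * Complex.log (h t) - (Real.log (n 0) : ℝ)) 0 :=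
    (analyticAt_const.mul (hha.clog (by rw [hh0]; exact Complex.ofReal_mem_slitPlane.2 hpos))).sub analyticAt_const
  refine (LowH.re hla).of_le ?_ ?_
  · simp only [hh0]
    rw [two_mul, Complex.sub_re, Complex.add_re, Complex.log_re, Complex.ofReal_re, Complex.norm_real,
      Real.norm_eq_abs, Real.log_abs]; ring
  · have h1 : ∀ᶠ t in 𝓝 (0 : ℂ), h t ≠ 0 := hha.continuousAt.eventually_ne (by
      rw [hh0]; exact_mod_cast hpos.ne')
    filter_upwards [h1] with t ht
    rw [two_mul, Complex.sub_re, Complex.add_re, Complex.log_re, Complex.ofReal_re]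
    have h2 : ‖h t‖ ^ 2 ≤ n 0 * n t := by
      have h3 : ‖h t‖ ≤ ∑ i, ‖g i 0‖ * ‖g i t‖ := by
        refine (norm_sum_le _ _).trans (le_of_eq (Finset.sum_congr rfl fun i _ => ?_))
        rw [norm_mul, RCLike.norm_conj]
      calc ‖h t‖ ^ 2 ≤ (∑ i, ‖g i 0‖ * ‖g i t‖) ^ 2 := pow_le_pow_left₀ (norm_nonneg _) h3 2
        _ ≤ _ := Finset.sum_mul_sq_le_sq_mul_sq _ _ _
    have h4 : 0 < ‖h t‖ := norm_pos_iff.2 ht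
    have h5 : 0 < n t := by
      by_contra hc
      have : n t = 0 := le_antisymm (not_lt.1 hc) (by simp only [hn]; positivity)
      rw [this] at h2; nlinarith
    have h6 := Real.log_le_log (by positivity) h2
    rw [Real.log_pow, Real.log_mul hpos.ne' h5.ne'] at h6
    push_cast at h6
    linarith

section BB3
variable {H : Type*} [NormedAddCommGroup H] [InnerProductSpace ℂ H] [FiniteDimensional ℂ H]

lemma B3s {z0 : H} {R : ℝ} {W : Set H} (hW : IsOpen W)
    (hKW : closedBall z0 R ⊆ W) {m : ℕ} {F : Fin m → H → ℂ} (hF : ∀ i, DifferentiableOn ℂ (F i) W)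
    (hF1 : ∀ z ∈ closedBall z0 R, ∑ i, ‖F i z‖ ^ 2 ≤ 1) {v w : H → ℝ} (hv : SS z0 R v) (hw : SS z0 R w)
    (hwv : ∀ z ∈ closedBall z0 R, (∑ i, ‖F i z‖ ^ 2 = 0) → w z < v z) {a0 : ℝ} (ha0 : 0 < a0) :
    ∃ v', SS z0 R v' ∧ (∀ z ∈ closedBall z0 R, (∑ i, ‖F i z‖ ^ 2 = 0) → v' z = w z) ∧
      (∀ z ∈ closedBall z0 R, v' z ≤ v z) ∧
      ∀ z ∈ closedBall z0 R, (∑ i, ‖F i z‖ ^ 2 ≠ 0) → v z + a0 * Real.log (∑ i, ‖F i z‖ ^ 2) ≤ v' z := by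
  haveI : FiniteDimensional ℝ H := FiniteDimensional.complexToReal H
  haveI : ProperSpace H := FiniteDimensional.proper ℝ H
  set K := closedBall z0 R with hK
  have hKc : IsCompact K := isCompact_closedBall _ _
  set n : H → ℝ := fun z => ∑ i, ‖F i z‖ ^ 2 with hn
  have hnc : ContinuousOn n K :=
    continuousOn_finset_sum _ fun i _ => (((hF i).continuousOn.mono hKW).norm).pow 2
  have hn0 : ∀ z, 0 ≤ n z := fun z => by simp only [hn]; positivity
  have hc : ∃ c : ℝ, 0 < c ∧ ∀ z ∈ K ∩ K, n z ≤ c → w z + c ≤ v z := by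
    refine hKc.induction_on (p := fun s => ∃ c : ℝ, 0 < c ∧ ∀ z ∈ s ∩ K, n z ≤ c → w z + c ≤ v z)
      ⟨1, one_pos, by simp⟩ (fun s t hst ⟨c, h1, h2⟩ => ⟨c, h1, fun z hz => h2 z ⟨hst hz.1, hz.2⟩⟩)
      ?_ fun z hz => ?_
    · rintro s t ⟨c, h1, h2⟩ ⟨c', h1', h2'⟩
      refine ⟨min c c', lt_min h1 h1', ?_⟩
      rintro z ⟨hz | hz, hzT⟩ h
      · linarith [h2 z ⟨hz, hzT⟩ (h.trans (min_le_left _ _)), min_le_left c c']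
      · linarith [h2' z ⟨hz, hzT⟩ (h.trans (min_le_right _ _)), min_le_right c c']
    · rcases (hn0 z).eq_or_lt with h | h
      · have h1 := hwv z hz h.symm
        have h2 : ContinuousWithinAt (fun x => v x - w x) K z := (hv.1 z hz).sub (hw.1 z hz)
        refine ⟨_, h2.eventually (lt_mem_nhds (show (v z - w z) / 2 < v z - w z by linarith)),
          (v z - w z) / 2, by linarith, fun x hx _ => ?_⟩
        have := hx.1
        simp only [mem_setOf_eq] at this
        linarith
      · refine ⟨_, (hnc z hz).eventually (lt_mem_nhds (show n z / 2 < n z by linarith)), n z / 2,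
          by linarith, fun x hx hx' => ?_⟩
        have := hx.1
        simp only [mem_setOf_eq] at this
        linarith
  obtain ⟨c, hcp, hc⟩ := hc
  set a := min a0 (c / (|Real.log c| + 1)) with ha
  have hap : 0 < a := by positivity
  have hac : a * |Real.log c| < c := by
    have h1 : a ≤ c / (|Real.log c| + 1) := min_le_right _ _
    rw [le_div_iff₀ (by positivity)] at h1
    nlinarith
  obtain ⟨M, hM⟩ := (hKc.image_of_continuousOn (hv.1.sub hw.1)).isBounded.exists_norm_le
  set B := (|M| + 1) / a with hB
  have hBp : 0 < B := by positivity
  have haB : a * B = |M| + 1 := by rw [hB, mul_div_cancel₀ _ hap.ne']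
  set L : H → ℝ := fun z => Real.log (max (n z) (Real.exp (-B))) with hL
  have hmp : ∀ z, 0 < max (n z) (Real.exp (-B)) := fun z => lt_max_of_lt_right (Real.exp_pos _)
  have hLc : ContinuousOn L K := ContinuousOn.log (hnc.sup continuousOn_const) fun z _ => (hmp z).ne'
  have hA : SS z0 R (fun z => v z + a * L z) := by
    refine ⟨hv.1.add (continuousOn_const.mul hLc), hv.2.add_low
      ((continuousOn_const.mul hLc).mono ball_subset_closedBall) fun γ hγ h0 => LowH.smul ?_ hap.le⟩
    have hFa : ∀ i, AnalyticAt ℂ (fun t => F i (γ t)) 0 := fun i =>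
      analyticAt_comp hW (hF i) hγ (hKW (ball_subset_closedBall h0))
    by_cases hcase : Real.exp (-B) ≤ n (γ 0)
    · refine (LowH.log_normSq hFa (lt_of_lt_of_le (Real.exp_pos _) hcase)).of_le ?_ ?_
      · simp only [hL]; rw [max_eq_left hcase]
      · have hpos : 0 < n (γ 0) := lt_of_lt_of_le (Real.exp_pos _) hcase
        have h3 : ContinuousAt (fun t => ∑ i, ‖F i (γ t)‖ ^ 2) 0 :=
          tendsto_finset_sum _ fun i _ => ((hFa i).continuousAt.norm.pow 2)
        filter_upwards [h3.eventually (lt_mem_nhds hpos)] with t ht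
        exact Real.log_le_log ht (le_max_left _ _)
    · refine (LowH.const (-B)).of_le ?_ (Eventually.of_forall fun t => ?_)
      · simp only [hL]; rw [max_eq_right (not_le.1 hcase).le, Real.log_exp]
      · simp only [hL]; rw [Real.le_log_iff_exp_le (hmp _)]; exact le_max_right _ _
  have hLn : ∀ z, n z ≠ 0 → Real.log (n z) ≤ L z := fun z hz =>
    Real.log_le_log (lt_of_le_of_ne (hn0 z) hz.symm) (le_max_left _ _)
  have hL0 : ∀ z ∈ K, L z ≤ 0 := fun z hz =>
    Real.log_nonpos (hmp z).le (max_le (hF1 z hz) (Real.exp_le_one_iff.2 (by linarith)))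
  have hg := hA.glue hw.1 (ρ := c) hnc (hw.2.mono inter_subset_left) (fun z hz hzc => by
    have h1 := hc z ⟨hz, hz⟩ hzc.le
    have h2 := hLn z (by rw [hzc]; exact hcp.ne')
    rw [hzc] at h2
    nlinarith [neg_abs_le (Real.log c)])
  refine ⟨_, hg, fun z hz h0 => ?_, fun z hz => ?_, fun z hz h0 => ?_⟩
  · have h0' : n z = 0 := h0
    simp only [h0', hcp, if_true]
    refine max_eq_right ?_
    have h1 : L z = -B := by simp only [hL, h0']; rw [max_eq_right (Real.exp_pos _).le, Real.log_exp]
    rw [h1]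
    have h2 : v z - w z ≤ M := (abs_le.1 (hM _ (mem_image_of_mem _ hz))).2
    nlinarith [le_abs_self M]
  · have h1 : v z + a * L z ≤ v z := by nlinarith [hL0 z hz]
    split_ifs with h
    · exact max_le h1 (by linarith [hc z ⟨hz, hz⟩ h.le])
    · exact h1
  · have h0' : n z ≠ 0 := h0
    have h1 : v z + a0 * Real.log (n z) ≤ v z + a * L z := by
      have h2 := hLn z h0'
      have h3 : Real.log (n z) ≤ 0 := Real.log_nonpos (hn0 z) (hF1 z hz)
      have h4 : a ≤ a0 := min_le_left _ _
      nlinarith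
    refine h1.trans ?_
    split_ifs with h
    · exact le_max_left _ _
    · exact le_rfl

lemma B3b {z0 : H} {R : ℝ} {W : Set H} (hW : IsOpen W)
    (hKW : closedBall z0 R ⊆ W) {m : ℕ} {F : Fin m → H → ℂ} (hF : ∀ i, DifferentiableOn ℂ (F i) W)
    {v : ℕ → H → ℝ} (hv : ∀ k, SS z0 R (v k))
    (hdec : ∀ k, ∀ z ∈ closedBall z0 R, (∀ i, F i z = 0) → v (k + 1) z < v k z) :
    ∃ w : ℕ → H → ℝ, (∀ k, SS z0 R (w k)) ∧ (∀ k, ∀ z ∈ closedBall z0 R, w (k + 1) z ≤ w k z) ∧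
      (∀ k, ∀ z ∈ closedBall z0 R, (∀ i, F i z = 0) → w k z = v k z) ∧
      ∀ z ∈ closedBall z0 R, (¬ ∀ i, F i z = 0) → ∃ c : ℝ, ∀ k, c ≤ w k z := by
  haveI : FiniteDimensional ℝ H := FiniteDimensional.complexToReal H
  haveI : ProperSpace H := FiniteDimensional.proper ℝ H
  set K := closedBall z0 R with hK
  have hnc : ContinuousOn (fun z => ∑ i, ‖F i z‖ ^ 2) K :=
    continuousOn_finset_sum _ fun i _ => (((hF i).continuousOn.mono hKW).norm).pow 2
  obtain ⟨M, hM⟩ := ((isCompact_closedBall z0 R).image_of_continuousOn hnc).isBounded.exists_norm_le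
  set s : ℝ := 1 / Real.sqrt (|M| + 1) with hs
  have hsp : 0 < s := by positivity
  set F' : Fin m → H → ℂ := fun i z => (s : ℂ) * F i z with hF'
  have hF'd : ∀ i, DifferentiableOn ℂ (F' i) W := fun i => (hF i).const_mul _
  have hsum : ∀ z, ∑ i, ‖F' i z‖ ^ 2 = s ^ 2 * ∑ i, ‖F i z‖ ^ 2 := by
    intro z; rw [Finset.mul_sum]
    refine Finset.sum_congr rfl fun i _ => ?_
    simp only [hF', norm_mul, Complex.norm_real, Real.norm_eq_abs, abs_of_pos hsp, mul_pow]
  have h0 : ∀ z, (∑ i, ‖F' i z‖ ^ 2 = 0) ↔ ∀ i, F i z = 0 := by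
    intro z
    rw [hsum, mul_eq_zero, or_iff_right (by positivity),
      Finset.sum_eq_zero_iff_of_nonneg (fun i _ => sq_nonneg _)]
    simp
  have h1 : ∀ z ∈ K, ∑ i, ‖F' i z‖ ^ 2 ≤ 1 := by
    intro z hz
    have h2 : (∑ i, ‖F i z‖ ^ 2) ≤ M := (abs_le.1 (hM _ (mem_image_of_mem _ hz))).2
    rw [hsum, hs, div_pow, Real.sq_sqrt (by positivity), one_pow, div_mul_eq_mul_div, one_mul,
      div_le_one (by positivity)]
    linarith [le_abs_self M]
  set n : H → ℝ := fun z => ∑ i, ‖F' i z‖ ^ 2 with hn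
  have step : ∀ k (w : {w : H → ℝ // SS z0 R w ∧ ∀ z ∈ K, n z = 0 → w z = v k z}),
      ∃ v', SS z0 R v' ∧ (∀ z ∈ K, n z = 0 → v' z = v (k + 1) z) ∧ (∀ z ∈ K, v' z ≤ w.1 z) ∧
        ∀ z ∈ K, n z ≠ 0 → w.1 z + (1 / 2) ^ k * Real.log (n z) ≤ v' z := fun k w =>
    B3s hW hKW hF'd h1 w.2.1 (hv (k + 1)) (fun z hz hz0 => by
      rw [w.2.2 z hz hz0]; exact hdec k z hz ((h0 z).1 hz0)) (by positivity)
  choose nx hnx1 hnx2 hnx3 hnx4 using step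
  let sq : ∀ k, {w : H → ℝ // SS z0 R w ∧ ∀ z ∈ K, n z = 0 → w z = v k z} := fun k =>
    Nat.rec (motive := fun k => {w : H → ℝ // SS z0 R w ∧ ∀ z ∈ K, n z = 0 → w z = v k z})
      ⟨v 0, hv 0, fun z _ _ => rfl⟩ (fun k w => ⟨nx k w, hnx1 k w, hnx2 k w⟩) k
  refine ⟨fun k => (sq k).1, fun k => (sq k).2.1, fun k => hnx3 k (sq k), fun k z hz hz0 =>
    (sq k).2.2 z hz ((h0 z).2 hz0), fun z hz hz0 => ?_⟩
  have hz0' : n z ≠ 0 := fun h => hz0 ((h0 z).1 h)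
  have hlog : Real.log (n z) ≤ 0 := Real.log_nonpos (by simp only [hn]; positivity) (h1 z hz)
  have key : ∀ k, (sq 0).1 z + (2 - 2 * (1 / 2 : ℝ) ^ k) * Real.log (n z) ≤ (sq k).1 z := by
    intro k
    induction k with
    | zero => simp
    | succ k ih =>
      have := hnx4 k (sq k) z hz hz0'
      have h5 : (sq (k + 1)).1 z = nx k (sq k) z := rfl
      rw [h5, pow_succ]
      linarith
  refine ⟨(sq 0).1 z + 2 * Real.log (n z), fun k => le_trans ?_ (key k)⟩
  have : (0 : ℝ) < (1 / 2) ^ k := by positivity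
  nlinarith

lemma limit_sub {z0 : H} {R : ℝ} {w : ℕ → H → ℝ} (hw : ∀ k, SS z0 R (w k))
    (hdec : ∀ k, ∀ z ∈ closedBall z0 R, w (k + 1) z ≤ w k z) :
    UpperSemicontinuousOn (fun z => ⨅ k, (w k z : EReal)) (ball z0 R) ∧
    ∀ a b : H, SubharmonicOnCC (fun t : ℂ => ⨅ k, (w k (a + t • b) : EReal)) {t : ℂ | a + t • b ∈ ball z0 R} := by
  have husc : UpperSemicontinuousOn (fun z => ⨅ k, (w k z : EReal)) (ball z0 R) := by
    intro z hz y hy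
    obtain ⟨k, hk⟩ := iInf_lt_iff.1 hy
    have h1 : ContinuousWithinAt (fun z => (w k z : EReal)) (ball z0 R) z :=
      continuous_coe_real_ereal.continuousAt.comp_continuousWithinAt
        (((hw k).1.mono ball_subset_closedBall) z hz)
    filter_upwards [h1.eventually (gt_mem_nhds hk)] with x hx
    exact (iInf_le _ k).trans_lt hx
  refine ⟨husc, fun a b => ⟨?_, ?_⟩⟩
  · intro t ht y hy
    have h1 : Continuous fun t : ℂ => a + t • b := by fun_prop
    exact (h1.continuousWithinAt.tendsto_nhdsWithin (fun _ h => h)) (husc _ ht y hy)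
  intro c r hr hcr h hh1 hh2 hs z hz
  have hanti : ∀ n k, n ≤ k → ∀ z ∈ closedBall z0 R, w k z ≤ w n z := by
    intro n k hnk
    induction hnk with
    | refl => exact fun z _ => le_rfl
    | step _ ih => exact fun z hz => (hdec _ z hz).trans (ih z hz)
  refine EReal.le_of_forall_lt_iff_le.1 fun e he => ?_
  have he' : h z < e := by exact_mod_cast he
  set ε := e - h z with hε
  have hmem : ∀ t ∈ closedBall c r, a + t • b ∈ closedBall z0 R := fun t ht =>
    ball_subset_closedBall (hcr ht)
  have hwc : ∀ k, ContinuousOn (fun t : ℂ => w k (a + t • b)) (closedBall c r) := fun k =>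
    (hw k).1.comp (by fun_prop) hmem
  have hD : ∃ k, ∀ t ∈ sphere c r ∩ sphere c r, w k (a + t • b) < h t + ε := by
    refine (isCompact_sphere c r).induction_on
      (p := fun s => ∃ k, ∀ t ∈ s ∩ sphere c r, w k (a + t • b) < h t + ε)
      ⟨0, by simp⟩ (fun s t hst ⟨c, h2⟩ => ⟨c, fun z hz => h2 z ⟨hst hz.1, hz.2⟩⟩) ?_ fun t ht => ?_
    · rintro s t ⟨k, h2⟩ ⟨k', h2'⟩
      refine ⟨max k k', ?_⟩
      rintro x ⟨hx | hx, hxs⟩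
      · exact (hanti k _ (le_max_left _ _) _ (hmem x (sphere_subset_closedBall hxs))).trans_lt (h2 x ⟨hx, hxs⟩)
      · exact (hanti k' _ (le_max_right _ _) _ (hmem x (sphere_subset_closedBall hxs))).trans_lt (h2' x ⟨hx, hxs⟩)
    · have h3 : (⨅ k, (w k (a + t • b) : EReal)) < ((h t + ε : ℝ) : EReal) :=
        (hs t ht).trans_lt (by exact_mod_cast (by linarith : h t < h t + ε))
      obtain ⟨k, hk⟩ := iInf_lt_iff.1 h3
      have hk' : w k (a + t • b) < h t + ε := by exact_mod_cast hk
      have h4 := ((hwc k).mono sphere_subset_closedBall t ht).eventually_lt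
        (((hh1.mono sphere_subset_closedBall) t ht).add continuousWithinAt_const) hk'
      exact ⟨_, h4, k, fun x hx => hx.1⟩
  obtain ⟨k, hk⟩ := hD
  have h5 := (hw k).2.dom a b (c := c) (r := r) hcr (h := fun t => h t + ε) (by fun_prop)
    (fun x hx => by
      obtain ⟨W, h1, h2, h3, f, h4, h5⟩ := hh2 x hx
      exact ⟨W, h1, h2, h3, fun z => f z + (ε : ℝ), by fun_prop, fun w hw => by
        rw [Complex.add_re, Complex.ofReal_re, ← h5 w hw]⟩)
    (fun x hx => (hk x ⟨hx, hx⟩).le) z hz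
  refine (iInf_le _ k).trans ?_
  have : w k (a + z • b) ≤ e := by linarith
  exact_mod_cast this
end BB3
end

section
section PB
variable {X : Type*} [TopologicalSpace X]

instance instCompleteChart (c : CChart X) : CompleteSpace c.E := FiniteDimensional.complete ℂ c.E

lemma chart_locext {S : CSpace X} {u : X → EReal} (hu : SpacePSHOn S u univ) {c : CChart X}
    (hc : c ∈ S.atlas) {p : X} (hp : p ∈ c.U) (N : ℝ) :
    ∃ G : Set c.E, IsOpen G ∧ c.φ p ∈ G ∧ ∃ ψ : c.E → ℝ, RP ψ G ∧ (∀ z, -N ≤ ψ z ∨ z ∉ G) ∧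
      ∀ q ∈ c.U, c.φ q ∈ G → ψ (c.φ q) = (max (u q) ((-N : ℝ) : EReal)).toReal := by
  obtain ⟨h1, -, h3⟩ := hu
  obtain ⟨d, hd, hpd, V', hV', hV'V, hpV', -, ψ, hψ, hψu⟩ := h3 p (mem_univ _)
  obtain ⟨W, hW, hpW, F, hF, hFe⟩ := S.compat c hc d hd p ⟨hp, hpd⟩
  obtain ⟨V2, hV2, hV2e⟩ := c.open_image (c.U ∩ d.U) inter_subset_left (c.openU.inter d.openU)
  have hpV2 : c.φ p ∈ V2 := by
    have : c.φ p ∈ c.B ∩ V2 := hV2e ▸ mem_image_of_mem _ ⟨hp, hpd⟩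
    exact this.2
  have hG : IsOpen ((W ∩ V2) ∩ F ⁻¹' V') :=
    (hF.continuousOn.mono inter_subset_left).isOpen_inter_preimage (hW.inter hV2) hV'
  have hT := (trunc_RP hV' hψ.1 hψ.2.1 hψ.2.2.2 N).comp hG (hF.mono fun z hz => hz.1.1) fun z hz => hz.2
  refine ⟨_, hG, ⟨⟨hpW, hpV2⟩, ?_⟩, _, hT, ?_, ?_⟩
  · show F (c.φ p) ∈ V'
    rw [hFe p ⟨hp, hpd⟩ hpW]; exact hpV'
  · intro z
    by_cases hz : z ∈ (W ∩ V2) ∩ F ⁻¹' V'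
    · left
      have := le_max_right (ψ (F z)) ((-N : ℝ) : EReal)
      rw [← coe_trunc (hψ.1 _ hz.2) N] at this
      exact_mod_cast this
    · exact Or.inr hz
  · intro q hq hqG
    have h4 : c.φ q ∈ c.B ∩ V2 := ⟨c.mapsToB q hq, hqG.1.2⟩
    rw [← hV2e] at h4
    obtain ⟨q', hq', he⟩ := h4
    have : q' = q := c.injOn hq'.1 hq he
    subst this
    have h5 := hqG.2
    have h6 := hFe q' hq' hqG.1.1
    simp only [mem_preimage] at h5
    rw [h6] at h5 ⊢
    rw [hψu q' hq'.2 h5]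

lemma partB {S : CSpace X} {u : ℕ → X → EReal} (hpsh : ∀ n, SpacePSHOn S (u n) univ)
    (hdec : ∀ x, Antitone fun n => u n x) {c : CChart X} (hc : c ∈ S.atlas) {x : X} (hx : x ∈ c.U) :
    ∃ V' : Set c.E, IsOpen V' ∧ V' ⊆ c.V ∧ c.φ x ∈ V' ∧ ∃ w : ℕ → c.E → ℝ,
      (∀ k, ContinuousOn (w k) V' ∧ RP (w k) V') ∧ (∀ k, ∀ z ∈ V', w (k + 1) z ≤ w k z) ∧
      (∀ y ∈ c.U, c.φ y ∈ V' → (⨅ k, (w k (c.φ y) : EReal)) = ⨅ n, u n y) ∧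
      (∀ z ∈ V', z ∉ c.B → ∃ a : ℝ, ∀ k, a ≤ w k z) ∧
      UpperSemicontinuousOn (fun z => ⨅ k, (w k z : EReal)) V' ∧
      ∀ a b : c.E, SubharmonicOnCC (fun t : ℂ => ⨅ k, (w k (a + t • b) : EReal)) {t : ℂ | a + t • b ∈ V'} := by
  haveI : Nonempty X := ⟨x⟩
  obtain ⟨W, hW, hxW, hWV, m, F, hF, hBW⟩ := c.subvariety.2.2 (c.φ x) (c.subvariety.2.1 (c.mapsToB x hx))
  let L : c.E ≃L[ℂ] EuclideanSpace ℂ (Fin (Module.finrank ℂ c.E)) :=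
    ContinuousLinearEquiv.ofFinrankEq (by simp)
  set z0 := L (c.φ x) with hz0
  have hWo : IsOpen (L.symm ⁻¹' W) := hW.preimage L.symm.continuous
  obtain ⟨R, hR, hRW⟩ := Metric.nhds_basis_closedBall.mem_iff.1 (hWo.mem_nhds
    (show z0 ∈ L.symm ⁻¹' W by simpa [hz0] using hxW))
  set W' := L.symm ⁻¹' W with hW'
  set F' : Fin m → _ → ℂ := fun i z => F i (L.symm z) with hF'
  have hFd : ∀ i, DifferentiableOn ℂ (F' i) W' := fun i =>
    (hF i).comp L.symm.differentiable.differentiableOn fun z hz => hz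
  set Y := {z ∈ closedBall z0 R | ∀ i, F' i z = 0} with hY
  set U : ℕ → _ → ℝ := fun k z => (max (u k (Function.invFunOn c.φ c.U (L.symm z))) ((-(k:ℝ) : ℝ) : EReal)).toReal with hU
  have htop : ∀ k y, u k y < ⊤ := fun k y => (hpsh k).1 y (mem_univ _)
  have hYB : ∀ z ∈ W', ((∀ i, F' i z = 0) ↔ L.symm z ∈ c.B) := by
    intro z hz
    have h1 := Set.ext_iff.1 hBW (L.symm z)
    exact ⟨fun h => (h1.2 ⟨hz, h⟩).1, fun h => (h1.1 ⟨h, hz⟩).2⟩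
  have hLE : ∀ k, LocExt Y univ (U k) := by
    rintro k y ⟨⟨hy1, hy2⟩, -⟩
    have hyB := (hYB y (hRW hy1)).1 hy2
    rw [← c.image_eq] at hyB
    obtain ⟨p, hp, hpy⟩ := hyB
    obtain ⟨G, hG, hpG, ψ, hψ, hψN, hψe⟩ := chart_locext (hpsh k) hc hp k
    have hGo : IsOpen (L.symm ⁻¹' G) := hG.preimage L.symm.continuous
    refine ⟨L.symm ⁻¹' G, hGo, ?_, _, hψ.comp hGo L.symm.differentiable.differentiableOn fun z hz => hz,
      ⟨k, fun z hz => (hψN _).resolve_right (not_not.2 hz)⟩, ?_⟩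
    · show L.symm y ∈ G
      rw [← hpy]; exact hpG
    · rintro z ⟨⟨hz1, hz2⟩, hzG⟩
      have hzB := (hYB z (hRW hz1)).1 hz2
      rw [← c.image_eq] at hzB
      have h4 := Function.invFunOn_mem hzB
      have h5 := Function.invFunOn_eq hzB
      have := hψe _ h4 (by rw [h5]; exact hzG)
      rw [h5] at this
      exact this
  have husc : ∀ k, UpperSemicontinuousOn (U k) Y := by
    intro k y hy a ha
    obtain ⟨G, hG, hyG, ψ, hψ, -, he⟩ := hLE k y ⟨hy, mem_univ _⟩
    have h1 : ψ y < a := by rw [he y ⟨hy, hyG⟩]; exact ha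
    have h2 := hψ.1 y hyG a h1
    rw [hG.nhdsWithin_eq hyG] at h2
    filter_upwards [nhdsWithin_le_nhds h2, self_mem_nhdsWithin, nhdsWithin_le_nhds (hG.mem_nhds hyG)] with z h3 h4 h5
    rw [← he z ⟨h4, h5⟩]; exact h3
  have hUc : ∀ k z, ((U k z : ℝ) : EReal) = max (u k (Function.invFunOn c.φ c.U (L.symm z))) ((-(k:ℝ) : ℝ) : EReal) :=
    fun k z => coe_trunc (htop k _) k
  have hz0Y : z0 ∈ Y := ⟨mem_closedBall_self hR.le, (hYB z0 (hRW (mem_closedBall_self hR.le))).2 (by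
    simpa [hz0] using c.mapsToB x hx)⟩
  obtain ⟨v, hv1, hv2, hv3⟩ := B3a (half_pos hR) (half_lt_self hR) hWo hRW hFd hY hz0Y husc
    (b := fun k => -(k:ℝ)) (fun k z hz => by
      have := le_max_right (u k (Function.invFunOn c.φ c.U (L.symm z))) ((-(k:ℝ) : ℝ) : EReal)
      rw [← hUc] at this; exact_mod_cast this)
    (fun k y hy => hLE k y ⟨hy.1, mem_univ _⟩) (fun k z hz => by
      have : ((U (k+1) z : ℝ) : EReal) ≤ (U k z : ℝ) := by
        rw [hUc, hUc]
        refine max_le_max (hdec _ (Nat.le_succ k)) ?_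
        rw [EReal.coe_le_coe_iff]; push_cast; linarith
      exact_mod_cast this)
  have hsub : closedBall z0 (R/2) ⊆ closedBall z0 R := closedBall_subset_closedBall (by linarith)
  have hv1' : ∀ k, SS z0 (R/2) (v k) := fun k => (hv1 k).mono (by linarith)
  obtain ⟨w, hw1, hw2, hw3, hw4⟩ := B3b hWo (hsub.trans hRW) hFd hv1' (fun k z hz h => hv2 k z ⟨⟨hsub hz, h⟩, hz⟩)
  obtain ⟨hl1, hl2⟩ := limit_sub hw1 hw2
  set V' := L ⁻¹' (ball z0 (R/2)) with hV'
  have hV'o : IsOpen V' := isOpen_ball.preimage L.continuous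
  have hVW : ∀ z ∈ V', L z ∈ W' := fun z hz => hRW (hsub (ball_subset_closedBall hz))
  refine ⟨V', hV'o, ?_, mem_ball_self (half_pos hR), fun k z => w k (L z), ?_, ?_, ?_, ?_, ?_, ?_⟩
  · intro z hz
    have := hVW z hz
    exact hWV (by simpa [hW'] using this)
  · intro k
    exact ⟨((hw1 k).1.mono ball_subset_closedBall).comp L.continuous.continuousOn fun z hz => hz,
      (hw1 k).2.comp hV'o L.differentiable.differentiableOn fun z hz => hz⟩
  · exact fun k z hz => hw2 k _ (ball_subset_closedBall hz)
  · intro y hy hyV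
    have hz : L (c.φ y) ∈ closedBall z0 (R/2) := ball_subset_closedBall hyV
    have h0 := (hYB _ (hVW _ hyV)).2 (by simpa using c.mapsToB y hy)
    have h1 := hv3 _ ⟨⟨hsub hz, h0⟩, hz⟩
    have h2 : ∀ k, w k (L (c.φ y)) = v k (L (c.φ y)) := fun k => hw3 k _ hz h0
    simp only [h2]
    rw [h1]
    have h3 : Function.invFunOn c.φ c.U (c.φ y) = y :=
      c.injOn (Function.invFunOn_mem ⟨y, hy, rfl⟩) hy (Function.invFunOn_eq ⟨y, hy, rfl⟩)
    have h4 : ∀ k, ((U k (L (c.φ y)) : ℝ) : EReal) = max (u k y) ((-(k:ℝ) : ℝ) : EReal) := by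
      intro k; rw [hUc]; simp [h3]
    simp only [h4]
    refine le_antisymm (le_of_forall_gt fun b hb => ?_) (le_iInf fun k => (iInf_le _ k).trans (le_max_left _ _))
    obtain ⟨n, hn⟩ := iInf_lt_iff.1 hb
    obtain ⟨r, hr⟩ := EReal.lt_iff_exists_real_btwn.1 hn
    obtain ⟨M, hM⟩ := exists_nat_gt (-r)
    refine (iInf_le _ (max n M)).trans_lt (max_lt ((hdec y (le_max_left n M)).trans_lt hn) ?_)
    refine lt_trans ?_ hr.2
    have : (M : ℝ) ≤ ((max n M : ℕ) : ℝ) := by exact_mod_cast le_max_right n M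
    rw [EReal.coe_lt_coe_iff]; linarith
  · intro z hz hzB
    refine hw4 _ (ball_subset_closedBall hz) fun h => hzB ?_
    simpa using (hYB _ (hVW _ hz)).1 h
  · intro z hz y hy
    have := hl1 (L z) hz y hy
    exact (L.continuous.continuousWithinAt.tendsto_nhdsWithin fun z hz => hz) this
  · intro a b
    have := hl2 (L a) (L b)
    simpa [hV', map_add, map_smul] using this
end PB
end

section
section HolB
variable {E : Type*} [NormedAddCommGroup E] [NormedSpace ℂ E] [FiniteDimensional ℂ E]

lemma param_hol {F : E → ℝ → ℂ} {Ω : Set E} (hΩ : IsOpen Ω) (a b : ℝ)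
    (hc : ContinuousOn (Function.uncurry F) (Ω ×ˢ univ)) (hd : ∀ θ, DifferentiableOn ℂ (fun z => F z θ) Ω) :
    DifferentiableOn ℂ (fun z => ∫ θ in a..b, F z θ) Ω := by
  haveI : FiniteDimensional ℝ E := FiniteDimensional.complexToReal E
  haveI : ProperSpace E := FiniteDimensional.proper ℝ E
  intro z0 hz0
  obtain ⟨ρ2, hρ2, hρs⟩ := Metric.nhds_basis_closedBall.mem_iff.1 (hΩ.mem_nhds hz0)
  set ρ := ρ2 / 2 with hρ
  have hρp : 0 < ρ := half_pos hρ2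
  set Q := closedBall z0 ρ2 ×ˢ uIcc a b with hQ
  have hQc : IsCompact Q := (isCompact_closedBall _ _).prod isCompact_uIcc
  have hQs : Q ⊆ Ω ×ˢ univ := prod_mono hρs (subset_univ _)
  obtain ⟨M, hM⟩ := (hQc.image_of_continuousOn (hc.mono hQs)).isBounded.exists_norm_le
  have hM' : ∀ x ∈ closedBall z0 ρ2, ∀ θ ∈ uIcc a b, ‖F x θ‖ ≤ M := fun x hx θ hθ =>
    hM _ ⟨(x, θ), ⟨hx, hθ⟩, rfl⟩
  have hsub : ∀ x ∈ ball z0 ρ, ball x ρ ⊆ closedBall z0 ρ2 := fun x hx y hy => by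
    rw [mem_ball] at hx hy; rw [mem_closedBall]
    linarith [dist_triangle y x z0]
  have hcθ : ∀ x ∈ Ω, Continuous (F x) := fun x hx => by
    rw [← continuousOn_univ]
    exact hc.comp (by fun_prop : ContinuousOn (fun θ : ℝ => (x, θ)) univ) fun θ _ => ⟨hx, mem_univ _⟩
  have hz00 : z0 ∈ closedBall z0 ρ2 := mem_closedBall_self hρ2.le
  have hF'c : ContinuousOn (fun θ => fderiv ℂ (fun z => F z θ) z0) (uIcc a b) := by
    rw [Metric.continuousOn_iff]
    intro θ hθ ε hε
    have hu := hQc.uniformContinuousOn_of_continuous (hc.mono hQs)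
    rw [Metric.uniformContinuousOn_iff] at hu
    obtain ⟨δ, hδ, hδ'⟩ := hu (ε * ρ / 4) (by positivity)
    refine ⟨δ, hδ, fun θ' hθ' hdist => ?_⟩
    have h1 : ∀ x ∈ closedBall z0 ρ2, ‖F x θ' - F x θ‖ < ε * ρ / 4 := fun x hx => by
      have := hδ' (x, θ') ⟨hx, hθ'⟩ (x, θ) ⟨hx, hθ⟩ (by simpa [Prod.dist_eq, hδ] using hdist)
      simpa [dist_eq_norm] using this
    have hdd : ∀ θ, DifferentiableAt ℂ (fun z => F z θ) z0 := fun θ => (hd θ).differentiableAt (hΩ.mem_nhds hz0)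
    rw [dist_eq_norm, ← fderiv_fun_sub (hdd _) (hdd _)]
    have h2 := Complex.norm_fderiv_le_div_of_mapsTo_ball (f := fun z => F z θ' - F z θ) (c := z0) (R₁ := ρ)
      (R₂ := ε * ρ / 2) (((hd θ').sub (hd θ)).mono ((hsub z0 (mem_ball_self hρp)).trans hρs)) (fun x hx => by
        have h3 := h1 x (hsub z0 (mem_ball_self hρp) hx)
        have h4 := h1 z0 hz00
        first
        | (rw [mem_ball, dist_eq_norm]; exact (norm_sub_le _ _).trans_lt (by linarith))
        | (rw [mem_closedBall, dist_eq_norm]; exact (norm_sub_le _ _).trans (by linarith))) hρp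
    refine h2.trans_lt ?_
    rw [div_lt_iff₀ hρp]; nlinarith
  have := intervalIntegral.hasFDerivAt_integral_of_dominated_of_fderiv_le (𝕜 := ℂ) (μ := volume) (a := a) (b := b)
    (F := F) (F' := fun x θ => fderiv ℂ (fun z => F z θ) x) (x₀ := z0) (s := ball z0 ρ)
    (bound := fun _ => (2 * M + 1) / ρ) (ball_mem_nhds _ hρp) ?_ ?_ ?_ ?_ ?_ ?_
  · exact this.differentiableAt.differentiableWithinAt
  · filter_upwards [hΩ.mem_nhds hz0] with x hx
    exact (hcθ x hx).aestronglyMeasurable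
  · exact (hcθ z0 hz0).intervalIntegrable _ _
  · exact (hF'c.mono uIoc_subset_uIcc).aestronglyMeasurable measurableSet_uIoc
  · refine Eventually.of_forall fun θ hθ x hx => ?_
    have hθ' := uIoc_subset_uIcc hθ
    refine Complex.norm_fderiv_le_div_of_mapsTo_ball ((hd θ).mono ((hsub x hx).trans hρs)) (fun y hy => ?_) hρp
    have h3 := hM' y (hsub x hx hy) θ hθ'
    have h4 := hM' x (hsub x hx (mem_ball_self hρp)) θ hθ'
    first
    | (rw [mem_ball, dist_eq_norm]; exact (norm_sub_le _ _).trans_lt (by linarith))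
    | (rw [mem_closedBall, dist_eq_norm]; exact (norm_sub_le _ _).trans (by linarith))
  · exact intervalIntegrable_const
  · refine Eventually.of_forall fun θ hθ x hx => ?_
    exact ((hd θ).differentiableAt (hΩ.mem_nhds (hρs (hsub x hx (mem_ball_self hρp))))).hasFDerivAt

lemma param_circle {f : E → ℂ → ℂ} {Ω : Set E} (hΩ : IsOpen Ω) {c : ℂ} {r : ℝ} (hr : 0 ≤ r)
    (hc : ContinuousOn (Function.uncurry f) (Ω ×ˢ sphere c r))
    (hd : ∀ ζ ∈ sphere c r, DifferentiableOn ℂ (fun z => f z ζ) Ω) :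
    DifferentiableOn ℂ (fun z => ∮ ζ in C(c, r), f z ζ) Ω := by
  unfold circleIntegral
  refine param_hol hΩ _ _ ?_ fun θ => ?_
  · have h1 : ContinuousOn (fun p : E × ℝ => f p.1 (circleMap c r p.2)) (Ω ×ˢ univ) :=
      hc.comp (f := fun p : E × ℝ => (p.1, circleMap c r p.2)) (by fun_prop) fun p hp => ⟨hp.1, circleMap_mem_sphere c hr _⟩
    have h2 : ContinuousOn (fun p : E × ℝ => deriv (circleMap c r) p.2) (Ω ×ˢ univ) := by
      simp only [deriv_circleMap]; fun_prop
    exact h2.smul h1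
  · exact (hd _ (circleMap_mem_sphere c hr θ)).const_smul (deriv (circleMap c r) θ)

lemma line_diff {f : E → ℂ} {Ω : Set E} (hΩ : IsOpen Ω) (hf : DifferentiableOn ℂ f Ω) (z e : E) :
    IsOpen {t : ℂ | z + t • e ∈ Ω} ∧ DifferentiableOn ℂ (fun t : ℂ => f (z + t • e)) {t : ℂ | z + t • e ∈ Ω} :=
  ⟨hΩ.preimage (by fun_prop), hf.comp (by fun_prop) fun t ht => ht⟩

lemma dirDeriv_hol {f : E → ℂ} {Ω : Set E} (hΩ : IsOpen Ω) (hf : DifferentiableOn ℂ f Ω) (e : E) :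
    DifferentiableOn ℂ (fun z => fderiv ℂ f z e) Ω := by
  intro z0 hz0
  have hcont : ContinuousAt (fun p : E × ℂ => p.1 + p.2 • e) (z0, 0) := by fun_prop
  have h1 : ∀ᶠ p : E × ℂ in 𝓝 (z0, 0), p.1 + p.2 • e ∈ Ω := hcont.eventually (by simpa using hΩ.mem_nhds hz0)
  rw [nhds_prod_eq] at h1
  obtain ⟨O, hO, T, hT, hOT⟩ := Filter.mem_prod_iff.1 h1
  obtain ⟨ε, hε, hεT⟩ := Metric.nhds_basis_closedBall.mem_iff.1 hT
  have hOT' : ∀ z ∈ interior O, ∀ t ∈ closedBall (0:ℂ) ε, z + t • e ∈ Ω := fun z hz t ht =>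
    hOT (show (z, t) ∈ O ×ˢ T from ⟨interior_subset hz, hεT ht⟩)
  have hd : DifferentiableOn ℂ (fun z => (2 * Real.pi * Complex.I : ℂ)⁻¹ • ∮ t in C(0, ε), ((t - 0) ^ 2)⁻¹ • f (z + t • e)) (interior O) := by
    refine (param_circle (f := fun z t => ((t - 0) ^ 2)⁻¹ • f (z + t • e)) isOpen_interior hε.le ?_ ?_).const_smul (2 * Real.pi * Complex.I : ℂ)⁻¹
    · refine ContinuousOn.smul (s := interior O ×ˢ sphere (0:ℂ) ε) (f := fun p : E × ℂ => ((p.2 - 0) ^ 2)⁻¹) (ContinuousOn.inv₀ (by fun_prop) ?_) (hf.continuousOn.comp (f := fun p : E × ℂ => p.1 + p.2 • e) (by fun_prop) ?_)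
      · rintro ⟨z, t⟩ ⟨-, ht⟩
        have : t ≠ 0 := by rintro rfl; simp at ht; linarith
        simpa using this
      · rintro ⟨z, t⟩ ⟨hz, ht⟩
        exact hOT' z hz t (sphere_subset_closedBall ht)
    · intro t ht
      exact (hf.comp (f := fun z => z + t • e) (by fun_prop) fun z hz => hOT' z hz t (sphere_subset_closedBall ht)).const_smul ((t - 0) ^ 2)⁻¹
  have hz0O : z0 ∈ interior O := mem_interior_iff_mem_nhds.2 hO
  refine ((hd z0 hz0O).differentiableAt (isOpen_interior.mem_nhds hz0O)).congr_of_eventuallyEq ?_ |>.differentiableWithinAt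
  filter_upwards [isOpen_interior.mem_nhds hz0O] with z hz
  obtain ⟨hU, hfd⟩ := line_diff hΩ hf z e
  have h2 := Complex.two_pi_I_inv_smul_circleIntegral_sub_sq_inv_smul_of_differentiable hU
    (fun t ht => hOT' z hz t ht) hfd (mem_ball_self hε)
  have hzΩ : z ∈ Ω := by simpa using hOT' z hz 0 (by simp [hε.le])
  rw [h2]
  have h3 : HasDerivAt (fun t : ℂ => z + t • e) e 0 := by
    simpa using ((hasDerivAt_id (0:ℂ)).smul_const e).const_add z
  have h4 : HasFDerivAt f (fderiv ℂ f z) (z + (0:ℂ) • e) := by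
    simpa using (hf.differentiableAt (hΩ.mem_nhds hzΩ)).hasFDerivAt
  exact (h4.comp_hasDerivAt (0:ℂ) h3).deriv.symm

def Dn (Ω : Set E) (G : E → ℂ) : Prop := ∀ z ∈ Ω, ∃ᶠ z' in 𝓝 z, G z' ≠ 0

lemma ident_conv {f : E → ℂ} {Ω : Set E} (hΩ : IsOpen Ω) (hcv : Convex ℝ Ω) (hf : DifferentiableOn ℂ f Ω)
    {z1 : E} (hz1 : z1 ∈ Ω) (h0 : ∀ᶠ z in 𝓝 z1, f z = 0) : ∀ z ∈ Ω, f z = 0 := by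
  intro z hz
  obtain ⟨hU, hfd⟩ := line_diff hΩ hf z1 (z - z1)
  have hUc : Convex ℝ {t : ℂ | z1 + t • (z - z1) ∈ Ω} := by
    intro a ha b hb s t hs ht hst
    have := hcv ha hb hs ht hst
    show z1 + (s • a + t • b) • (z - z1) ∈ Ω
    convert this using 1
    have h1 : z1 = s • z1 + t • z1 := by rw [← add_smul, hst, one_smul]
    rw [add_smul, smul_add, smul_add, smul_assoc, smul_assoc]
    nth_rewrite 1 [h1]; abel
  have ha := hfd.analyticOnNhd hU
  have hc : ContinuousAt (fun t : ℂ => z1 + t • (z - z1)) 0 := by fun_prop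
  have := ha.eqOn_zero_of_preconnected_of_eventuallyEq_zero hUc.isPreconnected (z₀ := 0) (by simpa using hz1)
    (hc.eventually (p := fun z => f z = 0) (by simpa using h0))
  simpa using this (show (1:ℂ) ∈ _ by simpa using hz)

lemma Dn.of_ne {f : E → ℂ} {Ω : Set E} (hΩ : IsOpen Ω) (hcv : Convex ℝ Ω) (hf : DifferentiableOn ℂ f Ω)
    {z1 : E} (hz1 : z1 ∈ Ω) (h : f z1 ≠ 0) : Dn Ω f := by
  intro z hz h0
  exact h (ident_conv hΩ hcv hf hz (by simpa using h0) z1 hz1)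

lemma Dn.mul {f g : E → ℂ} {Ω : Set E} (hΩ : IsOpen Ω) (hf : Dn Ω f) (hfc : ContinuousOn f Ω) (hg : Dn Ω g) :
    Dn Ω (fun z => f z * g z) := by
  intro z hz
  rw [Filter.frequently_iff]
  intro U hU
  obtain ⟨z1, hz1, h1⟩ := ((hf z hz).and_eventually (inter_mem (hΩ.mem_nhds hz) (mem_interior_iff_mem_nhds.2 hU |> isOpen_interior.mem_nhds))).exists
  have hc := hfc.continuousAt (hΩ.mem_nhds h1.1)
  obtain ⟨z2, hz2, h2⟩ := ((hg z1 h1.1).and_eventually ((hc.eventually_ne hz1).and (isOpen_interior.mem_nhds h1.2))).exists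
  exact ⟨z2, interior_subset h2.2, mul_ne_zero h2.1 hz2⟩

lemma Dn.prod {ι : Type*} (s : Finset ι) {f : ι → E → ℂ} {Ω : Set E} (hΩ : IsOpen Ω) (hf : ∀ i ∈ s, Dn Ω (f i))
    (hfc : ∀ i ∈ s, ContinuousOn (f i) Ω) : Dn Ω (fun z => ∏ i ∈ s, f i z) := by
  classical
  induction s using Finset.induction_on with
  | empty => intro z hz; simp
  | insert a s ha ih =>
    simp only [Finset.prod_insert ha]
    exact Dn.mul hΩ (hf a (by simp)) (hfc a (by simp)) (ih (fun i hi => hf i (by simp [hi])) fun i hi => hfc i (by simp [hi]))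

lemma Dn.mono {f : E → ℂ} {Ω Ω' : Set E} (hf : Dn Ω f) (h : Ω' ⊆ Ω) : Dn Ω' f := fun z hz => hf z (h hz)

lemma exists_dir {G : E → ℂ} {Ω : Set E} (hΩ : IsOpen Ω) (hG : DifferentiableOn ℂ G Ω) (hD : Dn Ω G)
    {z0 : E} (hz0 : z0 ∈ Ω) : ∃ e : E, ∃ ρ > 0, ∀ t : ℂ, ‖t‖ ≤ ρ → z0 + t • e ∈ Ω ∧ (t ≠ 0 → G (z0 + t • e) ≠ 0) := by
  obtain ⟨R, hR, hRs⟩ := Metric.isOpen_iff.1 hΩ z0 hz0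
  obtain ⟨z1, hz1, h1⟩ := ((hD z0 hz0).and_eventually (ball_mem_nhds z0 hR)).exists
  refine ⟨z1 - z0, ?_⟩
  obtain ⟨hU, hfd⟩ := line_diff isOpen_ball (hG.mono hRs) z0 (z1 - z0)
  have h0 : (0:ℂ) ∈ {t : ℂ | z0 + t • (z1 - z0) ∈ ball z0 R} := by simpa using hR
  have hUc : Convex ℝ {t : ℂ | z0 + t • (z1 - z0) ∈ ball z0 R} := by
    have : {t : ℂ | z0 + t • (z1 - z0) ∈ ball z0 R} = (LinearMap.toSpanSingleton ℂ E (z1 - z0)).restrictScalars ℝ ⁻¹' (ball 0 R) := by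
      ext t; simp [dist_eq_norm]
    rw [this]; exact (convex_ball _ _).linear_preimage _
  have ha := hfd.analyticOnNhd hU
  have hne : ∀ᶠ t in 𝓝[≠] (0:ℂ), G (z0 + t • (z1 - z0)) ≠ 0 := by
    rcases (ha 0 h0).eventually_eq_zero_or_eventually_ne_zero with h | h
    · exfalso
      have := ha.eqOn_zero_of_preconnected_of_eventuallyEq_zero hUc.isPreconnected h0 h (show (1:ℂ) ∈ _ by simpa [dist_eq_norm] using h1)
      simp at this; exact hz1 this
    · exact h
  rw [eventually_nhdsWithin_iff] at hne
  obtain ⟨ρ, hρ, hρs⟩ := Metric.nhds_basis_closedBall.mem_iff.1 (inter_mem hne (hU.mem_nhds h0))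
  refine ⟨ρ, hρ, fun t ht => ?_⟩
  have := hρs (show t ∈ closedBall 0 ρ by simpa using ht)
  exact ⟨hRs this.2, this.1⟩

lemma riem1 {h : ℂ → ℂ} {U : Set ℂ} (hU : IsOpen U) {T : Set ℂ} (hT : ∀ t ∈ U, ∀ᶠ s in 𝓝[≠] t, s ∉ T)
    (hd : ∀ t ∈ U, t ∉ T → DifferentiableAt ℂ h t) (hb : ∀ t ∈ U, ∃ C : ℝ, ∀ᶠ s in 𝓝 t, s ∉ T → ‖h s‖ ≤ C) :
    ∃ h' : ℂ → ℂ, DifferentiableOn ℂ h' U ∧ ∀ t ∈ U, t ∉ T → h' t = h t := by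
  have key : ∀ t ∈ U, t ∉ T → limUnder (𝓝[≠] t) h = h t := fun t ht htT =>
    ((hd t ht htT).continuousAt.tendsto.mono_left nhdsWithin_le_nhds).limUnder_eq
  refine ⟨fun t => limUnder (𝓝[≠] t) h, fun t ht => ?_, key⟩
  obtain ⟨C, hC⟩ := hb t ht
  have h1 := hT t ht
  rw [eventually_nhdsWithin_iff] at h1
  obtain ⟨ρ, hρ, hρs⟩ := Metric.nhds_basis_ball.mem_iff.1 (inter_mem (inter_mem h1 hC) (hU.mem_nhds ht))
  have h2 := Complex.differentiableOn_update_limUnder_of_bddAbove (f := h) (c := t) (ball_mem_nhds t hρ)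
    (fun s hs => (hd s (hρs hs.1).2 ((hρs hs.1).1.1 hs.2)).differentiableWithinAt)
    ⟨C, by rintro _ ⟨s, hs, rfl⟩; exact (hρs hs.1).1.2 ((hρs hs.1).1.1 hs.2)⟩
  refine ((h2 t (mem_ball_self hρ)).differentiableAt (ball_mem_nhds t hρ)).congr_of_eventuallyEq ?_ |>.differentiableWithinAt
  filter_upwards [ball_mem_nhds t hρ] with s hs
  by_cases hst : s = t
  · subst hst; simp
  · rw [Function.update_of_ne hst]
    exact key s (hρs hs).2 ((hρs hs).1.1 hst)

lemma riem {f G : E → ℂ} {Ω : Set E} (hΩ : IsOpen Ω) (hG : DifferentiableOn ℂ G Ω) (hD : Dn Ω G)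
    (hf : ∀ z ∈ Ω, G z ≠ 0 → DifferentiableAt ℂ f z)
    (hb : ∀ z ∈ Ω, ∃ C : ℝ, ∀ᶠ z' in 𝓝 z, G z' ≠ 0 → ‖f z'‖ ≤ C) :
    ∃ f' : E → ℂ, DifferentiableOn ℂ f' Ω ∧ ∀ z ∈ Ω, G z ≠ 0 → f' z = f z := by
  have loc : ∀ z0 ∈ Ω, ∃ O : Set E, IsOpen O ∧ z0 ∈ O ∧ O ⊆ Ω ∧ ∃ g : E → ℂ, DifferentiableOn ℂ g O ∧ ∀ z ∈ O, G z ≠ 0 → g z = f z := by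
    intro z0 hz0
    obtain ⟨e, ρ, hρ, hl⟩ := exists_dir hΩ hG hD hz0
    have hA : IsOpen {p : E × ℂ | p.1 + p.2 • e ∈ Ω} := hΩ.preimage (by fun_prop)
    have h1 : ∀ᶠ z in 𝓝 z0, ∀ t ∈ closedBall (0:ℂ) ρ, z + t • e ∈ Ω := by
      have := (isCompact_closedBall (0:ℂ) ρ).eventually_forall_of_forall_eventually (x₀ := z0) (P := fun z t => z + t • e ∈ Ω)
        (fun t ht => hA.mem_nhds (hl t (by simpa using ht)).1)
      exact this
    have h2 : ∀ᶠ z in 𝓝 z0, ∀ t ∈ sphere (0:ℂ) ρ, G (z + t • e) ≠ 0 := by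
      refine (isCompact_sphere (0:ℂ) ρ).eventually_forall_of_forall_eventually (x₀ := z0) (P := fun z t => G (z + t • e) ≠ 0)
        (fun t ht => ?_)
      have ht' : ‖t‖ = ρ := by simpa using ht
      have ht0 : t ≠ 0 := by rintro rfl; simp at ht'; linarith
      have hc : ContinuousAt (fun p : E × ℂ => G (p.1 + p.2 • e)) (z0, t) :=
        ContinuousAt.comp (f := fun p : E × ℂ => p.1 + p.2 • e) (hG.continuousOn.continuousAt (hΩ.mem_nhds (hl t ht'.le).1)) (by fun_prop)
      exact hc.eventually_ne ((hl t ht'.le).2 ht0)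
    obtain ⟨O, hO, hOo, hz0O⟩ := _root_.mem_nhds_iff.1 (inter_mem h1 h2)
    refine ⟨O, hOo, hz0O, fun z hz => by simpa using (hO hz).1 0 (by simp [hρ.le]), fun z => (2 * Real.pi * Complex.I : ℂ)⁻¹ • ∮ t in C(0, ρ), (t - 0)⁻¹ • f (z + t • e), ?_, ?_⟩
    · refine (param_circle (f := fun z t => (t - 0)⁻¹ • f (z + t • e)) hOo hρ.le ?_ ?_).const_smul (2 * Real.pi * Complex.I : ℂ)⁻¹
      · refine ContinuousOn.smul (f := fun p : E × ℂ => (p.2 - 0)⁻¹) (g := fun p : E × ℂ => f (p.1 + p.2 • e)) (ContinuousOn.inv₀ (by fun_prop) ?_) ?_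
        · rintro ⟨z, t⟩ ⟨-, ht⟩
          have : t ≠ 0 := by rintro rfl; simp at ht; linarith
          simpa using this
        · rintro ⟨z, t⟩ ⟨hz, ht⟩
          exact (ContinuousAt.comp (f := fun p : E × ℂ => p.1 + p.2 • e) (hf _ ((hO hz).1 t (sphere_subset_closedBall ht)) ((hO hz).2 t ht)).continuousAt (by fun_prop)).continuousWithinAt
      · intro t ht z hz
        have := hf _ ((hO hz).1 t (sphere_subset_closedBall ht)) ((hO hz).2 t ht)
        exact ((this.comp z (f := fun z => z + t • e) (by fun_prop)).const_smul (t - 0)⁻¹).differentiableWithinAt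
    · intro z hz hGz
      obtain ⟨hU, hGd⟩ := line_diff hΩ hG z e
      have hzΩ : z ∈ Ω := by simpa using (hO hz).1 0 (by simp [hρ.le])
      have hsub : closedBall (0:ℂ) ρ ⊆ {t : ℂ | z + t • e ∈ Ω} := fun t ht => (hO hz).1 t ht
      obtain ⟨ρ', hρ', hsub'⟩ := (isCompact_closedBall (0:ℂ) ρ).exists_thickening_subset_open hU hsub
      have hU' : ball (0:ℂ) (ρ + ρ') ⊆ {t : ℂ | z + t • e ∈ Ω} := by
        intro t ht; apply hsub'
        rw [thickening_closedBall hρ' hρ.le]; rwa [add_comm]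
      have hGa := (hGd.mono hU').analyticOnNhd isOpen_ball
      obtain ⟨h', hh', hh''⟩ := riem1 (h := fun t => f (z + t • e)) (U := ball (0:ℂ) (ρ + ρ')) isOpen_ball (T := {t | G (z + t • e) = 0})
        (by
          intro t ht
          rcases (hGa t ht).eventually_eq_zero_or_eventually_ne_zero with h | h
          · exfalso
            have := hGa.eqOn_zero_of_preconnected_of_eventuallyEq_zero (convex_ball _ _).isPreconnected ht h (show (0:ℂ) ∈ _ by simp; linarith)
            simp at this; exact hGz this
          · exact h)
        (by
          intro t ht htT
          exact (hf _ (hU' ht) htT).comp t (f := fun t : ℂ => z + t • e) (by fun_prop))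
        (by
          intro t ht
          obtain ⟨C, hC⟩ := hb _ (hU' ht)
          have hc : ContinuousAt (fun t : ℂ => z + t • e) t := by fun_prop
          exact ⟨C, hc.eventually hC⟩)
      have hcau := Complex.two_pi_I_inv_smul_circleIntegral_sub_inv_smul_of_differentiable_on_off_countable (s := ∅) (f := h') (c := 0) (R := ρ) (w := 0)
        countable_empty (mem_ball_self hρ) (hh'.continuousOn.mono (closedBall_subset_ball (by linarith)))
        (fun x hx => (hh' x (ball_subset_ball (by linarith) hx.1)).differentiableAt (isOpen_ball.mem_nhds (ball_subset_ball (by linarith) hx.1)))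
      have h3 : h' 0 = f z := by
        rw [hh'' 0 (by simp; linarith) (by simpa using hGz)]; simp
      rw [← h3, ← hcau]
      show _ • _ = _
      congr 1
      refine circleIntegral.integral_congr hρ.le fun t ht => ?_
      show _ • f (z + t • e) = _ • h' t
      rw [hh'' t (closedBall_subset_ball (by linarith) (sphere_subset_closedBall ht)) ((hO hz).2 t ht)]
  choose! O hO hzO hOs g hg hgf using loc
  refine ⟨fun z => if G z ≠ 0 then f z else g z z, fun z0 hz0 => ?_, fun z _ h => by simp [h]⟩
  refine ((hg z0 hz0 z0 (hzO z0 hz0)).differentiableAt ((hO z0 hz0).mem_nhds (hzO z0 hz0))).congr_of_eventuallyEq ?_ |>.differentiableWithinAt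
  filter_upwards [(hO z0 hz0).mem_nhds (hzO z0 hz0)] with z hz
  by_cases h : G z = 0
  · simp only [h, ne_eq, not_true_eq_false, if_false]
    have hzΩ := hOs z0 hz0 hz
    by_contra hne
    have hc : ContinuousAt (fun z' => g z z' - g z0 z') z := by
      refine ContinuousAt.sub ?_ ?_
      · exact ((hg z hzΩ).continuousOn).continuousAt ((hO z hzΩ).mem_nhds (hzO z hzΩ))
      · exact ((hg z0 hz0).continuousOn).continuousAt ((hO z0 hz0).mem_nhds hz)
    obtain ⟨z1, h1, h2, h3, h4⟩ := ((hD z hzΩ).and_eventually ((hc.eventually_ne (sub_ne_zero.2 hne)).and (((hO z hzΩ).eventually_mem (hzO z hzΩ)).and ((hO z0 hz0).eventually_mem hz)))).exists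
    exact h2 (by rw [hgf z hzΩ z1 h3 h1, hgf z0 hz0 z1 h4 h1, sub_self])
  · simp only [h, ne_eq, not_false_eq_true, if_true]
    exact (hgf z0 hz0 z hz h).symm

end HolB
end

section
section Roots

lemma resid {c : ℂ} {r R : ℝ} (hr : 0 < r) (hrR : r < R) (T : Finset ℂ) : ∀ f : ℂ → ℂ, DifferentiableOn ℂ f (ball c R) →
    (∀ a ∈ closedBall c r, f a = 0 ↔ a ∈ T) → (∀ a ∈ T, a ∈ ball c r) →
    ∃ m : ℂ → ℕ, (∀ a ∈ T, 0 < m a) ∧ ∀ h : ℂ → ℂ, DifferentiableOn ℂ h (ball c R) →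
      (∮ t in C(c, r), h t * (deriv f t / f t)) = 2 * Real.pi * Complex.I * ∑ a ∈ T, m a * h a := by
  classical
  have hsub : closedBall c r ⊆ ball c R := closedBall_subset_ball hrR
  induction T using Finset.induction_on with
  | empty =>
    intro f hf hz _
    refine ⟨fun _ => 1, by simp, fun h hh => ?_⟩
    have hd : ∀ t ∈ closedBall c r, DifferentiableAt ℂ (fun t => h t * (deriv f t / f t)) t := fun t ht => by
      have hn := isOpen_ball.mem_nhds (hsub ht)
      refine ((hh t (hsub ht)).differentiableAt hn).mul ((((hf.deriv isOpen_ball) t (hsub ht)).differentiableAt hn).div ((hf t (hsub ht)).differentiableAt hn) ?_)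
      have := hz t ht; simpa using this
    rw [Complex.circleIntegral_eq_zero_of_differentiable_on_off_countable hr.le countable_empty
      (fun t ht => (hd t ht).continuousAt.continuousWithinAt) (fun t ht => hd t (ball_subset_closedBall ht.1))]
    simp
  | insert a T ha ih =>
    intro f hf hz hT
    have har := hT a (by simp)
    have haR : a ∈ ball c R := hsub (ball_subset_closedBall har)
    have hfa : AnalyticAt ℂ f a := hf.analyticAt (isOpen_ball.mem_nhds haR)
    have hf0 : f a = 0 := (hz a (ball_subset_closedBall har)).2 (by simp)
    have hne : ∀ᶠ t in 𝓝[≠] a, f t ≠ 0 := by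
      have h1 : ∀ᶠ t in 𝓝 a, t ∉ T := (T.finite_toSet.isClosed.isOpen_compl.mem_nhds (by simpa using ha))
      filter_upwards [self_mem_nhdsWithin, nhdsWithin_le_nhds h1, nhdsWithin_le_nhds (isOpen_ball.mem_nhds har)] with t h2 h3 h4 h5
      have := (hz t (ball_subset_closedBall h4)).1 h5
      simp at this; tauto
    have hord : analyticOrderAt f a ≠ ⊤ := by
      intro htop
      rw [analyticOrderAt_eq_top] at htop
      obtain ⟨t, h1, h2⟩ := (hne.and (nhdsWithin_le_nhds htop)).exists
      exact h1 h2
    obtain ⟨n, hn⟩ := ENat.ne_top_iff_exists.1 hord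
    obtain ⟨g0, hg0, hg0a, hfg⟩ := (hfa.analyticOrderAt_eq_natCast).1 hn.symm
    have hn0 : 0 < n := by
      rcases Nat.eq_zero_or_pos n with h | h
      · subst h
        have := hfg.self_of_nhds
        simp [hf0] at this; exact absurd this.symm hg0a
      · exact h
    set g : ℂ → ℂ := fun t => if t = a then g0 a else f t / (t - a) ^ n with hg
    have hgg0 : g =ᶠ[𝓝 a] g0 := by
      filter_upwards [hfg] with t ht
      by_cases h : t = a
      · simp [hg, h]
      · simp only [hg, h, if_false, ht, smul_eq_mul]
        rw [mul_div_cancel_left₀ _ (pow_ne_zero _ (sub_ne_zero.2 h))]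
    have hfg' : ∀ t, f t = (t - a) ^ n * g t := by
      intro t
      by_cases h : t = a
      · subst h; simp [hf0, hn0.ne']
      · simp only [hg, h, if_false]
        rw [mul_div_cancel₀ _ (pow_ne_zero _ (sub_ne_zero.2 h))]
    have hgd : DifferentiableOn ℂ g (ball c R) := by
      intro t ht
      by_cases h : t = a
      · subst h; exact (hg0.differentiableAt.congr_of_eventuallyEq hgg0).differentiableWithinAt
      · have h1 : g =ᶠ[𝓝 t] fun t => f t / (t - a) ^ n := by
          filter_upwards [isOpen_ne.mem_nhds h] with s hs
          simp only [hg, show s ≠ a from hs, if_false]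
        refine (DifferentiableAt.congr_of_eventuallyEq ?_ h1).differentiableWithinAt
        exact ((hf t ht).differentiableAt (isOpen_ball.mem_nhds ht)).div (by fun_prop) (pow_ne_zero _ (sub_ne_zero.2 h))
    have hgz : ∀ b ∈ closedBall c r, g b = 0 ↔ b ∈ T := by
      intro b hb
      by_cases h : b = a
      · subst h; simp [hg, hg0a, ha]
      · have := hz b hb
        simp only [Finset.mem_insert, h, false_or] at this
        rw [← this, hfg' b]; simp [sub_ne_zero.2 h]
    obtain ⟨m, hm, hint⟩ := ih g hgd hgz (fun b hb => hT b (by simp [hb]))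
    refine ⟨fun b => if b = a then n else m b, ?_, fun h hh => ?_⟩
    · intro b hb
      by_cases hba : b = a
      · simp [hba, hn0]
      · simp only [hba, if_false]; exact hm b (by simpa [hba] using hb)
    · have hsp : ∀ t ∈ sphere c r, h t * (deriv f t / f t) = n * ((t - a)⁻¹ • h t) + h t * (deriv g t / g t) := by
        intro t ht
        have htb := hsub (sphere_subset_closedBall ht)
        have hta : t - a ≠ 0 := by
          rw [sub_ne_zero]; rintro rfl
          rw [mem_sphere] at ht; rw [mem_ball] at har; linarith
        have hgt : g t ≠ 0 := by
          intro h0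
          have := hT t (by simp [(hgz t (sphere_subset_closedBall ht)).1 h0])
          rw [mem_sphere] at ht; rw [mem_ball] at this; linarith
        have hd : HasDerivAt f (n * (t - a) ^ (n - 1) * g t + (t - a) ^ n * deriv g t) t := by
          have h1 : HasDerivAt (fun t => (t - a) ^ n) (n * (t - a) ^ (n - 1)) t := by
            simpa using ((hasDerivAt_id t).sub_const a).fun_pow n
          have h2 := h1.mul ((hgd t htb).differentiableAt (isOpen_ball.mem_nhds htb)).hasDerivAt
          exact h2.congr_of_eventuallyEq (Eventually.of_forall fun s => hfg' s)
        rw [hd.deriv, hfg' t]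
        obtain ⟨k, rfl⟩ : ∃ k, n = k + 1 := ⟨n - 1, by omega⟩
        simp only [Nat.add_sub_cancel, smul_eq_mul]
        field_simp
        ring
      rw [circleIntegral.integral_congr hr.le hsp]
      have hc1 : ContinuousOn (fun t => (t - a)⁻¹ • h t) (sphere c r) := by
        refine ContinuousOn.smul (f := fun t => (t - a)⁻¹) (ContinuousOn.inv₀ (by fun_prop) ?_) (hh.continuousOn.mono (sphere_subset_closedBall.trans hsub))
        intro t ht
        rw [sub_ne_zero]; rintro rfl
        rw [mem_sphere] at ht; rw [mem_ball] at har; linarith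
      have hc2 : ContinuousOn (fun t => h t * (deriv g t / g t)) (sphere c r) := by
        refine ContinuousOn.mul (hh.continuousOn.mono (sphere_subset_closedBall.trans hsub)) (ContinuousOn.div ((hgd.deriv isOpen_ball).continuousOn.mono (sphere_subset_closedBall.trans hsub)) (hgd.continuousOn.mono (sphere_subset_closedBall.trans hsub)) ?_)
        intro t ht h0
        have := hT t (by simp [(hgz t (sphere_subset_closedBall ht)).1 h0])
        rw [mem_sphere] at ht; rw [mem_ball] at this; linarith
      rw [circleIntegral.integral_add (f := fun t => (n:ℂ) * ((t - a)⁻¹ • h t)) ((continuousOn_const.mul hc1).circleIntegrable hr.le) (hc2.circleIntegrable hr.le), hint h hh, circleIntegral.integral_const_mul,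
        Complex.circleIntegral_sub_inv_smul_of_differentiable_on_off_countable countable_empty har (hh.continuousOn.mono hsub) (fun t ht => (hh t (hsub (ball_subset_closedBall ht.1))).differentiableAt (isOpen_ball.mem_nhds (hsub (ball_subset_closedBall ht.1))))]
      rw [Finset.sum_insert ha]
      simp only [if_true]
      have : ∑ b ∈ T, ((if b = a then n else m b : ℕ) : ℂ) * h b = ∑ b ∈ T, (m b : ℂ) * h b := by
        refine Finset.sum_congr rfl fun b hb => ?_
        rw [if_neg (by rintro rfl; exact ha hb)]
      rw [this, smul_eq_mul]; ring

lemma zeros_fin {c : ℂ} {r R : ℝ} (hr : 0 < r) (hrR : r < R) {f : ℂ → ℂ} (hf : DifferentiableOn ℂ f (ball c R))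
    (hs : ∀ a ∈ sphere c r, f a ≠ 0) : {a | a ∈ ball c r ∧ f a = 0}.Finite := by
  by_contra hinf
  obtain ⟨a, ha, hacc⟩ := Set.Infinite.exists_accPt_of_subset_isCompact hinf (isCompact_closedBall c r) (fun a ha => ball_subset_closedBall ha.1)
  have haR : a ∈ ball c R := closedBall_subset_ball hrR ha
  have hfa := hf.analyticOnNhd isOpen_ball
  rcases (hfa a haR).eventually_eq_zero_or_eventually_ne_zero with h | h
  · obtain ⟨b, hb⟩ := NormedSpace.sphere_nonempty (x := c) |>.2 hr.le
    exact hs b hb (hfa.eqOn_zero_of_preconnected_of_eventuallyEq_zero (convex_ball _ _).isPreconnected haR h (closedBall_subset_ball hrR (sphere_subset_closedBall hb)))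
  · rw [accPt_iff_frequently_nhdsNE] at hacc
    obtain ⟨b, h1, h2⟩ := (hacc.and_eventually h).exists
    exact h2 h1.2

variable {B : Type*} [NormedAddCommGroup B] [NormedSpace ℂ B] [FiniteDimensional ℂ B]

structure RD (p : B → ℂ → ℂ) (Ω : Set B) (c : ℂ) (r R : ℝ) : Prop where
  op : IsOpen Ω
  rp : 0 < r
  rR : r < R
  dp : DifferentiableOn ℂ (Function.uncurry p) (Ω ×ˢ ball c R)
  ne : ∀ z ∈ Ω, ∀ t ∈ sphere c r, p z t ≠ 0

open Classical in
def zs (p : B → ℂ → ℂ) (c : ℂ) (r : ℝ) (z : B) : Finset ℂ :=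
  if h : {a | a ∈ ball c r ∧ p z a = 0}.Finite then h.toFinset else ∅

lemma RD.slice {p : B → ℂ → ℂ} {Ω : Set B} {c : ℂ} {r R : ℝ} (h : RD p Ω c r R) {z : B} (hz : z ∈ Ω) :
    DifferentiableOn ℂ (p z) (ball c R) :=
  h.dp.comp (f := fun t => (z, t)) (by fun_prop) fun t ht => ⟨hz, ht⟩

lemma RD.mem_zs {p : B → ℂ → ℂ} {Ω : Set B} {c : ℂ} {r R : ℝ} (h : RD p Ω c r R) {z : B} (hz : z ∈ Ω) {a : ℂ} :
    a ∈ zs p c r z ↔ a ∈ ball c r ∧ p z a = 0 := by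
  have := zeros_fin h.rp h.rR (h.slice hz) (h.ne z hz)
  rw [zs, dif_pos this]; simp

lemma RD.powsum {p : B → ℂ → ℂ} {Ω : Set B} {c : ℂ} {r R : ℝ} (h : RD p Ω c r R) :
    ∃ mu : B → ℂ → ℕ, ∃ s : ℕ → B → ℂ, (∀ z ∈ Ω, ∀ a ∈ zs p c r z, 0 < mu z a) ∧ (∀ m, DifferentiableOn ℂ (s m) Ω) ∧
      ∀ z ∈ Ω, ∀ m, s m z = ∑ a ∈ zs p c r z, mu z a * a ^ m := by
  have hO : IsOpen (Ω ×ˢ ball c R) := h.op.prod isOpen_ball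
  have hres : ∀ z ∈ Ω, ∃ m : ℂ → ℕ, (∀ a ∈ zs p c r z, 0 < m a) ∧ ∀ g : ℂ → ℂ, DifferentiableOn ℂ g (ball c R) →
      (∮ t in C(c, r), g t * (deriv (p z) t / p z t)) = 2 * Real.pi * Complex.I * ∑ a ∈ zs p c r z, m a * g a := by
    intro z hz
    refine resid h.rp h.rR _ (p z) (h.slice hz) (fun a ha => ?_) (fun a ha => ((h.mem_zs hz).1 ha).1)
    rw [h.mem_zs hz]
    refine ⟨fun h0 => ⟨?_, h0⟩, fun h0 => h0.2⟩
    rcases (mem_closedBall.1 ha).lt_or_eq with h1 | h1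
    · exact h1
    · exact absurd h0 (h.ne z hz a h1)
  choose! mu hmu hint using hres
  refine ⟨mu, fun m z => (2 * Real.pi * Complex.I : ℂ)⁻¹ * ∮ t in C(c, r), t ^ m * (fderiv ℂ (Function.uncurry p) (z, t) (0, 1) / p z t), hmu, fun m => ?_, fun z hz m => ?_⟩
  · have hd := dirDeriv_hol hO h.dp (0, 1)
    have hs : Ω ×ˢ sphere c r ⊆ Ω ×ˢ ball c R := prod_mono le_rfl (sphere_subset_closedBall.trans (closedBall_subset_ball h.rR))
    refine DifferentiableOn.const_mul (param_circle (f := fun z t => t ^ m * (fderiv ℂ (Function.uncurry p) (z, t) (0, 1) / p z t)) h.op h.rp.le ?_ ?_) _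
    · refine ContinuousOn.mul (f := fun q : B × ℂ => q.2 ^ m) (by fun_prop) (ContinuousOn.div (f := fun q : B × ℂ => fderiv ℂ (Function.uncurry p) (q.1, q.2) (0, 1)) (hd.continuousOn.mono hs) (h.dp.continuousOn.mono hs) ?_)
      rintro ⟨z, t⟩ ⟨hz, ht⟩
      exact h.ne z hz t ht
    · intro t ht
      have ht' := closedBall_subset_ball h.rR (sphere_subset_closedBall ht)
      show DifferentiableOn ℂ (fun z => t ^ m * (fderiv ℂ (Function.uncurry p) (z, t) (0, 1) / p z t)) Ω
      simp only [div_eq_mul_inv]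
      refine DifferentiableOn.const_mul (DifferentiableOn.fun_mul ?_ (DifferentiableOn.fun_inv ?_ fun z hz => h.ne z hz t ht)) _
      · exact hd.comp (f := fun z => (z, t)) (by fun_prop) fun z hz => ⟨hz, ht'⟩
      · exact h.dp.comp (f := fun z => (z, t)) (by fun_prop) fun z hz => ⟨hz, ht'⟩
  · have h1 := hint z hz (fun t => t ^ m) (by fun_prop)
    have h2 : (∮ t in C(c, r), t ^ m * (fderiv ℂ (Function.uncurry p) (z, t) (0, 1) / p z t)) = ∮ t in C(c, r), t ^ m * (deriv (p z) t / p z t) := by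
      refine circleIntegral.integral_congr h.rp.le fun t ht => ?_
      have ht' := closedBall_subset_ball h.rR (sphere_subset_closedBall ht)
      have h3 : HasDerivAt (fun t : ℂ => (z, t)) ((0:B), (1:ℂ)) t := (hasDerivAt_const t z).prodMk (hasDerivAt_id t)
      have h4 := (h.dp.differentiableAt (hO.mem_nhds (show (z, t) ∈ _ from ⟨hz, ht'⟩))).hasFDerivAt.comp_hasDerivAt t h3
      have h5 : deriv (p z) t = fderiv ℂ (Function.uncurry p) (z, t) (0, 1) := h4.deriv
      simp only [h5]
    beta_reduce
    rw [h2, h1, inv_mul_cancel_left₀ Complex.two_pi_I_ne_zero]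

lemma RD.sub {p : B → ℂ → ℂ} {Ω : Set B} {c : ℂ} {r R : ℝ} (h : RD p Ω c r R) {z0 : B} (hz0 : z0 ∈ Ω) {a : ℂ} (ha : a ∈ ball c r)
    {ε : ℝ} (hε : 0 < ε) (hεs : closedBall a ε ⊆ ball c r) (hne : ∀ t ∈ sphere a ε, p z0 t ≠ 0) :
    ∃ Ω' ∈ 𝓝 z0, Ω' ⊆ Ω ∧ ∃ R', RD p Ω' a ε R' := by
  obtain ⟨ε', hε', hs'⟩ := (isCompact_closedBall a ε).exists_thickening_subset_open isOpen_ball hεs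
  have h2 : ∀ᶠ z in 𝓝 z0, ∀ t ∈ sphere a ε, p z t ≠ 0 := by
    refine (isCompact_sphere a ε).eventually_forall_of_forall_eventually (x₀ := z0) (P := fun z t => p z t ≠ 0) (fun t ht => ?_)
    have hc : ContinuousAt (Function.uncurry p) (z0, t) := h.dp.continuousOn.continuousAt
      ((h.op.prod isOpen_ball).mem_nhds ⟨hz0, ball_subset_ball h.rR.le (hεs (sphere_subset_closedBall ht))⟩)
    exact hc.eventually_ne (hne t ht)
  obtain ⟨O, hO, hOo, hz0O⟩ := _root_.mem_nhds_iff.1 (inter_mem h2 (h.op.mem_nhds hz0))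
  refine ⟨O, hOo.mem_nhds hz0O, fun z hz => (hO hz).2, ε + ε', hOo, hε, by linarith, h.dp.mono (prod_mono (fun z hz => (hO hz).2) ?_), fun z hz t ht => (hO hz).1 t ht⟩
  refine fun t ht => ball_subset_ball h.rR.le (hs' ?_)
  rw [thickening_closedBall hε' hε.le]; rwa [add_comm]

lemma RD.small {p : B → ℂ → ℂ} {Ω : Set B} {c : ℂ} {r R : ℝ} (h : RD p Ω c r R) {z0 : B} (hz0 : z0 ∈ Ω) {a : ℂ} (ha : a ∈ zs p c r z0) :
    ∀ᶠ ε in 𝓝[>] (0:ℝ), closedBall a ε ⊆ ball c r ∧ ∀ b ∈ closedBall a ε, p z0 b = 0 → b = a := by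
  classical
  have h1 : ∀ᶠ b in 𝓝 a, b ∈ ball c r ∧ (p z0 b = 0 → b = a) := by
    have h2 : ∀ᶠ b in 𝓝 a, b ∉ (zs p c r z0).erase a := ((zs p c r z0).erase a).finite_toSet.isClosed.isOpen_compl.mem_nhds (by simp)
    filter_upwards [h2, isOpen_ball.mem_nhds ((h.mem_zs hz0).1 ha).1] with b hb hb'
    refine ⟨hb', fun h0 => ?_⟩
    by_contra hne
    exact hb (Finset.mem_erase.2 ⟨hne, (h.mem_zs hz0).2 ⟨hb', h0⟩⟩)
  obtain ⟨ε0, hε0, hs⟩ := Metric.nhds_basis_closedBall.mem_iff.1 h1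
  filter_upwards [Ioo_mem_nhdsGT hε0] with ε hε
  exact ⟨fun b hb => (hs (closedBall_subset_closedBall hε.2.le hb)).1, fun b hb => (hs (closedBall_subset_closedBall hε.2.le hb)).2⟩

lemma RD.pos {p : B → ℂ → ℂ} {Ω : Set B} {c : ℂ} {r R : ℝ} (h : RD p Ω c r R) {mu : B → ℂ → ℕ} {s : ℕ → B → ℂ}
    (hmu : ∀ z ∈ Ω, ∀ a ∈ zs p c r z, 0 < mu z a) (hs : ∀ z ∈ Ω, ∀ m, s m z = ∑ a ∈ zs p c r z, mu z a * a ^ m) {z : B} (hz : z ∈ Ω) :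
    s 0 z ≠ 0 ↔ (zs p c r z).Nonempty := by
  have h1 : s 0 z = ((∑ a ∈ zs p c r z, mu z a : ℕ) : ℂ) := by rw [hs z hz 0]; simp
  rw [h1, Nat.cast_ne_zero, ← Nat.pos_iff_ne_zero, Finset.sum_pos_iff]
  exact ⟨fun ⟨a, ha, _⟩ => ⟨a, ha⟩, fun ⟨a, ha⟩ => ⟨a, ha, hmu z hz a ha⟩⟩

lemma RD.persist {p : B → ℂ → ℂ} {Ω : Set B} {c : ℂ} {r R : ℝ} (h : RD p Ω c r R) {z0 : B} (hz0 : z0 ∈ Ω) {a : ℂ} (ha : a ∈ zs p c r z0)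
    {ε : ℝ} (hε : 0 < ε) : ∀ᶠ z in 𝓝 z0, ∃ b ∈ zs p c r z, dist b a < ε := by
  obtain ⟨ε', h1, hε'⟩ := ((h.small hz0 ha).and (Ioo_mem_nhdsGT hε)).exists
  have ha' := (h.mem_zs hz0).1 ha
  have hp := hε'.1
  obtain ⟨Ω', hΩ', hΩs, R', h'⟩ := h.sub hz0 ha'.1 hp h1.1 (fun t ht h0 => by
    have := h1.2 t (sphere_subset_closedBall ht) h0
    subst this; simp at ht; linarith)
  obtain ⟨mu, s, hmu, hsd, hs⟩ := h'.powsum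
  have hz0' : z0 ∈ Ω' := mem_of_mem_nhds hΩ'
  have hne : s 0 z0 ≠ 0 := (h'.pos hmu hs hz0').2 ⟨a, (h'.mem_zs hz0').2 ⟨mem_ball_self hp, ha'.2⟩⟩
  filter_upwards [((hsd 0).continuousOn.continuousAt hΩ').eventually_ne hne, hΩ'] with z hz hzΩ
  obtain ⟨b, hb⟩ := (h'.pos hmu hs hzΩ).1 hz
  have hb' := (h'.mem_zs hzΩ).1 hb
  exact ⟨b, (h.mem_zs (hΩs hzΩ)).2 ⟨h1.1 (ball_subset_closedBall hb'.1), hb'.2⟩, (mem_ball.1 hb'.1).trans hε'.2⟩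

end Roots
end

section
section Hank
lemma diffAt_prod {B : Type*} [NormedAddCommGroup B] [NormedSpace ℂ B] {ι : Type*} (T : Finset ι) {f : ι → B → ℂ} {z : B}
    (hf : ∀ i ∈ T, DifferentiableAt ℂ (f i) z) : DifferentiableAt ℂ (fun z => ∏ i ∈ T, f i z) z := by
  classical
  induction T using Finset.induction_on with
  | empty => simp
  | insert a T ha ih =>
    simp only [Finset.prod_insert ha]
    exact (hf a (by simp)).fun_mul (ih fun i hi => hf i (by simp [hi]))
lemma diffOn_prod {B : Type*} [NormedAddCommGroup B] [NormedSpace ℂ B] {ι : Type*} (T : Finset ι) {f : ι → B → ℂ} {Ω : Set B}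
    (hΩ : IsOpen Ω) (hf : ∀ i ∈ T, DifferentiableOn ℂ (f i) Ω) : DifferentiableOn ℂ (fun z => ∏ i ∈ T, f i z) Ω := fun z hz =>
  (diffAt_prod T fun i hi => (hf i hi).differentiableAt (hΩ.mem_nhds hz)).differentiableWithinAt
open Polynomial in
lemma hankel (T : Finset ℂ) (m : ℂ → ℕ) (hm : ∀ a ∈ T, 0 < m a) (e : ℕ) (hTe : T.card ≤ e) :
    (Matrix.of fun i j : Fin e => ∑ a ∈ T, (m a : ℂ) * a ^ ((i:ℕ) + j)).det ≠ 0 ↔ T.card = e := by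
  classical
  set M := (Matrix.of fun i j : Fin e => ∑ a ∈ T, (m a : ℂ) * a ^ ((i:ℕ) + j)) with hM
  have hmv : ∀ (q : ℂ[X]), q.natDegree < e → ∀ i : Fin e, (M.mulVec fun j => q.coeff j) i = ∑ a ∈ T, m a * a ^ (i:ℕ) * q.eval a := by
    intro q hq i
    simp only [Matrix.mulVec, dotProduct, hM, Matrix.of_apply, Finset.sum_mul]
    rw [Finset.sum_comm]
    refine Finset.sum_congr rfl fun a _ => ?_
    rw [Polynomial.eval_eq_sum_range' hq, Finset.sum_range, Finset.mul_sum]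
    refine Finset.sum_congr rfl fun j _ => ?_
    rw [pow_add]; ring
  constructor
  · intro hdet
    by_contra hne
    have hlt : T.card < e := lt_of_le_of_ne hTe hne
    set q : ℂ[X] := ∏ a ∈ T, (X - C a) with hq
    have hdeg : q.natDegree = T.card := by rw [hq, Polynomial.natDegree_finset_prod_X_sub_C_eq_card]
    have hmon : q.Monic := Polynomial.monic_prod_X_sub_C _ _
    apply hdet
    rw [← Matrix.exists_mulVec_eq_zero_iff]
    refine ⟨fun j => q.coeff j, ?_, ?_⟩
    · intro h0
      have := congrFun h0 ⟨T.card, hlt⟩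
      simp only [Pi.zero_apply] at this
      have h1 := hmon.coeff_natDegree
      rw [hdeg, this] at h1
      exact zero_ne_one h1
    · ext i
      rw [hmv q (by omega)]
      refine Finset.sum_eq_zero fun a ha => ?_
      have : q.eval a = 0 := by rw [hq, Polynomial.eval_prod]; exact Finset.prod_eq_zero ha (by simp)
      rw [this, mul_zero]
  · intro hcard hdet
    obtain ⟨c, hc, hMc⟩ := Matrix.exists_mulVec_eq_zero_iff.2 hdet
    set q : ℂ[X] := ∑ j : Fin e, C (c j) * X ^ (j:ℕ) with hq
    have hco : ∀ j : Fin e, q.coeff j = c j := fun j => by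
      rw [hq, Polynomial.finset_sum_coeff]
      simp only [Polynomial.coeff_C_mul, Polynomial.coeff_X_pow]
      rw [Finset.sum_eq_single j]
      · simp
      · intro b _ hb; rw [if_neg (fun h => hb (Fin.ext h.symm))]; simp
      · simp
    have hdeg : q.degree < e := by
      rw [hq]
      refine (Polynomial.degree_sum_le _ _).trans_lt ?_
      rw [Finset.sup_lt_iff (WithBot.bot_lt_coe _)]
      intro j _
      exact (Polynomial.degree_C_mul_X_pow_le _ _).trans_lt (by exact_mod_cast j.2)
    have hev : ∀ i : Fin e, ∑ a ∈ T, m a * a ^ (i:ℕ) * q.eval a = 0 := by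
      intro i
      have he : 0 < e := i.pos
      rw [← hmv q ?_ i]
      · simp only [hco]; rw [hMc]; rfl
      · by_cases h0 : q = 0
        · simpa [h0] using he
        · exact (Polynomial.natDegree_lt_iff_degree_lt h0).2 hdeg
    have hq0 : q = 0 := by
      refine Polynomial.eq_zero_of_degree_lt_of_eval_finset_eq_zero T (by rw [hcard]; exact hdeg) fun a0 ha0 => ?_
      set h : ℂ[X] := ∏ a ∈ T.erase a0, (X - C a) with hh
      have hhd : h.natDegree < e := by
        rw [hh, Polynomial.natDegree_finset_prod_X_sub_C_eq_card, Finset.card_erase_of_mem ha0]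
        have := Finset.card_pos.2 ⟨a0, ha0⟩; omega
      have h1 : ∑ a ∈ T, (m a : ℂ) * h.eval a * q.eval a = 0 := by
        calc ∑ a ∈ T, (m a : ℂ) * h.eval a * q.eval a = ∑ i : Fin e, h.coeff i * ∑ a ∈ T, m a * a ^ (i:ℕ) * q.eval a := by
              simp only [Finset.mul_sum]
              rw [Finset.sum_comm]
              refine Finset.sum_congr rfl fun a _ => ?_
              rw [Polynomial.eval_eq_sum_range' hhd, Finset.sum_range, Finset.mul_sum, Finset.sum_mul]
              refine Finset.sum_congr rfl fun j _ => by ring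
          _ = 0 := by simp [hev]
      rw [Finset.sum_eq_single_of_mem a0 ha0] at h1
      · have h2 : h.eval a0 ≠ 0 := by
          rw [hh, Polynomial.eval_prod, Finset.prod_ne_zero_iff]
          intro a ha
          simpa [sub_eq_zero] using (Finset.ne_of_mem_erase ha).symm
        have h3 : (m a0 : ℂ) ≠ 0 := Nat.cast_ne_zero.2 (hm a0 ha0).ne'
        simpa [h2, h3] using h1
      · intro b hb hne
        have : h.eval b = 0 := by rw [hh, Polynomial.eval_prod]; exact Finset.prod_eq_zero (Finset.mem_erase.2 ⟨hne, hb⟩) (by simp)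
        rw [this]; ring
    exact hc (funext fun j => by rw [← hco j, hq0]; simp)
end Hank

section EtS
variable {B : Type*} [NormedAddCommGroup B] [NormedSpace ℂ B] [FiniteDimensional ℂ B]
variable {Fb : Type*} [NormedAddCommGroup Fb] [NormedSpace ℂ Fb]

def Et (Ω : Set B) (G : B → ℂ) (S : B → Finset Fb) : Prop :=
  ∀ z0 ∈ Ω, G z0 ≠ 0 → ∃ s : Fb → B → Fb, (∀ x ∈ S z0, s x z0 = x ∧ ∀ᶠ z in 𝓝 z0, DifferentiableAt ℂ (s x) z) ∧
    ∀ᶠ z in 𝓝 z0, ∀ x', x' ∈ S z ↔ ∃ x ∈ S z0, s x z = x'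

lemma RD.et {p : B → ℂ → ℂ} {Ω : Set B} {c : ℂ} {r R : ℝ} (h : RD p Ω c r R) (hcv : Convex ℝ Ω) (hn : Ω.Nonempty) :
    ∃ δ : B → ℂ, DifferentiableOn ℂ δ Ω ∧ Dn Ω δ ∧ Et Ω δ (zs p c r) ∧ ∃ D, ∀ z ∈ Ω, (zs p c r z).card ≤ D := by
  classical
  obtain ⟨mu, s, hmu, hsd, hs⟩ := h.powsum
  have hs0 : ∀ z ∈ Ω, s 0 z = ((∑ a ∈ zs p c r z, mu z a : ℕ) : ℂ) := fun z hz => by rw [hs z hz 0]; simp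
  have hcard : ∀ z ∈ Ω, (zs p c r z).card ≤ ∑ a ∈ zs p c r z, mu z a := fun z hz => by
    rw [Finset.card_eq_sum_ones]; exact Finset.sum_le_sum fun a ha => hmu z hz a ha
  obtain ⟨zb, hzb⟩ := hn
  have hbd : ∀ z ∈ Ω, ∑ a ∈ zs p c r z, mu z a = ∑ a ∈ zs p c r zb, mu zb a := by
    intro z hz
    have hc : ContinuousOn (fun z => ∑ a ∈ zs p c r z, mu z a) Ω := by
      rw [Nat.isClosedEmbedding_coe_real.isEmbedding.continuousOn_iff]
      refine (Complex.continuous_re.comp_continuousOn (hsd 0).continuousOn).congr fun z hz => ?_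
      simp [hs0 z hz]
    exact hcv.isPreconnected.constant hc hz hzb
  have hbdd : BddAbove ((fun z => (zs p c r z).card) '' Ω) := by
    refine ⟨∑ a ∈ zs p c r zb, mu zb a, ?_⟩
    rintro _ ⟨z, hz, rfl⟩
    exact (hcard z hz).trans (hbd z hz).le
  obtain ⟨z1, hz1, he⟩ := Nat.sSup_mem (s := (fun z => (zs p c r z).card) '' Ω) ⟨_, zb, hzb, rfl⟩ hbdd
  set e := sSup ((fun z => (zs p c r z).card) '' Ω) with hedef
  have hle : ∀ z ∈ Ω, (zs p c r z).card ≤ e := fun z hz => le_csSup hbdd ⟨z, hz, rfl⟩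
  set δ : B → ℂ := fun z => (Matrix.of fun i j : Fin e => s ((i:ℕ) + j) z).det with hδ
  have hδ' : ∀ z ∈ Ω, δ z ≠ 0 ↔ (zs p c r z).card = e := fun z hz => by
    rw [← hankel _ (mu z) (hmu z hz) e (hle z hz)]
    simp only [hδ, hs z hz]
  have hδd : DifferentiableOn ℂ δ Ω := by
    simp only [hδ, Matrix.det_apply, Matrix.of_apply]
    refine DifferentiableOn.fun_sum fun σ _ => DifferentiableOn.const_smul (diffOn_prod _ h.op fun i _ => hsd _) _
  refine ⟨δ, hδd, Dn.of_ne h.op hcv hδd hz1 ((hδ' z1 hz1).2 he), ?_, e, hle⟩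
  intro z0 hz0 hδ0
  have hc0 := (hδ' z0 hz0).1 hδ0
  have hsm : ∀ᶠ ε in 𝓝[>] (0:ℝ), (∀ a ∈ zs p c r z0, (closedBall a ε ⊆ ball c r ∧ ∀ b ∈ closedBall a ε, p z0 b = 0 → b = a)) ∧
      ∀ a ∈ zs p c r z0, ∀ b ∈ zs p c r z0, a ≠ b → 2 * ε < dist a b := by
    refine ((zs p c r z0).eventually_all.2 fun a ha => h.small hz0 ha).and ((zs p c r z0).eventually_all.2 fun a ha => (zs p c r z0).eventually_all.2 fun b hb => ?_)
    by_cases hab : a = b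
    · exact Eventually.of_forall fun _ hne => absurd hab hne
    · filter_upwards [Ioo_mem_nhdsGT (show 0 < dist a b / 2 by have := dist_pos.2 hab; positivity)] with ε hε _
      linarith [hε.2]
  obtain ⟨ε, ⟨h1, h2⟩, hε⟩ := (hsm.and self_mem_nhdsWithin).exists
  replace hε : 0 < ε := hε
  have hloc : ∀ a ∈ zs p c r z0, ∃ Ω' ∈ 𝓝 z0, Ω' ⊆ Ω ∧ ∃ R', RD p Ω' a ε R' := fun a ha =>
    h.sub hz0 ((h.mem_zs hz0).1 ha).1 hε (h1 a ha).1 fun t ht h0 => by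
      have := (h1 a ha).2 t (sphere_subset_closedBall ht) h0
      subst this; simp at ht; linarith
  choose! Ω' hΩ' hΩs R' hRD using hloc
  have hps := fun a (ha : a ∈ zs p c r z0) => (hRD a ha).powsum
  choose! mu' s' hmu' hsd' hs' using hps
  have hev : ∀ᶠ z in 𝓝 z0, ∀ a ∈ zs p c r z0, z ∈ Ω' a ∧ ∃ b, zs p a ε z = {b} ∧ b ∈ zs p c r z ∧ (∀ x ∈ zs p c r z, ∃ a ∈ zs p c r z0, x ∈ zs p a ε z) := by
    have hA : ∀ᶠ z in 𝓝 z0, ∀ a ∈ zs p c r z0, z ∈ Ω' a := (zs p c r z0).eventually_all.2 fun a ha => hΩ' a ha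
    have hB : ∀ᶠ z in 𝓝 z0, ∀ a ∈ zs p c r z0, ∃ b ∈ zs p c r z, dist b a < ε := (zs p c r z0).eventually_all.2 fun a ha => h.persist hz0 ha hε
    filter_upwards [hA, hB, h.op.mem_nhds hz0] with z hzA hzB hzΩ
    choose! β hβ hβd using hzB
    have hinj : Set.InjOn β (zs p c r z0) := by
      intro a ha b hb hab
      by_contra hne
      have := h2 a ha b hb hne
      have h3 := hβd a ha; have h4 := hβd b hb
      rw [← hab] at h4
      linarith [dist_triangle_left a b (β a)]
    have himg : (zs p c r z0).image β = zs p c r z := by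
      refine Finset.eq_of_subset_of_card_le (fun x hx => ?_) ?_
      · obtain ⟨a, ha, rfl⟩ := Finset.mem_image.1 hx; exact hβ a ha
      · rw [Finset.card_image_of_injOn hinj, hc0]; exact hle z hzΩ
    have hβm : ∀ a ∈ zs p c r z0, β a ∈ zs p a ε z := fun a ha =>
      ((hRD a ha).mem_zs (hzA a ha)).2 ⟨hβd a ha, ((h.mem_zs hzΩ).1 (hβ a ha)).2⟩
    intro a ha
    refine ⟨hzA a ha, β a, ?_, hβ a ha, fun x hx => ?_⟩
    · ext x
      rw [Finset.mem_singleton]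
      refine ⟨fun hx => ?_, fun hx => hx ▸ hβm a ha⟩
      obtain ⟨hx1, hx2⟩ := ((hRD a ha).mem_zs (hzA a ha)).1 hx
      have hx3 : x ∈ zs p c r z := (h.mem_zs hzΩ).2 ⟨(h1 a ha).1 (ball_subset_closedBall hx1), hx2⟩
      rw [← himg, Finset.mem_image] at hx3
      obtain ⟨b, hb, rfl⟩ := hx3
      by_cases hab : a = b
      · rw [hab]
      · have := h2 a ha b hb hab
        have h4 := hβd b hb
        rw [mem_ball] at hx1
        linarith [dist_triangle_left a b (β b)]
    · rw [← himg, Finset.mem_image] at hx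
      obtain ⟨b, hb, rfl⟩ := hx
      exact ⟨b, hb, hβm b hb⟩
  have hval : ∀ a ∈ zs p c r z0, ∀ z ∈ Ω' a, ∀ b, zs p a ε z = {b} → s' a 0 z ≠ 0 ∧ s' a 1 z / s' a 0 z = b := by
    intro a ha z hz b hb
    have hp : s' a 0 z ≠ 0 := ((hRD a ha).pos (hmu' a ha) (hs' a ha) hz).2 (by rw [hb]; simp)
    refine ⟨hp, ?_⟩
    have e0 := hs' a ha z hz 0
    have e1 := hs' a ha z hz 1
    rw [hb] at e0 e1
    simp at e0 e1
    rw [e0] at hp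
    rw [e1, e0]; field_simp
  refine ⟨fun a z => s' a 1 z / s' a 0 z, fun a ha => ?_, ?_⟩
  · obtain ⟨hz, b, hb, _, _⟩ := hev.self_of_nhds a ha
    have hab : b = a := by
      have : a ∈ zs p a ε z0 := ((hRD a ha).mem_zs hz).2 ⟨mem_ball_self hε, ((h.mem_zs hz0).1 ha).2⟩
      rw [hb, Finset.mem_singleton] at this; exact this.symm
    refine ⟨((hval a ha z0 hz b hb).2).trans hab, ?_⟩
    filter_upwards [hev, eventually_mem_nhds_iff.2 (hΩ' a ha)] with z hz hzn
    obtain ⟨hz', b, hb, _, _⟩ := hz a ha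
    simp only [div_eq_mul_inv]
    exact ((hsd' a ha 1).differentiableAt hzn).fun_mul (((hsd' a ha 0).differentiableAt hzn).fun_inv (hval a ha z hz' b hb).1)
  · filter_upwards [hev, h.op.mem_nhds hz0] with z hz hzΩ x
    constructor
    · intro hx
      by_cases hne : (zs p c r z0).Nonempty
      · obtain ⟨a0, ha0⟩ := hne
        obtain ⟨_, _, _, _, hcov⟩ := hz a0 ha0
        obtain ⟨a, ha, hxa⟩ := hcov x hx
        obtain ⟨hz', b, hb, _, _⟩ := hz a ha
        refine ⟨a, ha, ?_⟩
        refine (hval a ha z hz' b hb).2.trans ?_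
        rw [hb, Finset.mem_singleton] at hxa; exact hxa.symm
      · rw [Finset.not_nonempty_iff_eq_empty] at hne
        rw [hne, Finset.card_empty] at hc0
        have := hle z hzΩ
        rw [← hc0, Nat.le_zero, Finset.card_eq_zero] at this
        rw [this] at hx; simp at hx
    · rintro ⟨a, ha, rfl⟩
      obtain ⟨hz', b, hb, hbm, _⟩ := hz a ha
      exact (hval a ha z hz' b hb).2.symm ▸ hbm

end EtS
end

section
section EtOps
variable {B : Type*} [NormedAddCommGroup B] [NormedSpace ℂ B] [FiniteDimensional ℂ B]
variable {Fb : Type*} [NormedAddCommGroup Fb] [NormedSpace ℂ Fb]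

lemma Et.mono {Ω Ω' : Set B} {G G' : B → ℂ} {S : B → Finset Fb} (h : Et Ω G S) (h1 : Ω' ⊆ Ω) (h2 : ∀ z ∈ Ω', G' z ≠ 0 → G z ≠ 0) :
    Et Ω' G' S := fun z0 hz0 hG => h z0 (h1 hz0) (h2 z0 hz0 hG)

lemma Et.pi {l : ℕ} {Ω : Set B} {δ : Fin l → B → ℂ} {S : Fin l → B → Finset ℂ} (h : ∀ j, Et Ω (δ j) (S j)) :
    Et Ω (fun z => ∏ j, δ j z) (fun z => Fintype.piFinset fun j => S j z) := by
  intro z0 hz0 hG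
  rw [Finset.prod_ne_zero_iff] at hG
  have := fun j => h j z0 hz0 (hG j (Finset.mem_univ j))
  choose s hs1 hs2 using this
  refine ⟨fun x z j => s j (x j) z, fun x hx => ?_, ?_⟩
  · rw [Fintype.mem_piFinset] at hx
    refine ⟨funext fun j => (hs1 j _ (hx j)).1, ?_⟩
    filter_upwards [eventually_all.2 fun j => (hs1 j _ (hx j)).2] with z hz
    exact differentiableAt_pi.2 hz
  · filter_upwards [eventually_all.2 hs2] with z hz x
    rw [Fintype.mem_piFinset]
    constructor
    · intro hx
      have := fun j => (hz j (x j)).1 (hx j)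
      choose a ha hax using this
      exact ⟨a, Fintype.mem_piFinset.2 ha, funext hax⟩
    · rintro ⟨a, ha, rfl⟩ j
      exact (hz j _).2 ⟨a j, Fintype.mem_piFinset.1 ha j, rfl⟩

lemma Et.sec {Ω : Set B} {G : B → ℂ} {S : B → Finset Fb} (h : Et Ω G S) {z0 : B} (hz0 : z0 ∈ Ω) (hG : G z0 ≠ 0) :
    ∃ s : Fb → B → Fb, (∀ x ∈ S z0, s x z0 = x ∧ (∀ᶠ z in 𝓝 z0, DifferentiableAt ℂ (s x) z) ∧ (∀ᶠ z in 𝓝 z0, s x z ∈ S z) ∧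
      ∀ᶠ p : B × Fb in 𝓝 (z0, x), p.2 ∈ S p.1 → p.2 = s x p.1) ∧
    (∀ᶠ z in 𝓝 z0, Set.InjOn (fun x => s x z) (S z0)) ∧ ∀ᶠ z in 𝓝 z0, ∀ x', x' ∈ S z ↔ ∃ x ∈ S z0, s x z = x' := by
  classical
  obtain ⟨s, hs1, hs2⟩ := h z0 hz0 hG
  have hcont : ∀ x ∈ S z0, ContinuousAt (s x) z0 := fun x hx => (hs1 x hx).2.self_of_nhds.continuousAt
  refine ⟨s, fun x hx => ⟨(hs1 x hx).1, (hs1 x hx).2, ?_, ?_⟩, ?_, hs2⟩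
  · filter_upwards [hs2] with z hz
    exact (hz _).2 ⟨x, hx, rfl⟩
  · have h1 : ∀ᶠ p : B × Fb in 𝓝 (z0, x), ∀ x' ∈ S z0, x' ≠ x → s x' p.1 ≠ p.2 := by
      refine (S z0).eventually_all.2 fun x' hx' => ?_
      by_cases hne : x' = x
      · exact Eventually.of_forall fun _ h => absurd hne h
      · have hc : ContinuousAt (fun p : B × Fb => s x' p.1 - p.2) (z0, x) :=
          (ContinuousAt.comp (f := Prod.fst) (x := (z0, x)) (hcont x' hx') continuousAt_fst).sub continuousAt_snd
        filter_upwards [hc.eventually_ne (show s x' z0 - x ≠ 0 by rw [(hs1 x' hx').1]; exact sub_ne_zero.2 hne)] with p hp _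
        exact sub_ne_zero.1 hp
    filter_upwards [h1, (continuousAt_fst (p := (z0, x))).eventually hs2] with p hp1 hp2 hp3
    obtain ⟨x', hx', h2⟩ := (hp2 _).1 hp3
    by_cases hne : x' = x
    · rw [← h2, hne]
    · exact absurd h2 (hp1 x' hx' hne)
  · have h1 : ∀ᶠ z in 𝓝 z0, ∀ x ∈ S z0, ∀ x' ∈ S z0, x ≠ x' → s x z ≠ s x' z := by
      refine (S z0).eventually_all.2 fun x hx => (S z0).eventually_all.2 fun x' hx' => ?_
      by_cases hne : x = x'
      · exact Eventually.of_forall fun _ h => absurd hne h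
      · have hc : ContinuousAt (fun z => s x z - s x' z) z0 := (hcont x hx).sub (hcont x' hx')
        filter_upwards [hc.eventually_ne (show s x z0 - s x' z0 ≠ 0 by rw [(hs1 x hx).1, (hs1 x' hx').1]; exact sub_ne_zero.2 hne)] with p hp _
        exact sub_ne_zero.1 hp
    filter_upwards [h1] with z hz x hx x' hx' heq
    by_contra hne
    exact hz x hx x' hx' hne heq

def LC (Ω : Set B) (G : B → ℂ) (S : B → Finset Fb) (Q : B → Fb → Prop) : Prop :=
  ∀ z0 ∈ Ω, G z0 ≠ 0 → ∀ x ∈ S z0, ∀ᶠ p : B × Fb in 𝓝 (z0, x), p.2 ∈ S p.1 → (Q p.1 p.2 ↔ Q z0 x)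

open Classical in
lemma Et.filter {Ω : Set B} {G : B → ℂ} {S : B → Finset Fb} {Q : B → Fb → Prop} (h : Et Ω G S) (hQ : LC Ω G S Q) :
    Et Ω G (fun z => (S z).filter (Q z)) := by
  intro z0 hz0 hG
  obtain ⟨s, hs1, hs2⟩ := h z0 hz0 hG
  refine ⟨s, fun x hx => hs1 x (Finset.mem_filter.1 hx).1, ?_⟩
  have h1 : ∀ᶠ z in 𝓝 z0, ∀ x ∈ S z0, s x z ∈ S z → (Q z (s x z) ↔ Q z0 x) := by
    refine (S z0).eventually_all.2 fun x hx => ?_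
    have hc : ContinuousAt (fun z => (z, s x z)) z0 := continuousAt_id.prodMk (hs1 x hx).2.self_of_nhds.continuousAt
    have h2 := hQ z0 hz0 hG x hx
    rw [← (hs1 x hx).1] at h2
    simpa [(hs1 x hx).1] using hc.eventually h2
  filter_upwards [hs2, h1] with z hz hz1 x
  simp only [Finset.mem_filter]
  constructor
  · rintro ⟨h3, h4⟩
    obtain ⟨a, ha, rfl⟩ := (hz x).1 h3
    exact ⟨a, ⟨ha, (hz1 a ha h3).1 h4⟩, rfl⟩
  · rintro ⟨a, ⟨ha, hQa⟩, rfl⟩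
    have h3 := (hz (s a z)).2 ⟨a, ha, rfl⟩
    exact ⟨h3, (hz1 a ha h3).2 hQa⟩

variable {E' : Type*} [NormedAddCommGroup E'] [NormedSpace ℂ E'] [FiniteDimensional ℂ E']

lemma norm_prod_le' {ι : Type*} {T : Finset ι} {f : ι → ℂ} {C : ℝ} {D : ℕ} (hC : 1 ≤ C) (hD : T.card ≤ D) (hf : ∀ x ∈ T, ‖f x‖ ≤ C) :
    ‖∏ x ∈ T, f x‖ ≤ C ^ D := by
  rw [norm_prod]
  calc ∏ x ∈ T, ‖f x‖ ≤ ∏ x ∈ T, C := Finset.prod_le_prod (fun _ _ => norm_nonneg _) hf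
    _ = C ^ T.card := by simp
    _ ≤ C ^ D := pow_le_pow_right₀ hC hD

lemma norm_prod_le_one {ι : Type*} {T : Finset ι} {f : ι → ℂ} {C : ℝ} {D : ℕ} (hC : 1 ≤ C) (hD : T.card ≤ D) (hf : ∀ x ∈ T, ‖f x‖ ≤ C)
    {x0 : ι} (hx0 : x0 ∈ T) : ‖∏ x ∈ T, f x‖ ≤ ‖f x0‖ * C ^ D := by
  classical
  rw [← Finset.mul_prod_erase T f hx0, norm_mul]
  exact mul_le_mul_of_nonneg_left (norm_prod_le' hC ((Finset.card_erase_le).trans hD) fun x hx => hf x (Finset.mem_of_mem_erase hx)) (norm_nonneg _)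

lemma le_norm_prod {ι : Type*} {T : Finset ι} {f : ι → ℂ} {c : ℝ} {D : ℕ} (hc0 : 0 ≤ c) (hc : c ≤ 1) (hD : T.card ≤ D) (hf : ∀ x ∈ T, c ≤ ‖f x‖) :
    c ^ D ≤ ‖∏ x ∈ T, f x‖ := by
  rw [norm_prod]
  calc c ^ D ≤ c ^ T.card := pow_le_pow_of_le_one hc0 hc hD
    _ = ∏ x ∈ T, c := by simp
    _ ≤ _ := Finset.prod_le_prod (fun _ _ => hc0) hf

lemma NORM {Ω : Set B} {G : B → ℂ} {S : B → Finset Fb} (h : Et Ω G S) {D : ℕ} (hD : ∀ z ∈ Ω, (S z).card ≤ D)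
    {Q : Set E'} (hQ : IsOpen Q) {q : E' → B} (hq : DifferentiableOn ℂ q Q) (hqm : ∀ y ∈ Q, q y ∈ Ω)
    (hGq : DifferentiableOn ℂ (fun y => G (q y)) Q) (hDn : Dn Q (fun y => G (q y)))
    {H : E' → Fb → ℂ} (hH : ∀ y ∈ Q, G (q y) ≠ 0 → ∀ x ∈ S (q y), DifferentiableAt ℂ (Function.uncurry H) (y, x))
    (hb : ∀ y ∈ Q, ∃ C : ℝ, ∀ᶠ y' in 𝓝 y, ∀ x ∈ S (q y'), ‖H y' x‖ ≤ C) :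
    ∃ N : E' → ℂ, DifferentiableOn ℂ N Q ∧ ∀ y ∈ Q, G (q y) ≠ 0 → N y = ∏ x ∈ S (q y), H y x := by
  classical
  refine riem hQ hGq hDn (fun y0 hy0 hG => ?_) (fun y hy => ?_)
  · obtain ⟨s, hs1, hs2, hs3⟩ := h.sec (hqm y0 hy0) hG
    have hqd := hq.differentiableAt (hQ.mem_nhds hy0)
    have : DifferentiableAt ℂ (fun y => ∏ x ∈ S (q y0), H y (s x (q y))) y0 := by
      refine diffAt_prod _ fun x hx => ?_
      have h1 : DifferentiableAt ℂ (fun y => (y, s x (q y))) y0 :=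
        differentiableAt_id.prodMk ((hs1 x hx).2.1.self_of_nhds.comp y0 hqd)
      refine DifferentiableAt.comp (g := Function.uncurry H) (f := fun y => (y, s x (q y))) y0 ?_ h1
      rw [(hs1 x hx).1]
      exact hH y0 hy0 hG x hx
    refine this.congr_of_eventuallyEq ?_
    filter_upwards [hqd.continuousAt.eventually hs2, hqd.continuousAt.eventually hs3] with y h1 h2
    have : S (q y) = (S (q y0)).image (fun x => s x (q y)) := by
      ext x; rw [h2 x, Finset.mem_image]
    rw [this, Finset.prod_image h1]
  · obtain ⟨C, hC⟩ := hb y hy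
    refine ⟨(max 1 C) ^ D, ?_⟩
    filter_upwards [hC, hQ.mem_nhds hy] with y' hy' hyQ _
    exact norm_prod_le' (le_max_left _ _) (hD _ (hqm y' hyQ)) fun x hx => (hy' x hx).trans (le_max_right _ _)

open Classical in
lemma clopenN {Ω : Set B} {G : B → ℂ} {S : B → Finset Fb} (h : Et Ω G S) {D : ℕ} (hD : ∀ z ∈ Ω, (S z).card ≤ D)
    (hΩ : IsOpen Ω) (hG : DifferentiableOn ℂ G Ω) (hDn : Dn Ω G)
    {F : B → Fb → ℂ} (hF : ∀ z ∈ Ω, ∀ x ∈ S z, DifferentiableAt ℂ (Function.uncurry F) (z, x))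
    (hb : ∀ z ∈ Ω, ∃ C : ℝ, ∀ᶠ z' in 𝓝 z, ∀ x ∈ S z', ‖F z' x‖ ≤ C) :
    ∃ N : B → ℂ, DifferentiableOn ℂ N Ω ∧ Dn Ω N ∧ LC Ω (fun z => G z * N z) S (fun z x => F z x = 0) := by
  set Q : B → Fb → Prop := fun z x => ∀ᶠ p : B × Fb in 𝓝 (z, x), p.2 ∈ S p.1 → F p.1 p.2 = 0 with hQdef
  have hball : ∀ z0 ∈ Ω, G z0 ≠ 0 → ∃ s : Fb → B → Fb, ∃ ρ > 0, ball z0 ρ ⊆ Ω ∧ (∀ z ∈ ball z0 ρ, G z ≠ 0) ∧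
      (∀ x ∈ S z0, s x z0 = x ∧ (∀ z ∈ ball z0 ρ, s x z ∈ S z ∧ ContinuousAt (s x) z) ∧ DifferentiableOn ℂ (fun z => F z (s x z)) (ball z0 ρ) ∧
        (∀ᶠ p : B × Fb in 𝓝 (z0, x), p.2 ∈ S p.1 → p.2 = s x p.1)) ∧
      (∀ z ∈ ball z0 ρ, Set.InjOn (fun x => s x z) (S z0)) ∧ ∀ z ∈ ball z0 ρ, ∀ x', x' ∈ S z ↔ ∃ x ∈ S z0, s x z = x' := by
    intro z0 hz0 hG0
    obtain ⟨s, hs1, hs2, hs3⟩ := h.sec hz0 hG0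
    have h1 : ∀ᶠ z in 𝓝 z0, ∀ x ∈ S z0, s x z ∈ S z ∧ DifferentiableAt ℂ (s x) z := by
      refine (S z0).eventually_all.2 fun x hx => (hs1 x hx).2.2.1.and (hs1 x hx).2.1
    have h2 := (hG.continuousOn.continuousAt (hΩ.mem_nhds hz0)).eventually_ne hG0
    obtain ⟨ρ, hρ, hs⟩ := Metric.nhds_basis_ball.mem_iff.1 (h1.and (h2.and (hs2.and (hs3.and (hΩ.eventually_mem hz0)))))
    refine ⟨s, ρ, hρ, fun z hz => (hs hz).2.2.2.2, fun z hz => (hs hz).2.1, fun x hx => ⟨(hs1 x hx).1, fun z hz => ⟨((hs hz).1 x hx).1, ((hs hz).1 x hx).2.continuousAt⟩, fun z hz => ?_, (hs1 x hx).2.2.2⟩, fun z hz => (hs hz).2.2.1, fun z hz => (hs hz).2.2.2.1⟩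
    have h3 := (hs hz).1 x hx
    exact (DifferentiableAt.comp (g := Function.uncurry F) (f := fun z => (z, s x z)) z (hF z (hs hz).2.2.2.2 _ h3.1) (differentiableAt_id.prodMk h3.2)).differentiableWithinAt
  have hQLC : LC Ω G S Q := by
    intro z0 hz0 hG0 x hx
    by_cases hQ0 : Q z0 x
    · have := eventually_eventually_nhds.2 hQ0
      filter_upwards [this] with p hp _
      exact ⟨fun _ => hQ0, fun _ => hp⟩
    · obtain ⟨s, ρ, hρ, hsub, hG1, hs1, hs2, hs3⟩ := hball z0 hz0 hG0
      obtain ⟨hsx, hsS, hsF, hsg⟩ := hs1 x hx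
      filter_upwards [hsg, (continuousAt_fst (p := (z0, x))).eventually (ball_mem_nhds z0 hρ)] with p hp1 hp2 hp3
      refine ⟨fun hQp => absurd ?_ hQ0, fun h => absurd h hQ0⟩
      have hpe := hp1 hp3
      have hz : ∀ᶠ z in 𝓝 p.1, F z (s x z) = 0 := by
        have hc : ContinuousAt (fun z => (z, s x z)) p.1 := continuousAt_id.prodMk (hsS p.1 hp2).2
        have hQp' : ∀ᶠ p' : B × Fb in 𝓝 (p.1, s x p.1), p'.2 ∈ S p'.1 → F p'.1 p'.2 = 0 := by rw [← hpe]; exact hQp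
        filter_upwards [hc.eventually hQp', isOpen_ball.mem_nhds hp2] with z hz hz2
        exact hz (hsS z hz2).1
      have hall := ident_conv isOpen_ball (convex_ball _ _) hsF hp2 hz
      show ∀ᶠ p : B × Fb in 𝓝 (z0, x), p.2 ∈ S p.1 → F p.1 p.2 = 0
      filter_upwards [hsg, (continuousAt_fst (p := (z0, x))).eventually (ball_mem_nhds z0 hρ)] with p' h1 h2 h3
      rw [h1 h3]; exact hall _ h2
  obtain ⟨Q', hQ'⟩ : ∃ Q' : B → Fb → Prop, ∀ z x, Q' z x ↔ ¬ Q z x := ⟨_, fun _ _ => Iff.rfl⟩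
  have hQLC' : LC Ω G S Q' := fun z0 hz0 hG0 x hx => by
    filter_upwards [hQLC z0 hz0 hG0 x hx] with p hp h1
    rw [hQ', hQ', hp h1]
  have hT := h.filter hQLC'
  obtain ⟨N, hN, hNe⟩ := NORM hT (D := D) (fun z hz => (Finset.card_filter_le _ _).trans (hD z hz)) hΩ (q := id) differentiableOn_id (fun y hy => hy) hG hDn
    (H := F) (fun y hy _ x hx => hF y hy x (Finset.mem_filter.1 hx).1) (fun y hy => by
      obtain ⟨C, hC⟩ := hb y hy
      exact ⟨C, hC.mono fun y' hy' x hx => hy' x (Finset.mem_filter.1 hx).1⟩)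
  simp only [id] at hNe
  refine ⟨N, hN, ?_, ?_⟩
  · intro z1 hz1
    rw [Filter.frequently_iff]
    intro U hU
    obtain ⟨z0, hG0, hz0, hzU⟩ := ((hDn z1 hz1).and_eventually ((hΩ.eventually_mem hz1).and (eventually_mem_nhds_iff.2 hU))).exists
    obtain ⟨s, ρ, hρ, hsub, hG1, hs1, hs2, hs3⟩ := hball z0 hz0 hG0
    have hdn : Dn (ball z0 ρ) (fun z => ∏ x ∈ (S z0).filter (Q' z0), F z (s x z)) := by
      refine Dn.prod _ isOpen_ball (fun x hx => ?_) (fun x hx => (hs1 x (Finset.mem_filter.1 hx).1).2.2.1.continuousOn)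
      obtain ⟨hxS, hxQ⟩ := Finset.mem_filter.1 hx
      obtain ⟨hsx, hsS, hsF, hsg⟩ := hs1 x hxS
      obtain ⟨p, hp, h1, h2⟩ := (Filter.not_eventually.1 ((hQ' _ _).1 hxQ)).and_eventually (hsg.and ((continuousAt_fst (p := (z0, x))).eventually (ball_mem_nhds z0 hρ))) |>.exists
      push Not at hp
      exact Dn.of_ne isOpen_ball (convex_ball _ _) hsF h2 (by rw [← h1 hp.1]; exact hp.2)
    have hev : ∀ᶠ z in 𝓝 z0, ∀ x ∈ S z0, (Q z (s x z) ↔ Q z0 x) := by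
      refine (S z0).eventually_all.2 fun x hx => ?_
      obtain ⟨hsx, hsS, hsF, hsg⟩ := hs1 x hx
      have hc : ContinuousAt (fun z => (z, s x z)) z0 := continuousAt_id.prodMk (hsS z0 (mem_ball_self hρ)).2
      have h2 := hQLC z0 hz0 hG0 x hx
      have h3 : Tendsto (fun z => (z, s x z)) (𝓝 z0) (𝓝 (z0, x)) := by simpa [ContinuousAt, hsx] using hc
      filter_upwards [h3.eventually h2, ball_mem_nhds z0 hρ] with z h4 h5
      exact h4 (hsS z h5).1
    obtain ⟨z, hz, hzρ, hzU'⟩ := ((hdn z0 (mem_ball_self hρ)).and_eventually ((isOpen_ball.eventually_mem (mem_ball_self hρ)).and ((eventually_mem_nhds_iff.2 hzU).and hev))).exists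
    · refine ⟨z, mem_of_mem_nhds hzU'.1, ?_⟩
      rw [hNe z (hsub hzρ) (hG1 z hzρ)]
      have : (S z).filter (Q' z) = ((S z0).filter (Q' z0)).image (fun x => s x z) := by
        ext x'
        simp only [Finset.mem_filter, Finset.mem_image]
        constructor
        · rintro ⟨h1, h2⟩
          obtain ⟨x, hx, rfl⟩ := (hs3 z hzρ x').1 h1
          exact ⟨x, ⟨hx, (hQ' _ _).2 fun h3 => (hQ' _ _).1 h2 ((hzU'.2 x hx).2 h3)⟩, rfl⟩
        · rintro ⟨x, ⟨hx, hxQ⟩, rfl⟩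
          exact ⟨(hs3 z hzρ _).2 ⟨x, hx, rfl⟩, (hQ' _ _).2 fun h3 => (hQ' _ _).1 hxQ ((hzU'.2 x hx).1 h3)⟩
      rw [this, Finset.prod_image fun x hx x' hx' => hs2 z hzρ (Finset.mem_filter.1 hx).1 (Finset.mem_filter.1 hx').1]
      exact hz
  · intro z0 hz0 hGN x hx
    have hG0 := left_ne_zero_of_mul hGN
    have hN0 := right_ne_zero_of_mul hGN
    rw [hNe z0 hz0 hG0, Finset.prod_ne_zero_iff] at hN0
    by_cases hQ0 : Q z0 x
    · have hx0 : F z0 x = 0 := (show ∀ᶠ p : B × Fb in 𝓝 (z0, x), p.2 ∈ S p.1 → F p.1 p.2 = 0 from hQ0).self_of_nhds hx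
      filter_upwards [(show ∀ᶠ p : B × Fb in 𝓝 (z0, x), p.2 ∈ S p.1 → F p.1 p.2 = 0 from hQ0)] with p hp hp2
      simp only [hx0, hp hp2]
    · have hx0 := hN0 x (Finset.mem_filter.2 ⟨hx, (hQ' _ _).2 hQ0⟩)
      filter_upwards [(hF z0 hz0 x hx).continuousAt.eventually_ne hx0] with p hp hp2
      exact ⟨fun h => absurd h hp, fun h => absurd h hx0⟩

end EtOps
end

section
section Good
variable {B : Type*} [NormedAddCommGroup B] [NormedSpace ℂ B] [FiniteDimensional ℂ B]

def GoodP (p : B → ℂ → ℂ) : Prop :=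
  (∀ᶠ w in 𝓝 (0 : B × ℂ), DifferentiableAt ℂ (Function.uncurry p) w) ∧ ∃ᶠ t in 𝓝 (0:ℂ), p 0 t ≠ 0

lemma GoodP.rd {p : B → ℂ → ℂ} (h : GoodP p) :
    ∀ᶠ r in 𝓝[>] (0:ℝ), (∀ t : ℂ, ‖t‖ ≤ r → p 0 t = 0 → t = 0) ∧ ∀ᶠ ε in 𝓝[>] (0:ℝ), RD p (ball 0 ε) 0 r (2 * r) := by
  obtain ⟨d, hd, hdp⟩ := Metric.eventually_nhds_iff_ball.1 h.1
  have hdo : DifferentiableOn ℂ (Function.uncurry p) (ball 0 d ×ˢ ball 0 d) := fun w hw =>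
    (hdp w (by rw [← ball_prod_same] at *; exact hw)).differentiableWithinAt
  have ha : AnalyticAt ℂ (p 0) 0 := by
    have : DifferentiableOn ℂ (p 0) (ball 0 d) :=
      hdo.comp (f := fun t => ((0:B), t)) (by fun_prop) fun t ht => ⟨mem_ball_self hd, ht⟩
    exact this.analyticAt (ball_mem_nhds 0 hd)
  have hne : ∀ᶠ t in 𝓝 (0:ℂ), p 0 t = 0 → t = 0 := by
    rcases ha.eventually_eq_zero_or_eventually_ne_zero with h1 | h1
    · exact absurd h1 fun h2 => h.2 (h2.mono fun t ht => not_not.2 ht)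
    · rw [eventually_nhdsWithin_iff] at h1
      filter_upwards [h1] with t ht h0
      by_contra hc
      exact ht hc h0
  obtain ⟨e, he, hep⟩ := Metric.eventually_nhds_iff_ball.1 hne
  filter_upwards [Ioo_mem_nhdsGT he, Ioo_mem_nhdsGT (half_pos hd)] with r hr1 hr2
  have h0 : ∀ t : ℂ, ‖t‖ ≤ r → p 0 t = 0 → t = 0 := fun t ht => hep t (by simpa using ht.trans_lt hr1.2)
  refine ⟨h0, ?_⟩
  have h2 : ∀ᶠ z in 𝓝 (0:B), ∀ t ∈ sphere (0:ℂ) r, p z t ≠ 0 := by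
    refine (isCompact_sphere 0 r).eventually_forall_of_forall_eventually (x₀ := (0:B)) (P := fun z t => p z t ≠ 0) (fun t ht => ?_)
    have ht' : ‖t‖ = r := by simpa using ht
    have hc : ContinuousAt (Function.uncurry p) (0, t) := hdo.continuousOn.continuousAt
      ((isOpen_ball.prod isOpen_ball).mem_nhds ⟨mem_ball_self hd, by simp; linarith [hr2.2, hr2.1]⟩)
    refine hc.eventually_ne (show p 0 t ≠ 0 from fun h3 => ?_)
    have := h0 t ht'.le h3
    rw [this, norm_zero] at ht'
    exact hr1.1.ne ht'
  obtain ⟨f, hf, hfp⟩ := Metric.eventually_nhds_iff_ball.1 h2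
  filter_upwards [Ioo_mem_nhdsGT hf, Ioo_mem_nhdsGT hd] with ε h3 h4
  exact ⟨isOpen_ball, hr1.1, by linarith [hr1.1], hdo.mono (prod_mono (ball_subset_ball h4.2.le) (ball_subset_ball (by linarith [hr2.2]))),
    fun z hz => hfp z (ball_subset_ball h3.2.le hz)⟩

lemma RD.tozero {p : B → ℂ → ℂ} {Ω : Set B} {r R : ℝ} (h : RD p Ω 0 r R) (h0 : 0 ∈ Ω) (hp : ∀ t : ℂ, ‖t‖ ≤ r → p 0 t = 0 → t = 0)
    {η : ℝ} (hη : 0 < η) : ∀ᶠ z in 𝓝 0, ∀ a ∈ zs p 0 r z, ‖a‖ < η := by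
  have hK : IsCompact (closedBall (0:ℂ) r \ ball 0 η) := (isCompact_closedBall 0 r).diff isOpen_ball
  have h2 : ∀ᶠ z in 𝓝 (0:B), ∀ t ∈ closedBall (0:ℂ) r \ ball 0 η, p z t ≠ 0 := by
    refine hK.eventually_forall_of_forall_eventually (x₀ := (0:B)) (P := fun z t => p z t ≠ 0) (fun t ht => ?_)
    have ht' : ‖t‖ ≤ r := by simpa using ht.1
    have hc : ContinuousAt (Function.uncurry p) (0, t) := h.dp.continuousOn.continuousAt
      ((h.op.prod isOpen_ball).mem_nhds ⟨h0, by simp; linarith [h.rR]⟩)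
    refine hc.eventually_ne (show p 0 t ≠ 0 from fun h3 => ht.2 ?_)
    rw [hp t ht' h3]; exact mem_ball_self hη
  filter_upwards [h2, h.op.mem_nhds h0] with z hz hzΩ a ha
  obtain ⟨h3, h4⟩ := (h.mem_zs hzΩ).1 ha
  by_contra hc
  exact hz a ⟨ball_subset_closedBall h3, by simpa using hc⟩ h4

lemma Dn.fst {Ω : Set B} {G : B → ℂ} (h : Dn Ω G) {E' : Type*} [NormedAddCommGroup E'] [NormedSpace ℂ E'] (T : Set E') :
    Dn (Ω ×ˢ T) (fun y => G y.1) := by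
  rintro ⟨z, t⟩ ⟨hz, -⟩
  have h1 : Tendsto (fun z' => (z', t)) (𝓝 z) (𝓝 (z, t)) := by
    have : Continuous fun z' : B => (z', t) := by fun_prop
    exact this.tendsto z
  exact h1.frequently (h z hz)

lemma ELIM {g : B → ℂ → ℂ} {p : B × ℂ → ℂ → ℂ} (hg : GoodP g) (hp : GoodP p) :
    ∃ N : B → ℂ → ℂ, GoodP N ∧ ∀ᶠ w in 𝓝 (0 : (B × ℂ) × ℂ), g w.1.1 w.1.2 = 0 → p w.1 w.2 = 0 → N w.1.1 w.2 = 0 := by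
  have hpc : ContinuousAt (Function.uncurry p) 0 := hp.1.self_of_nhds.continuousAt
  have hpb : ∀ᶠ w in 𝓝 (0 : (B × ℂ) × ℂ), ‖Function.uncurry p w‖ < ‖Function.uncurry p 0‖ + 1 :=
    hpc.norm.eventually_lt continuousAt_const (by linarith)
  set C := ‖Function.uncurry p 0‖ + 1 with hC
  have hC1 : 1 ≤ C := by rw [hC]; linarith [norm_nonneg (Function.uncurry p 0)]
  obtain ⟨d, hd, hdp⟩ := Metric.eventually_nhds_iff_ball.1 (hp.1.and hpb)
  have hdp : ∀ z : B, ∀ ζ t : ℂ, ‖z‖ < d → ‖ζ‖ < d → ‖t‖ < d → DifferentiableAt ℂ (Function.uncurry p) ((z, ζ), t) ∧ ‖p (z, ζ) t‖ < C :=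
    fun z ζ t h1 h2 h3 => hdp ((z, ζ), t) (by simp [Prod.norm_def, h1, h2, h3])
  obtain ⟨r, ⟨hr0, hrd⟩, hrd'⟩ := (hg.rd.and (Ioo_mem_nhdsGT hd)).exists
  obtain ⟨ε, hRD, hε⟩ := (hrd.and (Ioo_mem_nhdsGT hd)).exists
  have hεp := hε.1
  obtain ⟨δ, hδ, hδD, hEt, D, hD⟩ := hRD.et (convex_ball _ _) ⟨0, mem_ball_self hεp⟩
  have hzd : ∀ z ∈ ball (0:B) ε, ∀ ζ ∈ zs g 0 r z, ‖z‖ < d ∧ ‖ζ‖ < d := fun z hz ζ hζ => by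
    have := ((hRD.mem_zs hz).1 hζ).1
    simp at this hz
    exact ⟨hz.trans hε.2, this.trans hrd'.2⟩
  have hQ : IsOpen ((ball (0:B) ε) ×ˢ (ball (0:ℂ) d)) := isOpen_ball.prod isOpen_ball
  obtain ⟨N, hN, hNe⟩ := NORM hEt hD hQ (q := Prod.fst) differentiableOn_fst (fun y hy => hy.1)
    (hδ.comp differentiableOn_fst fun y hy => hy.1) (hδD.fst _) (H := fun y ζ => p (y.1, ζ) y.2)
    (fun y hy _ ζ hζ => by
      have h1 := hzd y.1 hy.1 ζ hζ
      have h2 := (hdp y.1 ζ y.2 h1.1 h1.2 (by simpa using hy.2)).1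
      exact DifferentiableAt.comp (g := Function.uncurry p) (f := fun a : (B × ℂ) × ℂ => ((a.1.1, a.2), a.1.2)) (y, ζ) h2 (by fun_prop))
    (fun y hy => ⟨C, by
      filter_upwards [hQ.mem_nhds hy] with y' hy' ζ hζ
      have h1 := hzd y'.1 hy'.1 ζ hζ
      exact (hdp y'.1 ζ y'.2 h1.1 h1.2 (by simpa using hy'.2)).2.le⟩)
  have h00 : (0 : B) ∈ ball (0:B) ε := mem_ball_self hεp
  refine ⟨fun z t => N (z, t), ⟨?_, ?_⟩, ?_⟩
  · filter_upwards [hQ.mem_nhds (show (0 : B × ℂ) ∈ _ from ⟨h00, mem_ball_self hd⟩)] with w hw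
    exact hN.differentiableAt (hQ.mem_nhds hw)
  · refine (hp.2.and_eventually (ball_mem_nhds (0:ℂ) hd)).mono ?_
    rintro t ⟨ht, htd⟩ hN0
    have htd' : ‖t‖ < d := by simpa using htd
    dsimp only at hN0
    have hc1 : ContinuousAt (fun y : B × ℂ => p y t) 0 :=
      ContinuousAt.comp (g := Function.uncurry p) (f := fun y : B × ℂ => (y, t)) (hdp 0 0 t (by simpa) (by simpa) htd').1.continuousAt (by fun_prop)
    have hc2 : ∀ᶠ y in 𝓝 (0 : B × ℂ), ‖p 0 t‖ / 2 < ‖p y t‖ := continuousAt_const.eventually_lt hc1.norm (half_lt_self (norm_pos_iff.2 ht))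
    obtain ⟨e, he, hep⟩ := Metric.eventually_nhds_iff_ball.1 hc2
    set c := min 1 (‖p 0 t‖ / 2) with hcdef
    have hcp : 0 < c := lt_min one_pos (half_pos (norm_pos_iff.2 ht))
    have hlow : ∀ᶠ z in 𝓝 (0:B), δ z ≠ 0 → c ^ D ≤ ‖N (z, t)‖ := by
      filter_upwards [hRD.tozero h00 hr0 he, ball_mem_nhds (0:B) he, ball_mem_nhds (0:B) hεp] with z h1 h2 h3 h4
      rw [hNe (z, t) ⟨h3, htd⟩ h4]
      refine le_norm_prod hcp.le (min_le_left _ _) (hD z h3) fun ζ hζ => ?_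
      exact (min_le_right _ _).trans (hep (z, ζ) (by simp at h2; simp [Prod.norm_def, h2, h1 ζ hζ])).le
    have hNc : ContinuousAt (fun z => ‖N (z, t)‖) 0 :=
      (ContinuousAt.comp (g := N) (f := fun z => (z, t)) (hN.continuousOn.continuousAt (hQ.mem_nhds ⟨h00, htd⟩)) (by fun_prop)).norm
    have hNl : ∀ᶠ z in 𝓝 (0:B), ‖N (z, t)‖ < c ^ D := hNc.eventually_lt continuousAt_const (by
      show ‖N (0, t)‖ < c ^ D
      rw [hN0, norm_zero]; positivity)
    obtain ⟨z, h1, h2, h3⟩ := ((hδD 0 h00).and_eventually (hlow.and hNl)).exists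
    exact absurd (h2 h1) (not_le.2 h3)
  · have hO : IsOpen (((ball (0:B) ε) ×ˢ (ball (0:ℂ) r)) ×ˢ (ball (0:ℂ) d)) := (isOpen_ball.prod isOpen_ball).prod isOpen_ball
    filter_upwards [hO.mem_nhds (show (0 : (B × ℂ) × ℂ) ∈ _ from ⟨⟨h00, mem_ball_self hRD.rp⟩, mem_ball_self hd⟩)]
    rintro ⟨⟨z, ζ⟩, t⟩ ⟨⟨hz, hζ⟩, ht⟩ hg0 hp0
    dsimp only at hz hζ ht hg0 hp0 ⊢
    have hζz : ζ ∈ zs g 0 r z := (hRD.mem_zs hz).2 ⟨hζ, hg0⟩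
    have ht' : ‖t‖ < d := by simpa using ht
    by_contra hne
    have hpos : 0 < ‖N (z, t)‖ / 2 := half_pos (norm_pos_iff.2 hne)
    have hNc : ContinuousAt (fun z => ‖N (z, t)‖) z :=
      (ContinuousAt.comp (g := N) (f := fun z => (z, t)) (hN.continuousOn.continuousAt (hQ.mem_nhds ⟨hz, ht⟩)) (by fun_prop)).norm
    have h1 : ∀ᶠ z' in 𝓝 z, ‖N (z, t)‖ / 2 < ‖N (z', t)‖ := continuousAt_const.eventually_lt hNc (by linarith)
    have hzz := hzd z hz ζ hζz
    have hpc : ContinuousAt (fun y : B × ℂ => ‖p y t‖) (z, ζ) :=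
      (ContinuousAt.comp (g := Function.uncurry p) (f := fun y : B × ℂ => (y, t)) (hdp z ζ t hzz.1 hzz.2 ht').1.continuousAt (by fun_prop)).norm
    have hCD : 0 < C ^ D := by positivity
    have h2 : ∀ᶠ y in 𝓝 (z, ζ), ‖p y t‖ < ‖N (z, t)‖ / 2 / C ^ D := hpc.eventually_lt continuousAt_const (by
      show ‖p (z, ζ) t‖ < _
      rw [hp0, norm_zero]; positivity)
    obtain ⟨e, he, hep⟩ := Metric.eventually_nhds_iff_ball.1 h2
    obtain ⟨z', h3, h4, ⟨b, hb, hbd⟩, h5, h6⟩ := ((hδD z hz).and_eventually (h1.and ((hRD.persist hz hζz he).and ((isOpen_ball.eventually_mem (mem_ball_self he : z ∈ ball z e)).and (isOpen_ball.eventually_mem hz))))).exists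
    rw [hNe (z', t) ⟨h6, ht⟩ h3] at h4
    have h7 := norm_prod_le_one (f := fun ζ => p (z', ζ) t) hC1 (hD z' h6) (fun x hx => (hdp z' x t (hzd z' h6 x hx).1 (hzd z' h6 x hx).2 ht').2.le) hb
    have h8 := hep (z', b) (by rw [mem_ball, Prod.dist_eq]; exact max_lt h5 hbd)
    rw [lt_div_iff₀ hCD] at h8
    linarith
end Good
end

section
def vq {l : ℕ} (v : Fin l → ℂ) (c : ℕ) : ℂ := ∑ j, v j * (c:ℂ) ^ (j:ℕ)

lemma vand_inj {l : ℕ} {s : Finset ℕ} (hs : s.card = l) {v : Fin l → ℂ} (h : ∀ c ∈ s, vq v c = 0) : v = 0 := by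
  classical
  have hdeg : (∑ j : Fin l, Polynomial.C (v j) * Polynomial.X ^ (j:ℕ)).degree < (((s.image (fun c : ℕ => (c:ℂ))).card : ℕ) : WithBot ℕ) := by
    rw [Finset.card_image_of_injective _ Nat.cast_injective, hs]
    exact Polynomial.degree_sum_fin_lt v
  have h0 := Polynomial.eq_zero_of_degree_lt_of_eval_finset_eq_zero _ hdeg (by
    intro x hx
    obtain ⟨c, hc, rfl⟩ := Finset.mem_image.1 hx
    have := h c hc
    simpa [Polynomial.eval_finset_sum, vq] using this)
  funext j
  have := congrArg (fun p => Polynomial.coeff p (j:ℕ)) h0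
  simpa [Polynomial.finset_sum_coeff, Polynomial.coeff_C_mul, Polynomial.coeff_X_pow, Fin.val_inj, Finset.sum_ite_eq] using this

lemma vand (l L : ℕ) : ∃ K : ℝ, 0 < K ∧ ∀ s ∈ (Finset.range L).powersetCard l, ∀ v : Fin l → ℂ, ∀ b > 0, (∀ c ∈ s, ‖vq v c‖ < b) → ‖v‖ < K * b := by
  have h1 : ∀ s : Finset ℕ, ∃ K : ℝ, 0 < K ∧ (s ∈ (Finset.range L).powersetCard l → ∀ v : Fin l → ℂ, ∀ b > 0, (∀ c ∈ s, ‖vq v c‖ < b) → ‖v‖ < K * b) := by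
    intro s
    by_cases hs : s ∈ (Finset.range L).powersetCard l
    · let A : (Fin l → ℂ) →ₗ[ℂ] (s → ℂ) :=
        { toFun := fun v c => vq v c
          map_add' := fun v v' => by funext c; simp [vq, add_mul, Finset.sum_add_distrib]
          map_smul' := fun a v => by funext c; simp [vq, Finset.mul_sum, mul_assoc] }
      have hA : LinearMap.ker A = ⊥ := by
        rw [LinearMap.ker_eq_bot']
        intro v hv
        exact vand_inj (Finset.mem_powersetCard.1 hs).2 fun c hc => congrFun hv ⟨c, hc⟩
      obtain ⟨K, hK, hK'⟩ := A.exists_antilipschitzWith hA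
      refine ⟨K, hK, fun _ v b hb hv => ?_⟩
      have h2 := hK'.le_mul_dist v 0
      simp only [map_zero, dist_zero_right] at h2
      have h3 : ‖A v‖ < b := (pi_norm_lt_iff hb).2 fun c => hv c c.2
      exact h2.trans_lt (mul_lt_mul_of_pos_left h3 (by exact_mod_cast hK))
    · exact ⟨1, one_pos, fun h => absurd h hs⟩
  choose K hK hK' using h1
  refine ⟨∑ s ∈ (Finset.range L).powersetCard l, K s + 1, ?_, fun s hs v b hb hv => ?_⟩
  · have : 0 ≤ ∑ s ∈ (Finset.range L).powersetCard l, K s := Finset.sum_nonneg fun s _ => (hK s).le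
    linarith
  · refine (hK' s hs v b hb hv).trans_le (mul_le_mul_of_nonneg_right ?_ hb.le)
    have := Finset.single_le_sum (f := K) (fun s _ => (hK s).le) hs
    linarith

lemma vand_pick (l D : ℕ) : ∃ K : ℝ, 0 < K ∧ ∀ T : Finset (Fin l → ℂ), T.card ≤ D → ∀ b > 0, (∀ v ∈ T, K * b ≤ ‖v‖) →
    ∃ c : Fin (D * l + 1), ∀ v ∈ T, b ≤ ‖vq v c‖ := by
  classical
  obtain ⟨K, hK, h⟩ := vand l (D * l + 1)
  refine ⟨K, hK, fun T hT b hb hv => ?_⟩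
  by_contra hc
  push Not at hc
  have hsub : Finset.range (D * l + 1) ⊆ T.biUnion fun v => (Finset.range (D * l + 1)).filter fun c => ‖vq v c‖ < b := by
    intro c hcr
    obtain ⟨v, hvT, hvb⟩ := hc ⟨c, Finset.mem_range.1 hcr⟩
    exact Finset.mem_biUnion.2 ⟨v, hvT, Finset.mem_filter.2 ⟨hcr, hvb⟩⟩
  have h1 := (Finset.card_le_card hsub).trans (Finset.card_biUnion_le_card_mul _ _ l fun v hvT => by
    by_contra hlt
    push Not at hlt
    obtain ⟨s, hs, hsc⟩ := Finset.exists_subset_card_eq hlt.le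
    exact absurd (h s (Finset.mem_powersetCard.2 ⟨hs.trans (Finset.filter_subset _ _), hsc⟩) v b hb fun c hc => (Finset.mem_filter.1 (hs hc)).2) (not_lt.2 (hv v hvT)))
  rw [Finset.card_range] at h1
  have := Nat.mul_le_mul_right l hT
  omega

section LSsetup
variable {E : Type*} [NormedAddCommGroup E] [NormedSpace ℂ E] [FiniteDimensional ℂ E]
variable {B : Type*} [NormedAddCommGroup B] [NormedSpace ℂ B] [FiniteDimensional ℂ B] {l : ℕ}

structure Co (π : E → B) (w : E → Fin l → ℂ) (Ψ : B → (Fin l → ℂ) → E) (q : E) : Prop where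
  dπ : Differentiable ℂ π
  dw : Differentiable ℂ w
  dΨ : Differentiable ℂ (Function.uncurry Ψ)
  l1 : ∀ y, Ψ (π y) (w y) = y
  l2 : ∀ z x, π (Ψ z x) = z
  l3 : ∀ z x, w (Ψ z x) = x
  q0 : π q = 0
  q1 : w q = 0

structure Fam (g : B → ℂ) (ρ r : ℝ) (D : ℕ) (M : B → Finset (Fin l → ℂ)) : Prop where
  ρp : 0 < ρ
  rp : 0 < r
  gd : DifferentiableOn ℂ g (ball 0 ρ)
  gD : Dn (ball 0 ρ) g
  et : Et (ball 0 ρ) g M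
  cd : ∀ z ∈ ball (0:B) ρ, (M z).card ≤ D
  bd : ∀ z ∈ ball (0:B) ρ, ∀ x ∈ M z, ‖x‖ < r
  tz : ∀ η > 0, ∀ᶠ z in 𝓝 (0:B), ∀ x ∈ M z, ‖x‖ < η

def Pd (π : E → B) (w : E → Fin l → ℂ) (ρ r : ℝ) : Set E := {y | π y ∈ ball 0 ρ ∧ ‖w y‖ < r}

def Ms (π : E → B) (w : E → Fin l → ℂ) (g : B → ℂ) (ρ : ℝ) (M : B → Finset (Fin l → ℂ)) : Set E :=
  {y | π y ∈ ball 0 ρ ∧ g (π y) ≠ 0 ∧ w y ∈ M (π y)}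

def AnOn (A N : Set E) : Prop := ∃ (m : ℕ) (F : Fin m → E → ℂ), (∀ i, DifferentiableOn ℂ (F i) N) ∧ ∀ y ∈ N, y ∈ A ↔ ∀ i, F i y = 0

variable {π : E → B} {w : E → Fin l → ℂ} {Ψ : B → (Fin l → ℂ) → E} {q : E} {g : B → ℂ} {ρ r : ℝ} {D : ℕ} {M : B → Finset (Fin l → ℂ)}

lemma Co.Pd_open (h : Co π w Ψ q) : IsOpen (Pd π w ρ r) :=
  (isOpen_ball.preimage h.dπ.continuous).inter (isOpen_lt h.dw.continuous.norm continuous_const)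

lemma Co.q_mem (h : Co π w Ψ q) (hρ : 0 < ρ) (hr : 0 < r) : q ∈ Pd π w ρ r := by
  simp [Pd, h.q0, h.q1, hρ, hr]

lemma Co.dn (h : Co π w Ψ q) (hg : Dn (ball 0 ρ) g) : Dn (Pd π w ρ r) (fun y => g (π y)) := by
  intro y hy
  have h1 : Tendsto (fun z => Ψ z (w y)) (𝓝 (π y)) (𝓝 y) := by
    have : Continuous fun z => Ψ z (w y) := h.dΨ.continuous.comp (by fun_prop : Continuous fun z => (z, w y))
    simpa [h.l1] using this.tendsto (π y)
  exact h1.frequently ((hg _ hy.1).mono fun z hz => by simpa only [h.l2] using hz)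

lemma CL (h : Co π w Ψ q) (hM : Fam g ρ r D M) : AnOn (closure (Ms π w g ρ M)) (Pd π w ρ r) := by
  have hP : IsOpen (Pd π w ρ r) := h.Pd_open
  have hex : ∀ c : Fin (D * l + 1), ∃ N : E → ℂ, DifferentiableOn ℂ N (Pd π w ρ r) ∧ ∀ y ∈ Pd π w ρ r, g (π y) ≠ 0 → N y = ∏ x ∈ M (π y), vq (w y - x) c := by
    intro c
    have hd : Differentiable ℂ (Function.uncurry fun (y : E) (x : Fin l → ℂ) => vq (w y - x) c) := by
      have := h.dw
      show Differentiable ℂ (fun a : E × (Fin l → ℂ) => ∑ j : Fin l, (w a.1 - a.2) j * (c:ℂ) ^ (j:ℕ))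
      simp only [Pi.sub_apply]
      fun_prop
    refine NORM hM.et hM.cd hP h.dπ.differentiableOn (fun y hy => hy.1) (hM.gd.comp h.dπ.differentiableOn fun y hy => hy.1) (h.dn hM.gD)
      (fun y _ _ x _ => hd _) (fun y hy => ⟨∑ j : Fin l, (r + r) * ‖(c:ℂ) ^ (j:ℕ)‖, ?_⟩)
    filter_upwards [hP.mem_nhds hy] with y' hy' x hx
    refine (norm_sum_le _ _).trans (Finset.sum_le_sum fun j _ => ?_)
    rw [norm_mul]
    refine mul_le_mul_of_nonneg_right ?_ (norm_nonneg _)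
    exact (norm_le_pi_norm (w y' - x) j).trans ((norm_sub_le _ _).trans (add_le_add hy'.2.le (hM.bd _ hy'.1 x hx).le))
  choose N hN hNe using hex
  refine ⟨_, N, hN, fun y hy => ⟨fun hyc c => ?_, fun hz => ?_⟩⟩
  · by_contra hne
    have hc := ((hN c).continuousOn.continuousAt (hP.mem_nhds hy)).eventually_ne hne
    obtain ⟨y', h1, h2, h3⟩ := ((mem_closure_iff_frequently.1 hyc).and_eventually (hc.and (hP.mem_nhds hy))).exists
    refine h2 ?_
    rw [hNe c y' h3 h1.2.1]
    exact Finset.prod_eq_zero h1.2.2 (by simp [vq])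
  · by_contra hyc
    rw [mem_closure_iff_nhds] at hyc
    push Not at hyc
    obtain ⟨O, hO, hOe⟩ := hyc
    obtain ⟨K, hK, hpick⟩ := vand_pick l D
    have hct : ContinuousAt (Function.uncurry Ψ) (π y, w y) := h.dΨ.continuous.continuousAt
    have hO' : O ∈ 𝓝 (Function.uncurry Ψ (π y, w y)) := by simpa [h.l1] using hO
    obtain ⟨η, hη, hηO⟩ := Metric.eventually_nhds_iff_ball.1 (hct.eventually hO')
    set b := η / 2 / K with hb
    have hbp : 0 < b := by positivity
    set κ := min 1 b ^ D with hκ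
    have hκp : 0 < κ := by have := lt_min one_pos hbp; positivity
    have hlow : ∀ᶠ y' in 𝓝 y, g (π y') ≠ 0 → κ ≤ ∑ c, ‖N c y'‖ := by
      filter_upwards [hP.mem_nhds hy, h.dπ.continuous.continuousAt.eventually (ball_mem_nhds (π y) hη), h.dw.continuous.continuousAt.eventually (ball_mem_nhds (w y) (half_pos hη))] with y' h1 h2 h3 h4
      obtain ⟨c, hc⟩ := hpick ((M (π y')).image fun x => w y' - x) (Finset.card_image_le.trans (hM.cd _ h1.1)) b hbp (by
        intro v hv
        obtain ⟨x, hx, rfl⟩ := Finset.mem_image.1 hv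
        have : K * b = η / 2 := by rw [hb]; field_simp
        rw [this]
        by_contra hlt
        push Not at hlt
        have h5 : (π y', x) ∈ ball (π y, w y) η := by
          rw [mem_ball, Prod.dist_eq]
          refine max_lt h2 ?_
          calc dist x (w y) ≤ dist x (w y') + dist (w y') (w y) := dist_triangle _ _ _
            _ < η / 2 + η / 2 := add_lt_add (by rw [dist_comm, dist_eq_norm]; exact hlt) h3
            _ = η := by ring
        have h6 : Ψ (π y') x ∈ O := hηO _ h5
        have h7 : Ψ (π y') x ∈ Ms π w g ρ M := by
          simp only [Ms, mem_setOf_eq, h.l2, h.l3]; exact ⟨h1.1, h4, hx⟩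
        have h8 : Ψ (π y') x ∈ O ∩ Ms π w g ρ M := ⟨h6, h7⟩
        rw [hOe] at h8
        exact h8)
      refine le_trans ?_ (Finset.single_le_sum (f := fun c => ‖N c y'‖) (fun _ _ => norm_nonneg _) (Finset.mem_univ c))
      rw [hNe c y' h1 h4]
      exact le_norm_prod (lt_min one_pos hbp).le (min_le_left _ _) (hM.cd _ h1.1) fun x hx => (min_le_right _ _).trans (hc _ (Finset.mem_image_of_mem _ hx))
    have hcont : ContinuousAt (fun y => ∑ c, ‖N c y‖) y :=
      tendsto_finsetSum _ fun c _ => ((hN c).continuousOn.continuousAt (hP.mem_nhds hy)).norm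
    have hup : ∀ᶠ y' in 𝓝 y, ∑ c, ‖N c y'‖ < κ := hcont.eventually_lt continuousAt_const (by simpa [hz] using hκp)
    obtain ⟨y', h1, h2, h3⟩ := (((h.dn (r := r) hM.gD) y hy).and_eventually (hlow.and hup)).exists
    exact absurd (h2 h1) (not_le.2 h3)
end LSsetup
end

section
lemma SubV.sup' {ι : Type*} {T : Finset ι} (hT : T.Nonempty) {f : ι → ℂ → ℝ} (h : ∀ i ∈ T, SubV (f i)) : SubV (fun t => T.sup' hT fun i => f i t) := by
  induction hT using Finset.Nonempty.cons_induction with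
  | singleton a => simpa using h a (by simp)
  | cons a s ha hs ih =>
    simp only [Finset.sup'_cons hs]
    exact (h a (by simp)).max (ih fun i hi => h i (by simp [hi]))

lemma punct {Φ : ℂ → ℝ} {ρ m C : ℝ} (hρ : 0 < ρ) (hc : ∀ t, 0 < ‖t‖ → ‖t‖ ≤ ρ → ContinuousAt Φ t)
    (hS : ∀ t, 0 < ‖t‖ → ‖t‖ < ρ → SubV (fun τ => Φ (t + τ))) (hb : ∀ t, ‖t‖ = ρ → Φ t ≤ m) (hC : ∀ᶠ t in 𝓝[≠] (0:ℂ), Φ t ≤ C) :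
    ∀ t, 0 < ‖t‖ → ‖t‖ ≤ ρ → Φ t ≤ m := by
  intro t1 ht1 ht1'
  rw [eventually_nhdsWithin_iff] at hC
  obtain ⟨d, hd, hdC⟩ := Metric.eventually_nhds_iff_ball.1 hC
  set L := Real.log (ρ ^ 2) - Real.log (‖t1‖ ^ 2) with hL
  have key : ∀ ε > 0, Φ t1 ≤ m + ε * L := by
    intro ε hε
    have hlog : ∀ᶠ a in 𝓝[>] (0:ℝ), Real.log (a ^ 2) < Real.log (ρ ^ 2) - (|C| + |m|) / ε := by
      have : Tendsto (fun a : ℝ => Real.log (a ^ 2)) (𝓝[>] 0) atBot := by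
        have h2 : Tendsto (fun a : ℝ => 2 * Real.log a) (𝓝[>] 0) atBot := Real.tendsto_log_nhdsGT_zero.const_mul_atBot two_pos
        refine h2.congr fun a => ?_
        rw [Real.log_pow]; norm_num
      exact this.eventually (eventually_lt_atBot _)
    obtain ⟨a, hal, ha1, ha2⟩ := ((hlog.and (Ioo_mem_nhdsGT (lt_min ht1 hd)))).exists
    have had := ha2.trans_le (min_le_right _ _)
    have hat := ha2.trans_le (min_le_left _ _)
    have hK : IsCompact (closedBall (0:ℂ) ρ \ ball 0 a) := (isCompact_closedBall 0 ρ).diff isOpen_ball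
    have hU : IsOpen (ball (0:ℂ) ρ \ closedBall 0 a) := isOpen_ball.sdiff isClosed_closedBall
    have := maxPrinciple hK (φ := fun t => Φ t + (ε * Real.log (‖t‖ ^ 2) + (- ε * Real.log (ρ ^ 2) - m))) ?_ hU
      (fun t ht => ⟨ball_subset_closedBall ht.1, fun h => ht.2 (ball_subset_closedBall h)⟩) ?_ ?_ t1 ⟨by simpa using ht1', by simpa using hat.le⟩
    · rw [hL]; linarith
    · refine ContinuousOn.upperSemicontinuousOn fun t ht => ContinuousAt.continuousWithinAt ?_
      have h1 : a ≤ ‖t‖ := by simpa using ht.2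
      have h2 : ‖t‖ ≤ ρ := by simpa using ht.1
      refine (hc t (ha1.trans_le h1) h2).add ?_
      have : ‖t‖ ^ 2 ≠ 0 := by have := ha1.trans_le h1; positivity
      fun_prop (disch := assumption)
    · intro t ht
      have h1 : a < ‖t‖ := by simpa using ht.2
      have h2 : ‖t‖ < ρ := by simpa using ht.1
      have h3 : LowH (fun τ => Real.log (‖t + τ‖ ^ 2)) := by
        have h0 : 0 < ‖t‖ := ha1.trans h1
        have := LowH.log_normSq (m := 1) (g := fun _ τ => t + τ) (fun _ => by fun_prop) (by simp; first | exact norm_pos_iff.1 h0 | positivity)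
        simpa using this
      exact (hS t (ha1.trans h1) h2).addLow ((h3.smul hε.le).add (LowH.const _))
    · intro t ht
      have h1 : a ≤ ‖t‖ := by simpa using ht.1.2
      have h2 : ‖t‖ ≤ ρ := by simpa using ht.1.1
      by_cases h3 : ‖t‖ = ρ
      · have := hb t h3
        rw [h3]; linarith
      · have h4 : ‖t‖ = a := by
          by_contra hne
          exact ht.2 ⟨by simpa using lt_of_le_of_ne h2 h3, by simpa using lt_of_le_of_ne h1 (Ne.symm hne)⟩
        have h5 := hdC t (by simpa [h4] using had) (by intro h0; rw [mem_singleton_iff.1 h0, norm_zero] at h4; linarith)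
        have h6 : ε * Real.log (‖t‖ ^ 2) ≤ ε * (Real.log (ρ ^ 2) - (|C| + |m|) / ε) := by rw [h4]; gcongr
        have h7 : ε * ((|C| + |m|) / ε) = |C| + |m| := by field_simp
        rw [mul_sub, h7] at h6
        linarith [le_abs_self C, neg_abs_le m]
  have hlim : Tendsto (fun ε : ℝ => m + ε * L) (𝓝[>] 0) (𝓝 m) := by
    have : Continuous fun ε : ℝ => m + ε * L := by fun_prop
    simpa using (this.tendsto 0).mono_left nhdsWithin_le_nhds
  exact ge_of_tendsto hlim (by filter_upwards [self_mem_nhdsWithin] with ε hε using key ε hε)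

section AP
variable {E : Type*} [NormedAddCommGroup E] [NormedSpace ℂ E] [FiniteDimensional ℂ E] [CompleteSpace E]
variable {B : Type*} [NormedAddCommGroup B] [NormedSpace ℂ B] [FiniteDimensional ℂ B] {l : ℕ}
variable {π : E → B} {w : E → Fin l → ℂ} {Ψ : B → (Fin l → ℂ) → E} {q : E} {g : B → ℂ} {ρ r : ℝ} {D : ℕ} {M : B → Finset (Fin l → ℂ)}

lemma Fam.nonempty (h : Co π w Ψ q) (hM : Fam g ρ r D M) (hne : (Ms π w g ρ M).Nonempty) :
    ∀ z ∈ ball (0:B) ρ, g z ≠ 0 → (M z).Nonempty := by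
  obtain ⟨χ, hχ, hχe⟩ := NORM hM.et hM.cd isOpen_ball (q := id) differentiableOn_id (fun _ h => h) hM.gd hM.gD (H := fun _ _ => (0:ℂ))
    (fun _ _ _ _ _ => by simp [Function.uncurry_def]) (fun _ _ => ⟨0, by simp⟩)
  obtain ⟨y, hy1, hy2, hy3⟩ := hne
  have h0 : ∀ᶠ z in 𝓝 (π y), χ z = 0 := by
    obtain ⟨s, hs1, -, -⟩ := hM.et.sec hy1 hy2
    filter_upwards [(hs1 _ hy3).2.2.1, isOpen_ball.mem_nhds hy1, (hM.gd.continuousOn.continuousAt (isOpen_ball.mem_nhds hy1)).eventually_ne hy2] with z h1 h2 h3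
    rw [hχe z h2 h3]
    exact Finset.prod_eq_zero h1 rfl
  have hall := ident_conv isOpen_ball (convex_ball _ _) hχ hy1 h0
  intro z hz hg
  by_contra hc
  rw [Finset.not_nonempty_iff_eq_empty] at hc
  have h1 := hχe z hz hg
  rw [hall z hz] at h1
  simp [hc] at h1

lemma AP (h : Co π w Ψ q) (hM : Fam g ρ r D M) (hne : (Ms π w g ρ M).Nonempty) {N : Set E} (hN : IsOpen N) (hqN : q ∈ N) :
    ∃ K : Set E, IsCompact K ∧ K ⊆ Ms π w g ρ M ∩ N ∧ ∀ v : E → ℝ, ContinuousOn v N → RP v N → ∃ x ∈ K, v q ≤ v x := by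
  have hfib := hM.nonempty h hne
  have hΨc : Continuous (Function.uncurry Ψ) := h.dΨ.continuous
  have hΨ0 : Function.uncurry Ψ (0, 0) = q := by
    show Ψ 0 0 = q
    conv_rhs => rw [← h.l1 q, h.q0, h.q1]
  obtain ⟨e, ρ', hρ', hdir⟩ := exists_dir isOpen_ball hM.gd hM.gD (mem_ball_self hM.ρp)
  simp only [zero_add] at hdir
  have hec : Continuous fun t : ℂ => t • e := by fun_prop
  have htoq : ∀ O ∈ 𝓝 q, ∀ᶠ t in 𝓝 (0:ℂ), ∀ x ∈ M (t • e), Ψ (t • e) x ∈ O := by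
    intro O hO
    rw [← hΨ0] at hO
    obtain ⟨η, hη, hηO⟩ := Metric.eventually_nhds_iff_ball.1 (hΨc.continuousAt.eventually hO)
    have h0 : Tendsto (fun t : ℂ => t • e) (𝓝 0) (𝓝 0) := by simpa using hec.tendsto 0
    filter_upwards [h0.eventually (hM.tz η hη), h0.eventually (ball_mem_nhds 0 hη)] with t h1 h2 x hx
    have h2' : ‖t • e‖ < η := by simpa using h2
    exact hηO (t • e, x) (by rw [mem_ball, Prod.dist_eq]; exact max_lt (by simpa using h2') (by simpa using h1 x hx))
  obtain ⟨ρ1', hρ1', hN1⟩ := Metric.eventually_nhds_iff_ball.1 (htoq N (hN.mem_nhds hqN))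
  obtain ⟨ρ1, hρ1, hρ1a, hρ1b⟩ : ∃ ρ1 > 0, ρ1 ≤ ρ' ∧ ρ1 < ρ1' := ⟨min ρ' (ρ1' / 2), by positivity, min_le_left _ _, (min_le_right _ _).trans_lt (by linarith)⟩
  have hN1 : ∀ t : ℂ, ‖t‖ ≤ ρ1 → ∀ x ∈ M (t • e), Ψ (t • e) x ∈ N := fun t ht => hN1 t (by simpa using ht.trans_lt hρ1b)
  have hgood : ∀ t : ℂ, ‖t‖ ≤ ρ1 → 0 < ‖t‖ → t • e ∈ ball (0:B) ρ ∧ g (t • e) ≠ 0 := fun t ht h0 =>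
    ⟨(hdir t (ht.trans hρ1a)).1, (hdir t (ht.trans hρ1a)).2 (norm_pos_iff.1 h0)⟩
  set K' : Set (ℂ × (Fin l → ℂ)) := {a | ‖a.1‖ = ρ1 ∧ a.2 ∈ M (a.1 • e)} with hK'
  have hK'c : IsCompact K' := by
    refine Metric.isCompact_of_isClosed_isBounded ?_ ?_
    · rw [← isOpen_compl_iff, isOpen_iff_mem_nhds]
      rintro ⟨t0, x0⟩ hx
      by_cases ht0 : ‖t0‖ = ρ1
      · have hx0 : x0 ∉ M (t0 • e) := fun h' => hx ⟨ht0, h'⟩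
        obtain ⟨h1, h2⟩ := hgood t0 ht0.le (by rw [ht0]; exact hρ1)
        obtain ⟨s, hs1, -, hs3⟩ := hM.et.sec h1 h2
        have hT : Tendsto (fun a : ℂ × (Fin l → ℂ) => a.1 • e) (𝓝 (t0, x0)) (𝓝 (t0 • e)) := by
          have : Continuous fun a : ℂ × (Fin l → ℂ) => a.1 • e := by fun_prop
          exact this.tendsto (t0, x0)
        have h4 : ∀ᶠ a : ℂ × (Fin l → ℂ) in 𝓝 (t0, x0), ∀ x ∈ M (t0 • e), s x (a.1 • e) - a.2 ≠ 0 := by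
          refine (M (t0 • e)).eventually_all.2 fun x hx' => ?_
          have hc : ContinuousAt (s x) (t0 • e) := (hs1 x hx').2.1.self_of_nhds.continuousAt
          have h5 : Tendsto (fun a : ℂ × (Fin l → ℂ) => s x (a.1 • e) - a.2) (𝓝 (t0, x0)) (𝓝 (x - x0)) := by
            have := (hc.tendsto.comp hT).sub (continuousAt_snd (p := (t0, x0))).tendsto
            rw [(hs1 x hx').1] at this
            exact this
          exact h5.eventually_ne (sub_ne_zero.2 fun h6 => hx0 (h6 ▸ hx'))
        filter_upwards [h4, hT.eventually hs3] with a h5 h6 ha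
        obtain ⟨x, hx', hxe⟩ := (h6 _).1 ha.2
        exact h5 x hx' (by rw [hxe, sub_self])
      · have : ∀ᶠ a : ℂ × (Fin l → ℂ) in 𝓝 (t0, x0), ‖a.1‖ ≠ ρ1 :=
          (continuous_fst.norm.continuousAt).eventually_ne ht0
        filter_upwards [this] with a ha h'
        exact ha h'.1
    · refine (isBounded_iff_forall_norm_le.2 ⟨max ρ1 r, fun a ha => ?_⟩)
      rw [Prod.norm_def]
      exact max_le_max ha.1.le (hM.bd _ (hgood a.1 ha.1.le (by rw [ha.1]; exact hρ1)).1 _ ha.2).le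
  refine ⟨(fun a : ℂ × (Fin l → ℂ) => Ψ (a.1 • e) a.2) '' K', hK'c.image (hΨc.comp (by fun_prop : Continuous fun a : ℂ × (Fin l → ℂ) => (a.1 • e, a.2))), ?_, ?_⟩
  · rintro _ ⟨a, ha, rfl⟩
    have h1 := hgood a.1 ha.1.le (by rw [ha.1]; exact hρ1)
    refine ⟨?_, hN1 a.1 ha.1.le _ ha.2⟩
    simp only [Ms, mem_setOf_eq, h.l2, h.l3]
    exact ⟨h1.1, h1.2, ha.2⟩
  · intro v hvc hv
    by_contra hcon
    push Not at hcon
    have hcon : ∀ t : ℂ, ‖t‖ = ρ1 → ∀ x ∈ M (t • e), v (Ψ (t • e) x) < v q := fun t ht x hx => hcon _ ⟨(t, x), ⟨ht, hx⟩, rfl⟩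
    have hρn : ‖(ρ1 : ℂ)‖ = ρ1 := by simp [hρ1.le]
    obtain ⟨x1, hx1⟩ := hfib _ (hgood (ρ1:ℂ) hρn.le (by rw [hρn]; exact hρ1)).1 (hgood (ρ1:ℂ) hρn.le (by rw [hρn]; exact hρ1)).2
    have hvK : ContinuousOn (fun a : ℂ × (Fin l → ℂ) => v (Ψ (a.1 • e) a.2)) K' :=
      hvc.comp (hΨc.comp (by fun_prop : Continuous fun a : ℂ × (Fin l → ℂ) => (a.1 • e, a.2))).continuousOn fun a ha => hN1 a.1 ha.1.le _ ha.2
    obtain ⟨a0, ha0, hmax⟩ := hK'c.exists_isMaxOn ⟨((ρ1:ℂ), x1), hρn, hx1⟩ hvK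
    set m := v (Ψ (a0.1 • e) a0.2) with hm
    have hmq : m < v q := hcon a0.1 ha0.1 _ ha0.2
    classical
    set Φ : ℂ → ℝ := fun t => if hT : (M (t • e)).Nonempty then (M (t • e)).sup' hT (fun x => v (Ψ (t • e) x)) else 0 with hΦ
    have hΦle : ∀ (t : ℂ) (C : ℝ), (M (t • e)).Nonempty → (∀ x ∈ M (t • e), v (Ψ (t • e) x) ≤ C) → Φ t ≤ C := by
      intro t C hT hC
      simp only [hΦ, dif_pos hT]
      exact Finset.sup'_le _ _ hC
    have hloc : ∀ t0 : ℂ, 0 < ‖t0‖ → ‖t0‖ ≤ ρ1 → ContinuousAt Φ t0 ∧ SubV (fun τ => Φ (t0 + τ)) := by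
      intro t0 h0 h1
      obtain ⟨h2, h3⟩ := hgood t0 h1 h0
      obtain ⟨s, hs1, hs2, hs3⟩ := hM.et.sec h2 h3
      have hT0 := hfib _ h2 h3
      have heq : ∀ᶠ t in 𝓝 t0, Φ t = (M (t0 • e)).sup' hT0 (fun x => v (Ψ (t • e) (s x (t • e)))) := by
        filter_upwards [hec.continuousAt.eventually hs3] with t ht
        have him : M (t • e) = (M (t0 • e)).image (fun x => s x (t • e)) := by ext x'; rw [ht x', Finset.mem_image]
        have hT : (M (t • e)).Nonempty := by rw [him]; exact hT0.image _
        simp only [hΦ, dif_pos hT]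
        refine le_antisymm (Finset.sup'_le _ _ fun x hx => ?_) (Finset.sup'_le _ _ fun x hx => ?_)
        · obtain ⟨x', hx', rfl⟩ := (ht x).1 hx
          exact Finset.le_sup' (fun x => v (Ψ (t • e) (s x (t • e)))) hx'
        · exact Finset.le_sup' (fun x => v (Ψ (t • e) x)) ((ht _).2 ⟨x, hx, rfl⟩)
      have hda : ∀ x ∈ M (t0 • e), AnalyticAt ℂ (fun t : ℂ => Ψ (t • e) (s x (t • e))) t0 := by
        intro x hx
        refine Complex.analyticAt_iff_eventually_differentiableAt.2 ?_
        filter_upwards [hec.continuousAt.eventually (hs1 x hx).2.1] with t ht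
        exact (h.dΨ _).comp (f := fun t : ℂ => (t • e, s x (t • e))) t
          (DifferentiableAt.prodMk (by fun_prop) (DifferentiableAt.comp (g := s x) (f := fun t : ℂ => t • e) t ht (by fun_prop)))
      have hval : ∀ x ∈ M (t0 • e), Ψ (t0 • e) (s x (t0 • e)) ∈ N := fun x hx => by rw [(hs1 x hx).1]; exact hN1 t0 h1 x hx
      constructor
      · refine ContinuousAt.congr ?_ (heq.mono fun _ h => h.symm)
        exact ContinuousAt.finset_sup'_apply hT0 fun x hx => ContinuousAt.comp (g := v) (f := fun t : ℂ => Ψ (t • e) (s x (t • e))) (hvc.continuousAt (hN.mem_nhds (hval x hx))) (hda x hx).continuousAt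
      · have h4 : SubV (fun τ => (M (t0 • e)).sup' hT0 (fun x => v (Ψ ((t0 + τ) • e) (s x ((t0 + τ) • e))))) := by
          refine SubV.sup' hT0 fun x hx => hv.2 (fun τ => Ψ ((t0 + τ) • e) (s x ((t0 + τ) • e))) ?_ (by simpa using hval x hx)
          exact AnalyticAt.comp (g := fun t : ℂ => Ψ (t • e) (s x (t • e))) (f := fun τ => t0 + τ) (by simpa using hda x hx) (by fun_prop)
        refine h4.congr ?_
        filter_upwards [(tendsto_add0 t0).eventually heq] with τ hτ
        exact hτ.symm
    have hne0 : ∀ᶠ t in 𝓝[≠] (0:ℂ), ‖t‖ ≤ ρ1 ∧ 0 < ‖t‖ := by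
      rw [eventually_nhdsWithin_iff]
      filter_upwards [ball_mem_nhds (0:ℂ) hρ1] with t ht h0
      exact ⟨by simpa using (mem_ball_zero_iff.1 ht).le, norm_pos_iff.2 h0⟩
    have hvq : ContinuousAt v q := hvc.continuousAt (hN.mem_nhds hqN)
    have hp := punct (Φ := Φ) (m := m) (C := v q + 1) hρ1 (fun t h0 h1 => (hloc t h0 h1).1) (fun t h0 h1 => (hloc t h0 h1.le).2)
      (fun t ht => by
        have h1 := hgood t ht.le (by rw [ht]; exact hρ1)
        exact hΦle t m (hfib _ h1.1 h1.2) fun x hx => hmax (show (t, x) ∈ K' from ⟨ht, hx⟩))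
      (by
        filter_upwards [hne0, nhdsWithin_le_nhds (htoq _ (hvq.eventually_lt continuousAt_const (by linarith : v q < v q + 1)))] with t ht h1
        have h2 := hgood t ht.1 ht.2
        exact hΦle t _ (hfib _ h2.1 h2.2) fun x hx => (h1 x hx).le)
    obtain ⟨t, ht, h1⟩ := (hne0.and (nhdsWithin_le_nhds (htoq _ (continuousAt_const.eventually_lt hvq hmq)))).exists
    have h2 := hgood t ht.1 ht.2
    obtain ⟨x, hx⟩ := hfib _ h2.1 h2.2
    have h3 := hp t ht.2 ht.1
    have h4 : v (Ψ (t • e) x) ≤ Φ t := by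
      simp only [hΦ, dif_pos (show (M (t • e)).Nonempty from ⟨x, hx⟩)]
      exact Finset.le_sup' (fun x => v (Ψ (t • e) x)) hx
    have h5 : m < v (Ψ (t • e) x) := h1 x hx
    linarith
end AP
end

section
section AN
variable {E : Type*} [NormedAddCommGroup E] [NormedSpace ℂ E]

lemma AnOn.mk' {A N : Set E} {ι : Type*} [Fintype ι] (F : ι → E → ℂ) (hF : ∀ i, DifferentiableOn ℂ (F i) N) (h : ∀ y ∈ N, y ∈ A ↔ ∀ i, F i y = 0) : AnOn A N :=
  ⟨Fintype.card ι, fun k => F ((Fintype.equivFin ι).symm k), fun k => hF _, fun y hy => by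
    rw [h y hy]; exact ((Fintype.equivFin ι).symm.forall_congr_right (q := fun i => F i y = 0)).symm⟩

lemma AnOn.mono {A N N' : Set E} (h : AnOn A N) (hN : N' ⊆ N) : AnOn A N' := by
  obtain ⟨m, F, h1, h2⟩ := h
  exact ⟨m, F, fun i => (h1 i).mono hN, fun y hy => h2 y (hN hy)⟩

lemma AnOn.congr {A A' N : Set E} (h : AnOn A N) (h' : ∀ y ∈ N, y ∈ A' ↔ y ∈ A) : AnOn A' N := by
  obtain ⟨m, F, h1, h2⟩ := h
  exact ⟨m, F, h1, fun y hy => (h' y hy).trans (h2 y hy)⟩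

lemma AnOn.empty {N : Set E} : AnOn ∅ N := .mk' (fun _ : Unit => fun _ => 1) (fun _ => differentiableOn_const _) (by simp)

lemma AnOn.inter {A A' N : Set E} (h : AnOn A N) (h' : AnOn A' N) : AnOn (A ∩ A') N := by
  obtain ⟨m, F, h1, h2⟩ := h
  obtain ⟨m', F', h1', h2'⟩ := h'
  refine .mk' (Sum.elim F F') (by rintro (i | i); exacts [h1 i, h1' i]) fun y hy => ?_
  simp [Sum.forall, mem_inter_iff, h2 y hy, h2' y hy]

lemma AnOn.union {A A' N : Set E} (h : AnOn A N) (h' : AnOn A' N) : AnOn (A ∪ A') N := by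
  obtain ⟨m, F, h1, h2⟩ := h
  obtain ⟨m', F', h1', h2'⟩ := h'
  refine .mk' (fun (i : Fin m × Fin m') y => F i.1 y * F' i.2 y) (fun i => (h1 _).mul (h1' _)) fun y hy => ?_
  rw [mem_union, h2 y hy, h2' y hy]
  constructor
  · rintro (h | h) i <;> simp [h]
  · intro h
    by_contra hc
    push Not at hc
    obtain ⟨⟨i, hi⟩, j, hj⟩ := hc
    exact (mul_ne_zero hi hj) (h (i, j))

lemma AnOn.single {N : Set E} {f : E → ℂ} (hf : DifferentiableOn ℂ f N) : AnOn {y | f y = 0} N :=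
  .mk' (fun _ : Unit => f) (fun _ => hf) (by simp)

def Patch (Y : Set E) (p : E) : Prop := ∀ O ∈ 𝓝 p, ∃ (n : ℕ) (Ω : Set (Fin n → ℂ)) (θ : (Fin n → ℂ) → E) (O' : Set E),
  IsOpen Ω ∧ Convex ℝ Ω ∧ DifferentiableOn ℂ θ Ω ∧ IsOpen O' ∧ p ∈ O' ∧ O' ⊆ O ∧ θ '' Ω = Y ∩ O'

lemma Patch.congr {Y Y' : Set E} {p : E} (h : Patch Y p) (he : ∀ᶠ y in 𝓝 p, y ∈ Y ↔ y ∈ Y') : Patch Y' p := by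
  intro O hO
  obtain ⟨n, Ω, θ, O', h1, h2, h3, h4, h5, h6, h7⟩ := h _ (inter_mem hO he)
  refine ⟨n, Ω, θ, O', h1, h2, h3, h4, h5, fun y hy => (h6 hy).1, ?_⟩
  rw [h7]
  ext y
  exact ⟨fun h => ⟨(h6 h.2).2.1 h.1, h.2⟩, fun h => ⟨(h6 h.2).2.2 h.1, h.2⟩⟩
end AN

section STEP
variable {E : Type*} [NormedAddCommGroup E] [NormedSpace ℂ E] [FiniteDimensional ℂ E]
variable {B : Type*} [NormedAddCommGroup B] [NormedSpace ℂ B] [FiniteDimensional ℂ B] {l : ℕ}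
variable {π : E → B} {w : E → Fin l → ℂ} {Ψ : B → (Fin l → ℂ) → E} {q : E} {g : B → ℂ} {ρ r : ℝ} {D : ℕ} {M : B → Finset (Fin l → ℂ)}

lemma Co.small (h : Co π w Ψ q) {O : Set E} (hO : O ∈ 𝓝 q) : ∃ η > 0, Pd π w η η ⊆ O := by
  have h0 : Function.uncurry Ψ (0, 0) = q := by
    show Ψ 0 0 = q
    conv_rhs => rw [← h.l1 q, h.q0, h.q1]
  rw [← h0] at hO
  obtain ⟨η, hη, hηO⟩ := Metric.eventually_nhds_iff_ball.1 (h.dΨ.continuous.continuousAt.eventually hO)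
  refine ⟨η, hη, fun y hy => ?_⟩
  have : Function.uncurry Ψ (π y, w y) ∈ O := hηO (π y, w y) (by rw [mem_ball, Prod.dist_eq]; exact max_lt hy.1 (by simpa using hy.2))
  rwa [show Function.uncurry Ψ (π y, w y) = y from h.l1 y] at this

lemma LC.mono {Ω : Set B} {G G' : B → ℂ} {S : B → Finset (Fin l → ℂ)} {Q : B → (Fin l → ℂ) → Prop} (h : LC Ω G S Q) (h2 : ∀ z ∈ Ω, G' z ≠ 0 → G z ≠ 0) :
    LC Ω G' S Q := fun z0 hz0 hG => h z0 hz0 (h2 z0 hz0 hG)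

lemma LC.all {Ω : Set B} {G : B → ℂ} {S : B → Finset (Fin l → ℂ)} {ι : Type*} [Finite ι] {Q : ι → B → (Fin l → ℂ) → Prop} (h : ∀ i, LC Ω G S (Q i)) :
    LC Ω G S (fun z x => ∀ i, Q i z x) := fun z0 hz0 hG x hx => by
  filter_upwards [eventually_all.2 fun i => h i z0 hz0 hG x hx] with p hp hS
  exact forall_congr' fun i => hp i hS

lemma LC.congr {Ω : Set B} {G : B → ℂ} {S : B → Finset (Fin l → ℂ)} {Q Q' : B → (Fin l → ℂ) → Prop} (hΩ : IsOpen Ω) (h : LC Ω G S Q)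
    (hq : ∀ z ∈ Ω, ∀ x ∈ S z, Q' z x ↔ Q z x) : LC Ω G S Q' := fun z0 hz0 hG x hx => by
  filter_upwards [h z0 hz0 hG x hx, continuousAt_fst.eventually (hΩ.eventually_mem hz0)] with p hp hΩp hS
  rw [hq _ hΩp _ hS, hp hS, hq _ hz0 _ hx]

lemma STEP (h : Co π w Ψ q) {N0 Y A : Set E} (hN : N0 ∈ 𝓝 q) (hY : AnOn Y N0) (hA : AnOn A N0) (hNo : IsOpen N0)
    {p : Fin l → B → ℂ → ℂ} (hp : ∀ j, GoodP (p j)) (hpY : ∀ᶠ y in 𝓝 q, y ∈ Y → ∀ j, p j (π y) (w y j) = 0) :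
    ∃ (ρ r : ℝ) (D : ℕ) (g : B → ℂ) (S : B → Finset (Fin l → ℂ)), Pd π w ρ r ⊆ N0 ∧ Fam g ρ r D S ∧ (∀ y ∈ Pd π w ρ r, y ∈ Y → w y ∈ S (π y)) ∧
      LC (ball 0 ρ) g S (fun z x => Ψ z x ∈ Y) ∧ LC (ball 0 ρ) g S (fun z x => Ψ z x ∈ A) := by
  obtain ⟨m1, F1, hF1, hF1'⟩ := hY
  obtain ⟨m2, F2, hF2, hF2'⟩ := hA
  have hqN : q ∈ N0 := mem_of_mem_nhds hN
  let F : Fin m1 ⊕ Fin m2 → E → ℂ := Sum.elim F1 F2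
  have hF : ∀ i, DifferentiableOn ℂ (F i) N0 := by rintro (i | i); exacts [hF1 i, hF2 i]
  have hFb : ∀ᶠ y in 𝓝 q, ∀ i, ‖F i y‖ < ‖F i q‖ + 1 := eventually_all.2 fun i =>
    ((hF i).continuousOn.continuousAt hN).norm.eventually_lt continuousAt_const (by linarith)
  obtain ⟨η, hη, hηO⟩ := h.small (inter_mem hN (inter_mem hFb hpY))
  obtain ⟨r, hr, hr0, hrη⟩ := ((eventually_all.2 fun j => (hp j).rd).and (Ioo_mem_nhdsGT hη)).exists
  obtain ⟨ρ, hρ, hρ0, hρη⟩ := ((eventually_all.2 fun j => (hr j).2).and (Ioo_mem_nhdsGT hη)).exists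
  have hPsub : Pd π w ρ r ⊆ Pd π w η η := fun y hy => ⟨ball_subset_ball hρη.le hy.1, hy.2.trans hrη⟩
  have hball : IsOpen (ball (0:B) ρ) := isOpen_ball
  have h0b : (0:B) ∈ ball 0 ρ := mem_ball_self hρ0
  choose δ hδd hδD hδE Dj hDj using fun j => (hρ j).et (convex_ball _ _) ⟨0, h0b⟩
  set S : B → Finset (Fin l → ℂ) := fun z => Fintype.piFinset fun j => zs (p j) 0 r z with hS
  set δ0 : B → ℂ := fun z => ∏ j, δ j z with hδ0
  have hEt : Et (ball 0 ρ) δ0 S := Et.pi hδE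
  have hδ0d : DifferentiableOn ℂ δ0 (ball 0 ρ) := diffOn_prod _ hball fun j _ => hδd j
  have hδ0D : Dn (ball 0 ρ) δ0 := Dn.prod Finset.univ hball (fun j _ => hδD j) fun j _ => (hδd j).continuousOn
  have hcard : ∀ z ∈ ball (0:B) ρ, (S z).card ≤ ∏ j, Dj j := fun z hz => by
    rw [hS, Fintype.card_piFinset]; exact Finset.prod_le_prod' fun j _ => hDj j z hz
  have hbd : ∀ z ∈ ball (0:B) ρ, ∀ x ∈ S z, ‖x‖ < r := fun z hz x hx => by
    rw [pi_norm_lt_iff hr0]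
    intro j
    simpa using (((hρ j).mem_zs hz).1 (Fintype.mem_piFinset.1 hx j)).1
  have hΨP : ∀ z ∈ ball (0:B) ρ, ∀ x ∈ S z, Ψ z x ∈ Pd π w ρ r := fun z hz x hx => by
    simp only [Pd, mem_setOf_eq, h.l2, h.l3]; exact ⟨hz, hbd z hz x hx⟩
  have hΨN : ∀ z ∈ ball (0:B) ρ, ∀ x ∈ S z, Ψ z x ∈ N0 := fun z hz x hx => (hηO (hPsub (hΨP z hz x hx))).1
  have hN' := fun i => clopenN hEt hcard hball hδ0d hδ0D (F := fun z x => F i (Ψ z x))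
    (fun z hz x hx => DifferentiableAt.comp (g := F i) (f := Function.uncurry Ψ) (z, x) ((hF i).differentiableAt (hNo.mem_nhds (hΨN z hz x hx))) (h.dΨ _))
    (fun z hz => ⟨‖F i q‖ + 1, by
      filter_upwards [hball.mem_nhds hz] with z' hz' x hx
      exact ((hηO (hPsub (hΨP z' hz' x hx))).2.1 i).le⟩)
  choose N hNd hND hNL using hN'
  have hLC : ∀ i, LC (ball 0 ρ) (fun z => δ0 z * ∏ i, N i z) S (fun z x => F i (Ψ z x) = 0) := fun i =>
    (hNL i).mono fun z hz hne => mul_ne_zero (left_ne_zero_of_mul hne) (Finset.prod_ne_zero_iff.1 (right_ne_zero_of_mul hne) i (Finset.mem_univ i))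
  refine ⟨ρ, r, ∏ j, Dj j, fun z => δ0 z * ∏ i, N i z, S, fun y hy => (hηO (hPsub hy)).1, ⟨hρ0, hr0, ?_, ?_, ?_, hcard, hbd, ?_⟩, ?_, ?_, ?_⟩
  · exact hδ0d.fun_mul (diffOn_prod _ hball fun i _ => hNd i)
  · exact Dn.mul hball hδ0D hδ0d.continuousOn (Dn.prod Finset.univ hball (fun i _ => hND i) fun i _ => (hNd i).continuousOn)
  · exact hEt.mono Subset.rfl fun z _ hne => left_ne_zero_of_mul hne
  · intro ε hε
    filter_upwards [eventually_all.2 fun j => (hρ j).tozero h0b (hr j).1 hε] with z hz x hx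
    rw [pi_norm_lt_iff hε]
    exact fun j => hz j _ (Fintype.mem_piFinset.1 hx j)
  · intro y hy hyY
    rw [hS, Fintype.mem_piFinset]
    intro j
    rw [(hρ j).mem_zs hy.1]
    exact ⟨by simpa using (norm_le_pi_norm (w y) j).trans_lt hy.2, (hηO (hPsub hy)).2.2 hyY j⟩
  · exact (LC.all fun i => hLC (Sum.inl i)).congr hball fun z hz x hx => hF1' _ (hΨN z hz x hx)
  · exact (LC.all fun i => hLC (Sum.inr i)).congr hball fun z hz x hx => hF2' _ (hΨN z hz x hx)

open Classical in
lemma Fam.filter {Q : B → (Fin l → ℂ) → Prop} (h : Fam g ρ r D M) (hQ : LC (ball 0 ρ) g M Q) : Fam g ρ r D (fun z => (M z).filter (Q z)) :=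
  ⟨h.ρp, h.rp, h.gd, h.gD, h.et.filter hQ, fun z hz => (Finset.card_filter_le _ _).trans (h.cd z hz), fun z hz x hx => h.bd z hz x (Finset.mem_filter.1 hx).1,
    fun η hη => (h.tz η hη).mono fun z hz x hx => hz x (Finset.mem_filter.1 hx).1⟩

open Classical in
lemma Ms_filter (h : Co π w Ψ q) (hM : Fam g ρ r D M) {Z : Set E} (hZ : ∀ y ∈ Pd π w ρ r, y ∈ Z → w y ∈ M (π y)) :
    Ms π w g ρ (fun z => (M z).filter (fun x => Ψ z x ∈ Z)) = {y | y ∈ Pd π w ρ r ∧ y ∈ Z ∧ g (π y) ≠ 0} := by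
  ext y
  simp only [Ms, mem_setOf_eq, Finset.mem_filter, h.l1]
  exact ⟨fun ⟨a, b, c, d⟩ => ⟨⟨a, hM.bd _ a _ c⟩, d, b⟩, fun ⟨a, b, c⟩ => ⟨a.1, c, hZ y a b, b⟩⟩

lemma patch_of (h : Co π w Ψ q) (hM : Fam g ρ r D M) {Y : Set E} (hY : ∀ y ∈ Pd π w ρ r, y ∈ Y → w y ∈ M (π y))
    (hL : LC (ball 0 ρ) g M (fun z x => Ψ z x ∈ Y)) {y : E} (hyP : y ∈ Pd π w ρ r) (hyY : y ∈ Y) (hg : g (π y) ≠ 0) : Patch Y y := by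
  intro O hO
  have hx := hY y hyP hyY
  obtain ⟨s, hs, -, -⟩ := hM.et.sec hyP.1 hg
  obtain ⟨hs0, hs1, hs2, hs3⟩ := hs _ hx
  have hΨy : Function.uncurry Ψ (π y, w y) = y := h.l1 y
  have hΨt : Tendsto (Function.uncurry Ψ) (𝓝 (π y, w y)) (𝓝 y) := by
    have := h.dΨ.continuous.tendsto (π y, w y); rwa [hΨy] at this
  have hev := hs3.and ((hL _ hyP.1 hg _ hx).and (hΨt.eventually (inter_mem hO (h.Pd_open.mem_nhds hyP))))
  obtain ⟨ε', hε', hev'⟩ := Metric.eventually_nhds_iff_ball.1 hev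
  have hsc : ContinuousAt (s (w y)) (π y) := hs1.self_of_nhds.continuousAt
  have hsn : ∀ᶠ z in 𝓝 (π y), s (w y) z ∈ ball (w y) ε' := by
    refine hsc.eventually ?_
    rw [hs0]; exact ball_mem_nhds _ hε'
  obtain ⟨ε, hε, hev2⟩ := Metric.eventually_nhds_iff_ball.1 ((hs1.and (hs2.and hsn)).and (ball_mem_nhds _ hε'))
  let e := (Module.finBasis ℂ B).equivFunL
  have hmem : ∀ z ∈ ball (π y) ε, ∀ x ∈ ball (w y) ε', ((z, x) : B × (Fin l → ℂ)) ∈ ball (π y, w y) ε' := fun z hz x hx => by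
    rw [← ball_prod_same]; exact ⟨(hev2 z hz).2, hx⟩
  refine ⟨_, e.symm ⁻¹' ball (π y) ε, fun v => Ψ (e.symm v) (s (w y) (e.symm v)), {y' | π y' ∈ ball (π y) ε ∧ w y' ∈ ball (w y) ε'},
    isOpen_ball.preimage e.symm.continuous, ?_, ?_, ?_, ⟨mem_ball_self hε, mem_ball_self hε'⟩, ?_, ?_⟩
  · exact (convex_ball (π y) ε).is_linear_preimage ⟨fun a b => map_add e.symm a b, fun c a => by
      rw [← Complex.coe_smul, map_smul, Complex.coe_smul]⟩
  · intro v hv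
    refine DifferentiableAt.differentiableWithinAt ?_
    exact (h.dΨ _).comp (f := fun v => (e.symm v, s (w y) (e.symm v))) v
      (DifferentiableAt.prodMk e.symm.differentiableAt (DifferentiableAt.comp (g := s (w y)) (f := e.symm) v (hev2 _ hv).1.1 e.symm.differentiableAt))
  · exact (isOpen_ball.preimage h.dπ.continuous).inter (isOpen_ball.preimage h.dw.continuous)
  · intro y' hy'
    have := (hev' _ (hmem _ hy'.1 _ hy'.2)).2.2.1
    simpa [Function.uncurry, h.l1] using this
  · ext y'
    constructor
    · rintro ⟨v, hv, rfl⟩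
      have h1 := (hev2 _ hv).1
      have h2 := hev' _ (hmem _ hv _ h1.2.2)
      refine ⟨(h2.2.1 h1.2.1).2 (by show Ψ _ _ ∈ Y; rw [h.l1]; exact hyY), ?_⟩
      simp only [mem_setOf_eq, h.l2, h.l3]
      exact ⟨hv, h1.2.2⟩
    · rintro ⟨hy1, hy2, hy3⟩
      have h2 := hev' _ (hmem _ hy2 _ hy3)
      have h3 : y' ∈ Pd π w ρ r := by simpa [Function.uncurry, h.l1] using h2.2.2.2
      have h4 := h2.1 (hY _ h3 hy1)
      refine ⟨e (π y'), by simpa using hy2, ?_⟩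
      simp only [ContinuousLinearEquiv.symm_apply_apply]
      rw [← h4, h.l1]

lemma NEWCO (h : Co π w Ψ q) (hρ : 0 < ρ) (hg : DifferentiableOn ℂ g (ball 0 ρ)) (hD : Dn (ball 0 ρ) g) (hg0 : g 0 = 0) {Y : Set E}
    {p : Fin l → B → ℂ → ℂ} (hp : ∀ j, GoodP (p j)) (hpY : ∀ᶠ y in 𝓝 q, y ∈ Y → ∀ j, p j (π y) (w y j) = 0) :
    ∃ (B' : Submodule ℂ B) (π' : E → B') (w' : E → Fin (l+1) → ℂ) (Ψ' : B' → (Fin (l+1) → ℂ) → E) (p' : Fin (l+1) → B' → ℂ → ℂ),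
      Module.finrank ℂ B' < Module.finrank ℂ B ∧ Co π' w' Ψ' q ∧ (∀ j, GoodP (p' j)) ∧
      ∀ᶠ y in 𝓝 q, y ∈ Y ∩ {y | g (π y) = 0} → ∀ j, p' j (π' y) (w' y j) = 0 := by
  obtain ⟨e, ρ', hρ', hdir⟩ := exists_dir isOpen_ball hg hD (mem_ball_self hρ)
  simp only [zero_add] at hdir
  have he : e ≠ 0 := by
    rintro rfl
    refine (hdir (ρ':ℂ) (by simp [abs_of_pos hρ'])).2 (by simpa using hρ'.ne') ?_
    simpa using hg0
  obtain ⟨f, hf⟩ := SeparatingDual.exists_eq_one (R := ℂ) he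
  let K : Submodule ℂ B := LinearMap.ker (f : B →ₗ[ℂ] ℂ)
  have hK : ∀ z : K, f z = 0 := fun z => z.2
  let L0 : B →L[ℂ] B := ContinuousLinearMap.id ℂ B - f.smulRight e
  have hL0 : ∀ b, L0 b = b - f b • e := fun b => by simp [L0]
  let L : B →L[ℂ] K := L0.codRestrict K fun b => by
    show f (L0 b) = 0
    rw [hL0]; simp [hf]
  have hL : ∀ b, (L b : B) = b - f b • e := hL0
  have hLT : ∀ b, (L b : B) + f b • e = b := fun b => by rw [hL]; simp
  have hfT : ∀ (z : K) (t : ℂ), f ((z:B) + t • e) = t := fun z t => by simp [hK, hf]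
  have hLz : ∀ (z : K) (t : ℂ), L ((z:B) + t • e) = z := fun z t => by
    apply Subtype.ext
    rw [hL, hfT]; simp
  have hTd : Differentiable ℂ (fun a : K × ℂ => (a.1 : B) + a.2 • e) := by
    have h1 : Differentiable ℂ (fun a : K × ℂ => (a.1 : B)) := (K.subtypeL.comp (ContinuousLinearMap.fst ℂ K ℂ)).differentiable
    fun_prop
  have hT0 : Tendsto (fun a : K × ℂ => (a.1 : B) + a.2 • e) (𝓝 0) (𝓝 0) := by simpa using hTd.continuous.tendsto 0
  have hG0 : GoodP (fun (z : K) t => g ((z:B) + t • e)) := by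
    constructor
    · filter_upwards [hT0.eventually (ball_mem_nhds 0 hρ)] with a ha
      exact DifferentiableAt.comp (g := g) (f := fun a : K × ℂ => (a.1 : B) + a.2 • e) a (hg.differentiableAt (isOpen_ball.mem_nhds ha)) (hTd a)
    · have h1 : ∃ᶠ t in 𝓝[≠] (0:ℂ), True := frequently_true_iff_neBot _ |>.2 inferInstance
      have h2 : ∃ᶠ t in 𝓝 (0:ℂ), t ≠ 0 := by
        have := frequently_nhdsWithin_iff.1 h1
        simpa using this
      refine (h2.and_eventually (ball_mem_nhds (0:ℂ) hρ')).mono fun t ht => ?_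
      have := (hdir t (by simpa using (mem_ball_zero_iff.1 ht.2).le)).2 ht.1
      simpa using this
  have hG1 : ∀ j, GoodP (fun (a : K × ℂ) t => p j ((a.1:B) + a.2 • e) t) := fun j => by
    constructor
    · have hTd' : Differentiable ℂ (fun a : (K × ℂ) × ℂ => ((a.1.1 : B) + a.1.2 • e, a.2)) := (hTd.comp differentiable_fst).prodMk differentiable_snd
      have ht : Tendsto (fun a : (K × ℂ) × ℂ => ((a.1.1 : B) + a.1.2 • e, a.2)) (𝓝 0) (𝓝 0) := by simpa [← Prod.zero_eq_mk] using hTd'.continuous.tendsto 0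
      filter_upwards [ht.eventually (hp j).1] with a ha
      exact DifferentiableAt.comp (g := Function.uncurry (p j)) (f := fun a : (K × ℂ) × ℂ => ((a.1.1 : B) + a.1.2 • e, a.2)) a ha (hTd' a)
    · refine (hp j).2.mono fun t ht => ?_
      simpa using ht
  choose N hN1 hN2 using fun j => ELIM hG0 (hG1 j)
  refine ⟨K, fun y => L (π y), fun y => Fin.cons (f (π y)) (w y), fun z x => Ψ ((z:B) + x 0 • e) (fun j => x j.succ),
    Fin.cons (fun z t => g ((z:B) + t • e)) N, ?_, ⟨?_, ?_, ?_, ?_, ?_, ?_, ?_, ?_⟩, ?_, ?_⟩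
  · refine Submodule.finrank_lt fun hK' => ?_
    have : e ∈ K := hK' ▸ Submodule.mem_top
    have h2 : f e = 0 := this
    rw [hf] at h2; exact one_ne_zero h2
  · exact L.differentiable.comp h.dπ
  · refine differentiable_pi.2 (Fin.cases ?_ fun j => ?_)
    · simpa [Function.comp_def] using f.differentiable.comp h.dπ
    · simpa using differentiable_pi.1 h.dw j
  · have : Differentiable ℂ (fun a : K × (Fin (l+1) → ℂ) => ((a.1:B) + a.2 0 • e, fun j : Fin l => a.2 j.succ)) := by
      refine Differentiable.prodMk (hTd.comp (g := fun a : K × ℂ => (a.1 : B) + a.2 • e) (f := fun a : K × (Fin (l+1) → ℂ) => (a.1, a.2 0)) (by fun_prop)) (by fun_prop)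
    exact h.dΨ.comp this
  · intro y
    simp only [Fin.cons_zero, Fin.cons_succ, hLT]
    exact h.l1 y
  · intro z x
    rw [h.l2, hLz]
  · intro z x
    rw [h.l2, h.l3, hfT]
    exact Fin.cons_self_tail x
  · rw [h.q0, map_zero]
  · rw [h.q0, h.q1, map_zero]
    funext j
    refine Fin.cases ?_ (fun j => ?_) j <;> simp
  · refine Fin.cases ?_ fun j => ?_
    · exact hG0
    · exact hN1 j
  · have ht : ∀ j, Tendsto (fun y => ((L (π y), f (π y)), w y j)) (𝓝 q) (𝓝 (0 : (K × ℂ) × ℂ)) := fun j => by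
      have hc : Continuous (fun y => ((L (π y), f (π y)), w y j)) := by
        have h1 := h.dπ.continuous
        have h2 := (continuous_apply j).comp h.dw.continuous
        exact ((L.continuous.comp h1).prodMk (f.continuous.comp h1)).prodMk h2
      have := hc.tendsto q
      simpa [h.q0, h.q1, ← Prod.zero_eq_mk] using this
    filter_upwards [hpY, eventually_all.2 fun j => (ht j).eventually (hN2 j)] with y h1 h2 ⟨hy, hgy⟩
    have hgy : g (π y) = 0 := hgy
    refine Fin.cases ?_ fun j => ?_
    · simpa [hLT] using hgy
    · have := h2 j
      simp only [hLT] at this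
      simpa using this hgy (h1 hy j)
end STEP
end

section
universe u
section LS
variable {E : Type*} [NormedAddCommGroup E] [NormedSpace ℂ E] [FiniteDimensional ℂ E] [CompleteSpace E]

structure RHyp (Y A N0 R : Set E) : Prop where
  h0 : ∀ y ∈ R, y ∈ N0 → y ∈ Y ∧ y ∉ A
  h1 : ∀ y ∈ R, y ∈ N0 → ∀ᶠ y' in 𝓝[Y] y, y' ∈ R
  h2 : ∀ p ∈ N0, p ∈ Y → p ∉ A → Patch Y p → p ∉ R → ∀ᶠ y' in 𝓝[Y] p, y' ∉ R

def Peak (R : Set E) (q : E) : Prop := ∀ N, IsOpen N → q ∈ N → ∃ K, IsCompact K ∧ K ⊆ R ∩ N ∧ ∀ v : E → ℝ, ContinuousOn v N → RP v N → ∃ x ∈ K, v q ≤ v x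

def LSC (Y A N0 : Set E) (q : E) : Prop := (q ∈ Y → q ∈ closure {y | y ∈ Y ∧ Patch Y y}) ∧
  ∀ R, RHyp Y A N0 R → (∃ N, IsOpen N ∧ q ∈ N ∧ AnOn (closure R) N) ∧ (q ∈ closure R → Peak R q)

lemma LSC.triv {Y A N0 : Set E} {q : E} (hN : N0 ∈ 𝓝 q) (h : ∀ᶠ y in 𝓝 q, y ∉ Y) : LSC Y A N0 q := by
  refine ⟨fun hq => absurd hq h.self_of_nhds, fun R hR => ?_⟩
  have h1 : ∀ᶠ y in 𝓝 q, y ∉ R := by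
    filter_upwards [h, hN] with y h1 h2 h3
    exact h1 (hR.h0 y h3 h2).1
  obtain ⟨N, h2, h3, h4⟩ := _root_.eventually_nhds_iff.1 h1
  have h5 : ∀ y ∈ N, y ∉ closure R := fun y hy hc => by
    obtain ⟨y', h6, h7⟩ := mem_closure_iff.1 hc N h3 hy
    exact h2 y' h6 h7
  exact ⟨⟨N, h3, h4, AnOn.empty.congr fun y hy => by simp [h5 y hy]⟩, fun hc => absurd hc (h5 q h4)⟩

variable {B : Type*} [NormedAddCommGroup B] [NormedSpace ℂ B] [FiniteDimensional ℂ B] {l : ℕ}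
variable {π : E → B} {w : E → Fin l → ℂ} {Ψ : B → (Fin l → ℂ) → E} {q : E} {g : B → ℂ} {ρ r : ℝ} {D : ℕ} {S : B → Finset (Fin l → ℂ)}

lemma LSC.step (h : Co π w Ψ q) {N0 Y A Y0 : Set E} (hPN : Pd π w ρ r ⊆ N0) (hS : Fam g ρ r D S) (hYS : ∀ y ∈ Pd π w ρ r, y ∈ Y → w y ∈ S (π y))
    (hLY : LC (ball 0 ρ) g S (fun z x => Ψ z x ∈ Y)) (hLA : LC (ball 0 ρ) g S (fun z x => Ψ z x ∈ A))
    (hY0 : Y0 = {y | y ∈ Pd π w ρ r ∧ y ∈ Y ∧ g (π y) ≠ 0})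
    (hI : LSC (Y ∩ {y | g (π y) = 0}) (A ∪ closure Y0) (Pd π w ρ r) q) : LSC Y A N0 q := by
  classical
  set P := Pd π w ρ r with hP
  have hPo : IsOpen P := h.Pd_open
  have hqP : q ∈ P := h.q_mem hS.ρp hS.rp
  have hpatch : ∀ y ∈ Y0, Patch Y y := by
    rw [hY0]; rintro y ⟨h1, h2, h3⟩
    exact patch_of h hS hYS hLY h1 h2 h3
  have hloc : ∀ y ∈ P, y ∉ closure Y0 → ∀ᶠ y' in 𝓝 y, y' ∈ Y ∩ {y | g (π y) = 0} ↔ y' ∈ Y := by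
    intro y hy hyc
    filter_upwards [hPo.mem_nhds hy, isClosed_closure.isOpen_compl.mem_nhds hyc] with y' h1 h2
    refine ⟨fun h => h.1, fun h3 => ⟨h3, ?_⟩⟩
    by_contra h4
    exact h2 (subset_closure (by rw [hY0]; exact ⟨h1, h3, h4⟩))
  refine ⟨fun hqY => ?_, fun R hR => ?_⟩
  · by_cases hc : q ∈ closure Y0
    · have hs : Y0 ⊆ {y | y ∈ Y ∧ Patch Y y} := fun y hy => ⟨by rw [hY0] at hy; exact hy.2.1, hpatch y hy⟩
      exact closure_mono hs hc
    · have h1 := hI.1 ((hloc q hqP hc).self_of_nhds.2 hqY)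
      rw [mem_closure_iff_frequently] at h1 ⊢
      refine (h1.and_eventually ((hPo.eventually_mem hqP).and (isClosed_closure.isOpen_compl.eventually_mem hc))).mono ?_
      rintro y ⟨⟨h2, h3⟩, h4, h5⟩
      exact ⟨h2.1, h3.congr (hloc y h4 h5)⟩
  · have hRS : ∀ y ∈ P, y ∈ R → w y ∈ S (π y) := fun y hy hyR => hYS y hy (hR.h0 y hyR (hPN hy)).1
    have hΨP : ∀ z ∈ ball (0:B) ρ, ∀ x ∈ S z, Ψ z x ∈ P := fun z hz x hx => by
      simp only [hP, Pd, mem_setOf_eq, h.l2, h.l3]; exact ⟨hz, hS.bd z hz x hx⟩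
    have hLR : LC (ball 0 ρ) g S (fun z x => Ψ z x ∈ R) := by
      intro z0 hz0 hg x hx
      have hy0 := hΨP z0 hz0 x hx
      have hΨt : Tendsto (Function.uncurry Ψ) (𝓝 (z0, x)) (𝓝 (Ψ z0 x)) := h.dΨ.continuous.tendsto (z0, x)
      have hevN : ∀ᶠ p : B × (Fin l → ℂ) in 𝓝 (z0, x), Ψ p.1 p.2 ∈ N0 := (hΨt.eventually (hPo.mem_nhds hy0)).mono fun p hp => hPN hp
      have hevY := hLY z0 hz0 hg x hx
      by_cases h1 : Ψ z0 x ∈ R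
      · have h2 := hR.h0 _ h1 (hPN hy0)
        have h3 := hR.h1 _ h1 (hPN hy0)
        rw [eventually_nhdsWithin_iff] at h3
        filter_upwards [hevY, hΨt.eventually h3] with p h4 h5 h6
        exact ⟨fun _ => h1, fun _ => h5 ((h4 h6).2 h2.1)⟩
      · by_cases h2 : Ψ z0 x ∈ Y
        · by_cases h3 : Ψ z0 x ∈ A
          · filter_upwards [hLA z0 hz0 hg x hx, hevN] with p h4 h5 h6
            exact ⟨fun h7 => absurd ((h4 h6).2 h3) (hR.h0 _ h7 h5).2, fun h7 => absurd h7 h1⟩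
          · have h4 := hR.h2 _ (hPN hy0) h2 h3 (hpatch _ (by rw [hY0]; exact ⟨hy0, h2, by rwa [h.l2]⟩)) h1
            rw [eventually_nhdsWithin_iff] at h4
            filter_upwards [hevN, hΨt.eventually h4] with p h5 h6 h7
            exact ⟨fun h8 => absurd h8 (h6 (hR.h0 _ h8 h5).1), fun h8 => absurd h8 h1⟩
        · filter_upwards [hevY, hevN] with p h4 h5 h6
          exact ⟨fun h7 => absurd ((h4 h6).1 (hR.h0 _ h7 h5).1) h2, fun h7 => absurd h7 h1⟩
    have hFR := hS.filter hLR
    have hMs := Ms_filter h hS hRS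
    set MR := {y | y ∈ P ∧ y ∈ R ∧ g (π y) ≠ 0} with hMR
    have hCL := CL h hFR
    rw [hMs] at hCL
    set R2 := R ∩ (P ∩ (closure Y0)ᶜ) with hR2
    have hMRR : MR ⊆ R := fun y hy => hy.2.1
    have hcl : ∀ y ∈ P, y ∈ closure R → y ∈ closure MR ∪ closure R2 := by
      have hsub : R ∩ P ⊆ closure MR ∪ R2 := by
        rintro y ⟨h1, h2⟩
        by_cases h3 : y ∈ closure Y0
        · left
          have h4 := hR.h1 y h1 (hPN h2)
          rw [eventually_nhdsWithin_iff] at h4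
          rw [mem_closure_iff_frequently] at h3 ⊢
          refine (h3.and_eventually h4).mono ?_
          rintro y' ⟨h5, h6⟩
          rw [hY0] at h5
          exact ⟨h5.1, h6 h5.2.1, h5.2.2⟩
        · exact Or.inr ⟨h1, h2, h3⟩
      intro y hy hyc
      have h1 : y ∈ closure (R ∩ P) := by
        rw [mem_closure_iff_frequently] at hyc ⊢
        exact hyc.and_eventually (hPo.mem_nhds hy)
      have h2 := closure_mono hsub h1
      rwa [closure_union, closure_closure] at h2
    have hIR := hI.2 R2 ⟨?_, ?_, ?_⟩
    · obtain ⟨⟨N, hNo, hqN, hAN⟩, hpk⟩ := hIR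
      refine ⟨⟨N ∩ P, hNo.inter hPo, ⟨hqN, hqP⟩, ((hCL.mono inter_subset_right).union (hAN.mono inter_subset_left)).congr fun y hy => ⟨hcl y hy.2, ?_⟩⟩, fun hq => ?_⟩
      · rintro (h1 | h1)
        · exact closure_mono hMRR h1
        · exact closure_mono inter_subset_left h1
      · rcases hcl q hqP hq with h1 | h1
        · intro N hN hqN
          obtain ⟨K, h2, h3, h4⟩ := AP h hFR (by rw [hMs]; exact closure_nonempty_iff.1 ⟨q, h1⟩) hN hqN
          rw [hMs] at h3
          exact ⟨K, h2, fun y hy => ⟨hMRR (h3 hy).1, (h3 hy).2⟩, h4⟩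
        · intro N hN hqN
          obtain ⟨K, h2, h3, h4⟩ := hpk h1 N hN hqN
          exact ⟨K, h2, fun y hy => ⟨(h3 hy).1.1, (h3 hy).2⟩, h4⟩
    · rintro y ⟨h1, h2, h3⟩ -
      have h4 := hR.h0 y h1 (hPN h2)
      exact ⟨(hloc y h2 h3).self_of_nhds.2 h4.1, fun h5 => h5.elim h4.2 h3⟩
    · rintro y ⟨h1, h2, h3⟩ -
      have h4 := nhdsWithin_mono y (inter_subset_left : Y ∩ {y | g (π y) = 0} ⊆ Y) (hR.h1 y h1 (hPN h2))
      filter_upwards [h4, nhdsWithin_le_nhds ((hPo.inter isClosed_closure.isOpen_compl).mem_nhds (show y ∈ P ∩ (closure Y0)ᶜ from ⟨h2, h3⟩))] with y' h5 h6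
      exact ⟨h5, h6⟩
    · intro p h1 h2 h3 h4 h5
      have h6 : p ∉ closure Y0 := fun h => h3 (Or.inr h)
      have h7 := hR.h2 p (hPN h1) h2.1 (fun h => h3 (Or.inl h)) (h4.congr (hloc p h1 h6)) (fun h => h5 ⟨h, h1, h6⟩)
      filter_upwards [nhdsWithin_mono p (inter_subset_left : Y ∩ {y | g (π y) = 0} ⊆ Y) h7] with y' h8 h9
      exact h8 h9.1

lemma LS_aux (k : ℕ) : ∀ {B : Type u} [NormedAddCommGroup B] [NormedSpace ℂ B] [FiniteDimensional ℂ B] {l : ℕ}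
    {π : E → B} {w : E → Fin l → ℂ} {Ψ : B → (Fin l → ℂ) → E} {q : E}, Module.finrank ℂ B < k → Co π w Ψ q → ∀ {N0 Y A : Set E}, IsOpen N0 → q ∈ N0 →
    AnOn Y N0 → AnOn A N0 → ∀ {p : Fin l → B → ℂ → ℂ}, (∀ j, GoodP (p j)) → (∀ᶠ y in 𝓝 q, y ∈ Y → ∀ j, p j (π y) (w y j) = 0) → LSC Y A N0 q := by
  classical
  induction k with
  | zero => intro B _ _ _ l π w Ψ q hk; omega
  | succ k ih =>
    intro B _ _ _ l π w Ψ q hk h N0 Y A hN hq hY hA p hp hpY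
    obtain ⟨ρ, r, D, g, S, hPN, hS, hYS, hLY, hLA⟩ := STEP h (hN.mem_nhds hq) hY hA hN hp hpY
    refine LSC.step h hPN hS hYS hLY hLA rfl ?_
    have hPo : IsOpen (Pd π w ρ r) := h.Pd_open
    have hqP := h.q_mem hS.ρp hS.rp
    have hgd : DifferentiableOn ℂ (fun y => g (π y)) (Pd π w ρ r) := hS.gd.comp h.dπ.differentiableOn fun y hy => hy.1
    by_cases hg0 : g 0 = 0
    · obtain ⟨B', π', w', Ψ', p', hfr, hco, hp', hpY'⟩ := NEWCO h hS.ρp hS.gd hS.gD hg0 hp hpY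
      have hcl := CL h (hS.filter hLY)
      rw [Ms_filter h hS hYS] at hcl
      exact ih (by omega) hco hPo hqP ((hY.mono hPN).inter (.single hgd)) ((hA.mono hPN).union hcl) hp' hpY'
    · refine LSC.triv (hPo.mem_nhds hqP) ?_
      have : ContinuousAt (fun y => g (π y)) q := hgd.continuousOn.continuousAt (hPo.mem_nhds hqP)
      filter_upwards [this.eventually_ne (by simpa [h.q0] using hg0)] with y h1 h2
      exact h1 h2.2

lemma LS {N0 Y A : Set E} {q : E} (hN : IsOpen N0) (hq : q ∈ N0) (hY : AnOn Y N0) (hA : AnOn A N0) : LSC Y A N0 q := by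
  refine LS_aux (Module.finrank ℂ E + 1) (B := E) (l := 0) (π := fun y => y - q) (w := fun _ => 0) (Ψ := fun z _ => z + q) (by omega)
    ⟨by fun_prop, by fun_prop, ?_, by simp, by simp, fun z x => Subsingleton.elim _ _, by simp, rfl⟩ hN hq hY hA (p := fun j => j.elim0) (fun j => j.elim0)
    (by simp)
  show Differentiable ℂ (fun a : E × (Fin 0 → ℂ) => a.1 + q)
  fun_prop
end LS
end

section
section GLB
variable {X : Type*} [TopologicalSpace X]

lemma chart_nb {c : CChart X} {x : X} (hx : x ∈ c.U) {O : Set X} (hO : O ∈ 𝓝 x) :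
    ∃ V, IsOpen V ∧ c.φ x ∈ V ∧ ∀ y ∈ c.U, c.φ y ∈ V → y ∈ O := by
  obtain ⟨O1, h1, h2, h3⟩ := _root_.mem_nhds_iff.1 hO
  obtain ⟨V, hV, he⟩ := c.open_image (O1 ∩ c.U) inter_subset_right (h2.inter c.openU)
  have h4 : c.φ x ∈ c.B ∩ V := he ▸ mem_image_of_mem _ ⟨h3, hx⟩
  refine ⟨V, hV, h4.2, fun y hy hyV => ?_⟩
  have h5 : c.φ y ∈ c.φ '' (O1 ∩ c.U) := he ▸ ⟨c.mapsToB y hy, hyV⟩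
  obtain ⟨z, hz, hzy⟩ := h5
  exact c.injOn hz.2 hy hzy ▸ h1 hz.1

lemma chart_open (c : CChart X) {V : Set c.E} (hV : IsOpen V) : IsOpen {y | y ∈ c.U ∧ c.φ y ∈ V} :=
  c.contOn.isOpen_inter_preimage c.openU hV

lemma chart_closure {c : CChart X} {x : X} (hx : x ∈ c.U) {R : Set X} :
    x ∈ closure R ↔ c.φ x ∈ closure (c.φ '' (R ∩ c.U)) := by
  rw [_root_.mem_closure_iff, _root_.mem_closure_iff]
  constructor
  · intro h V hV hxV
    obtain ⟨y, h1, h2⟩ := h _ (chart_open c hV) ⟨hx, hxV⟩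
    exact ⟨c.φ y, h1.2, mem_image_of_mem _ ⟨h2, h1.1⟩⟩
  · intro h O hO hxO
    obtain ⟨V, hV, hxV, h1⟩ := chart_nb hx (hO.mem_nhds hxO)
    obtain ⟨_, h2, y, h3, rfl⟩ := h V hV hxV
    exact ⟨y, h1 y h3.2 h2, h3.1⟩

lemma chart_ev {c : CChart X} {x : X} (hx : x ∈ c.U) {O : Set X} (hO : O ∈ 𝓝 x) :
    ∀ᶠ y in 𝓝[c.B] (c.φ x), y ∈ c.φ '' (O ∩ c.U) := by
  obtain ⟨V, hV, hxV, h1⟩ := chart_nb hx hO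
  filter_upwards [self_mem_nhdsWithin, mem_nhdsWithin_of_mem_nhds (hV.mem_nhds hxV)] with y h2 h3
  rw [← c.image_eq] at h2
  obtain ⟨z, hz, rfl⟩ := h2
  exact ⟨z, ⟨h1 z hz h3, hz⟩, rfl⟩

def Nice (S : CSpace X) (U : Set X) : Prop := IsOpen U ∧ ∃ c ∈ S.atlas, U ⊆ c.U ∧ ∃ (n : ℕ) (Ω : Set (Fin n → ℂ)) (θ : (Fin n → ℂ) → X),
  IsOpen Ω ∧ Convex ℝ Ω ∧ ContinuousOn θ Ω ∧ DifferentiableOn ℂ (fun v => c.φ (θ v)) Ω ∧ θ '' Ω = U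

lemma nice_of_patch {S : CSpace X} {c : CChart X} (hc : c ∈ S.atlas) {x : X} (hx : x ∈ c.U) (hp : Patch c.B (c.φ x)) :
    ∃ U, Nice S U ∧ x ∈ U := by
  haveI : Nonempty X := ⟨x⟩
  obtain ⟨n, Ω, θ, O', hΩ, hcv, hθ, hO', hxO', -, him⟩ := hp univ univ_mem
  set T : (Fin n → ℂ) → X := fun v => Function.invFunOn c.φ c.U (θ v) with hT
  have h1 : ∀ v ∈ Ω, T v ∈ c.U ∧ c.φ (T v) = θ v ∧ θ v ∈ O' := by
    intro v hv
    have h2 : θ v ∈ c.B ∩ O' := him ▸ mem_image_of_mem _ hv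
    have h3 : θ v ∈ c.φ '' c.U := c.image_eq ▸ h2.1
    exact ⟨Function.invFunOn_mem h3, Function.invFunOn_eq h3, h2.2⟩
  have h4 : T '' Ω = {y | y ∈ c.U ∧ c.φ y ∈ O'} := by
    ext y
    constructor
    · rintro ⟨v, hv, rfl⟩
      exact ⟨(h1 v hv).1, (h1 v hv).2.1 ▸ (h1 v hv).2.2⟩
    · rintro ⟨h2, h3⟩
      have : c.φ y ∈ θ '' Ω := him ▸ ⟨c.mapsToB y h2, h3⟩
      obtain ⟨v, hv, he⟩ := this
      exact ⟨v, hv, c.injOn (h1 v hv).1 h2 ((h1 v hv).2.1.trans he)⟩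
  refine ⟨T '' Ω, ⟨h4 ▸ chart_open c hO', c, hc, fun y hy => (h4 ▸ hy : y ∈ {y | y ∈ c.U ∧ c.φ y ∈ O'}).1, n, Ω, T, hΩ, hcv, ?_, ?_, rfl⟩, h4 ▸ ⟨hx, hxO'⟩⟩
  · intro v hv
    refine fun O hO => mem_map.2 ?_
    obtain ⟨V, hV, hxV, h5⟩ := chart_nb (h1 v hv).1 hO
    rw [(h1 v hv).2.1] at hxV
    have h6 := hθ.continuousOn v hv (hV.mem_nhds hxV)
    filter_upwards [h6, self_mem_nhdsWithin] with v' h7 h8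
    refine h5 _ (h1 v' h8).1 ?_
    rw [(h1 v' h8).2.1]; exact h7
  · exact hθ.congr fun v hv => (h1 v hv).2.1

def RegS (S : CSpace X) : Set X := {x | ∃ U, Nice S U ∧ x ∈ U}

lemma RegS.isOpen (S : CSpace X) : IsOpen (RegS S) := by
  rw [isOpen_iff_mem_nhds]
  rintro x ⟨U, hU, hx⟩
  filter_upwards [hU.1.mem_nhds hx] with y hy using ⟨U, hU, hy⟩

lemma chart_AnOn {c : CChart X} {x : X} (hx : x ∈ c.U) : ∃ W, IsOpen W ∧ c.φ x ∈ W ∧ W ⊆ c.V ∧ AnOn c.B W := by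
  obtain ⟨W, hW, hxW, hWV, m, F, hF, hBW⟩ := c.subvariety.2.2 (c.φ x) (c.subvariety.2.1 (c.mapsToB x hx))
  refine ⟨W, hW, hxW, hWV, m, F, hF, fun y hy => ?_⟩
  have := Set.ext_iff.1 hBW y
  simpa [hy] using this

lemma RegS.dense (S : CSpace X) (x : X) : x ∈ closure (RegS S) := by
  obtain ⟨c, hc, hx⟩ := S.chart_cover x
  obtain ⟨W, hW, hxW, hWV, hA⟩ := chart_AnOn hx
  have h := (LS hW hxW hA (AnOn.empty)).1 (c.mapsToB x hx)
  rw [chart_closure hx]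
  refine closure_mono ?_ h
  rintro y ⟨h1, h2⟩
  rw [← c.image_eq] at h1
  obtain ⟨z, hz, rfl⟩ := h1
  exact ⟨z, ⟨nice_of_patch hc hz h2, hz⟩, rfl⟩

lemma clos_props {S : CSpace X} {R : Set X} (hR : IsOpen R) (hR' : IsOpen (RegS S \ R)) :
    IsAnalyticIn S (closure R) univ ∧ ∀ c ∈ S.atlas, ∀ x ∈ c.U, x ∈ closure R → Peak (c.φ '' (R ∩ c.U)) (c.φ x) := by
  have key : ∀ c ∈ S.atlas, ∀ x ∈ c.U, ∃ W, IsOpen W ∧ c.φ x ∈ W ∧ W ⊆ c.V ∧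
      (∃ N, IsOpen N ∧ c.φ x ∈ N ∧ AnOn (closure (c.φ '' (R ∩ c.U))) N) ∧ (c.φ x ∈ closure (c.φ '' (R ∩ c.U)) → Peak (c.φ '' (R ∩ c.U)) (c.φ x)) := by
    intro c hc x hx
    obtain ⟨W, hW, hxW, hWV, hA⟩ := chart_AnOn hx
    refine ⟨W, hW, hxW, hWV, (LS hW hxW hA (AnOn.empty)).2 _ ⟨?_, ?_, ?_⟩⟩
    · rintro _ ⟨y, hy, rfl⟩ -
      exact ⟨c.mapsToB y hy.2, fun h => h⟩
    · rintro _ ⟨y, hy, rfl⟩ -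
      exact chart_ev hy.2 (hR.mem_nhds hy.1)
    · intro p _ h1 _ h2 h3
      rw [← c.image_eq] at h1
      obtain ⟨y, hy, rfl⟩ := h1
      have h4 : y ∈ RegS S \ R := ⟨nice_of_patch hc hy h2, fun h => h3 ⟨y, ⟨h, hy⟩, rfl⟩⟩
      filter_upwards [chart_ev hy (hR'.mem_nhds h4)] with y' h5 h6
      obtain ⟨a, ha, rfl⟩ := h5
      obtain ⟨b, hb, he⟩ := h6
      exact ha.1.2 (c.injOn hb.2 ha.2 he ▸ hb.1)
  refine ⟨⟨subset_univ _, fun x _ => ?_⟩, fun c hc x hx h => ?_⟩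
  · obtain ⟨c, hc, hx⟩ := S.chart_cover x
    obtain ⟨W, hW, hxW, hWV, ⟨N, hN, hxN, m, F, hF, hN2⟩, -⟩ := key c hc x hx
    refine ⟨c, hc, hx, W ∩ N, hW.inter hN, fun y hy => hWV hy.1, ⟨hxW, hxN⟩, m, F, fun i => (hF i).mono inter_subset_right, fun y hy h1 _ => ?_⟩
    rw [chart_closure hy]
    exact hN2 _ h1.2
  · obtain ⟨W, hW, hxW, hWV, -, h2⟩ := key c hc x hx
    exact h2 ((chart_closure hx).1 h)

lemma analytic_closed {S : CSpace X} {A : Set X} (hA : IsAnalyticIn S A univ) : IsClosed A := by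
  rw [← isOpen_compl_iff, isOpen_iff_mem_nhds]
  intro x hx
  obtain ⟨c, hc, hxc, V, hV, -, hxV, m, F, hF, h⟩ := hA.2 x (mem_univ _)
  have h1 : ∃ i, F i (c.φ x) ≠ 0 := by
    by_contra h2
    push Not at h2
    exact hx ((h x hxc hxV (mem_univ _)).2 h2)
  obtain ⟨i, hi⟩ := h1
  have h2 : ContinuousAt (fun y => F i (c.φ y)) x :=
    ContinuousAt.comp (f := c.φ) ((hF i).continuousOn.continuousAt (hV.mem_nhds hxV)) (c.contOn.continuousAt (c.openU.mem_nhds hxc))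
  filter_upwards [h2.eventually_ne hi, (chart_open c hV).mem_nhds ⟨hxc, hxV⟩] with y h3 h4 h5
  exact h3 ((h y h4.1 h4.2 (mem_univ _)).1 h5 i)

lemma nice_prop {n : ℕ} {Ω : Set (Fin n → ℂ)} (hΩ : IsOpen Ω) (hcv : Convex ℝ Ω) {P : (Fin n → ℂ) → Prop} {v1 : Fin n → ℂ} (hv1 : v1 ∈ Ω)
    (h1 : ∀ᶠ v in 𝓝 v1, P v) (hstep : ∀ v0 ∈ Ω, ∃ ε > 0, ∀ v2 ∈ ball v0 ε, v2 ∈ Ω → (∀ᶠ v in 𝓝 v2, P v) → ∀ᶠ v in 𝓝 v0, P v) : ∀ v ∈ Ω, P v := by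
  have h2 : IsOpen {v2 | ∀ᶠ v in 𝓝 v2, P v} := isOpen_setOf_eventually_nhds
  have h3 : Ω ⊆ {v2 | ∀ᶠ v in 𝓝 v2, P v} := by
    refine hcv.isPreconnected.subset_of_closure_inter_subset h2 ⟨v1, hv1, h1⟩ ?_
    rintro v0 ⟨h4, h5⟩
    obtain ⟨ε, hε, h6⟩ := hstep v0 h5
    obtain ⟨v2, h7, h8⟩ := mem_closure_iff.1 h4 (ball v0 ε ∩ Ω) (isOpen_ball.inter hΩ) ⟨mem_ball_self hε, h5⟩
    exact h6 v2 h7.1 h7.2 h8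
  exact fun v hv => (h3 hv).self_of_nhds

lemma nice_ident {S : CSpace X} {A U O : Set X} (hA : IsAnalyticIn S A univ) (hU : Nice S U) (hO : IsOpen O) (hne : (O ∩ U).Nonempty) (hOA : O ∩ U ⊆ A) : U ⊆ A := by
  obtain ⟨hUo, c, hc, hUc, n, Ω, θ, hΩ, hcv, hθ, hθd, him⟩ := hU
  obtain ⟨x1, h1, h2⟩ := hne
  have h2' := h2
  rw [← him] at h2'
  obtain ⟨v1, hv1, rfl⟩ := h2'
  have hθU : ∀ v ∈ Ω, θ v ∈ U := fun v hv => him ▸ mem_image_of_mem _ hv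
  have hca : ∀ v ∈ Ω, ContinuousAt θ v := fun v hv => hθ.continuousAt (hΩ.mem_nhds hv)
  have key : ∀ v ∈ Ω, θ v ∈ A := by
    refine nice_prop hΩ hcv hv1 (P := fun v => θ v ∈ A) ?_ ?_
    · filter_upwards [(hca v1 hv1).eventually_mem ((hO.inter hUo).mem_nhds ⟨h1, h2⟩)] with v hv using hOA hv
    · intro v0 hv0
      obtain ⟨d, hd, hxd, V, hV, -, hxV, m, F, hF, h⟩ := hA.2 (θ v0) (mem_univ _)
      obtain ⟨W, hW, hxW, G, hG, hGe⟩ := S.compat c hc d hd (θ v0) ⟨hUc (hθU v0 hv0), hxd⟩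
      have h3 : ∀ᶠ v in 𝓝 v0, v ∈ Ω ∧ θ v ∈ d.U ∧ d.φ (θ v) ∈ V ∧ c.φ (θ v) ∈ W := by
        filter_upwards [hΩ.mem_nhds hv0, (hca v0 hv0).eventually_mem ((chart_open d hV).mem_nhds ⟨hxd, hxV⟩),
          (hca v0 hv0).eventually_mem ((chart_open c hW).mem_nhds ⟨hUc (hθU v0 hv0), hxW⟩)] with v h4 h5 h6
        exact ⟨h4, h5.1, h5.2, h6.2⟩
      obtain ⟨ε, hε, h4⟩ := Metric.eventually_nhds_iff_ball.1 h3
      refine ⟨ε, hε, fun v2 hv2 _ hP => ?_⟩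
      have h5 : ∀ v ∈ ball v0 ε, G (c.φ (θ v)) = d.φ (θ v) := fun v hv => hGe _ ⟨hUc (hθU v (h4 v hv).1), (h4 v hv).2.1⟩ (h4 v hv).2.2.2
      have h6 : ∀ i, ∀ v ∈ ball v0 ε, F i (G (c.φ (θ v))) = 0 := by
        intro i
        refine ident_conv isOpen_ball (convex_ball _ _) ?_ hv2 ?_
        · refine (hF i).comp (hG.comp (hθd.mono fun v hv => (h4 v hv).1) fun v hv => (h4 v hv).2.2.2) fun v hv => ?_
          show G (c.φ (θ v)) ∈ V
          rw [h5 v hv]; exact (h4 v hv).2.2.1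
        · filter_upwards [hP, isOpen_ball.mem_nhds hv2] with v h7 h8
          rw [h5 v h8]
          exact (h _ (h4 v h8).2.1 (h4 v h8).2.2.1 (mem_univ _)).1 h7 i
      filter_upwards [isOpen_ball.mem_nhds (mem_ball_self hε)] with v hv
      refine (h _ (h4 v hv).2.1 (h4 v hv).2.2.1 (mem_univ _)).2 fun i => ?_
      rw [← h5 v hv]; exact h6 i v hv
  rw [← him]
  rintro _ ⟨v, hv, rfl⟩
  exact key v hv
end GLB
end

section
lemma iInf_bot_iff {a : ℕ → ℝ} : (⨅ k, (a k : EReal)) = ⊥ ↔ ∀ L : ℝ, ∃ k, a k < L := by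
  rw [iInf_eq_bot]
  constructor
  · intro h L
    obtain ⟨k, hk⟩ := h L (EReal.bot_lt_coe L)
    exact ⟨k, by exact_mod_cast hk⟩
  · intro h b hb
    obtain ⟨L, -, hL⟩ := EReal.lt_iff_exists_real_btwn.1 hb
    obtain ⟨k, hk⟩ := h L
    exact ⟨k, lt_trans (by exact_mod_cast hk) hL⟩

lemma dini_bot {Z : Type*} [TopologicalSpace Z] {K : Set Z} (hK : IsCompact K) {f : ℕ → Z → ℝ} (hf : ∀ k, ContinuousOn (f k) K)
    (hm : ∀ z ∈ K, Antitone fun k => f k z) (hb : ∀ z ∈ K, ∀ L : ℝ, ∃ k, f k z < L) (L : ℝ) : ∃ k, ∀ z ∈ K, f k z < L := by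
  have := hK.induction_on (p := fun s => ∃ k, ∀ z ∈ s, z ∈ K → f k z < L) ⟨0, by simp⟩
    (fun s t hst ⟨k, hk⟩ => ⟨k, fun z hz => hk z (hst hz)⟩)
    (fun s t ⟨k, hk⟩ ⟨l, hl⟩ => ⟨max k l, fun z hz hzK => hz.elim
      (fun h => (hm z hzK (le_max_left k l)).trans_lt (hk z h hzK)) (fun h => (hm z hzK (le_max_right k l)).trans_lt (hl z h hzK))⟩)
    (fun z hz => by
      obtain ⟨k, hk⟩ := hb z hz L
      exact ⟨_, inter_mem self_mem_nhdsWithin ((hf k z hz).eventually_lt_const hk), k, fun y hy _ => hy.2⟩)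
  obtain ⟨k, hk⟩ := this
  exact ⟨k, fun z hz => hk z hz hz⟩

lemma ann_bot {f : ℂ → ℝ} {a M c : ℝ} (ha : 0 < a) (ha1 : a < 1) (hc : 0 < c) (hf : ContinuousOn f (closedBall 0 2))
    (hS : ∀ t, ‖t‖ < 2 → SubV (fun τ => f (t + τ))) (hM : ∀ t, ‖t‖ = 2 → f t ≤ M)
    (hb : ∀ t, ‖t‖ = a → f t ≤ M - c * Real.log 4 - c * Real.log ((a⁻¹) ^ 2)) : f 1 ≤ M - c * Real.log 4 := by
  have hK : IsCompact (closedBall (0:ℂ) 2 \ ball 0 a) := (isCompact_closedBall 0 2).diff isOpen_ball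
  have hU : IsOpen (ball (0:ℂ) 2 \ closedBall 0 a) := isOpen_ball.sdiff isClosed_closedBall
  have := maxPrinciple hK (φ := fun t => f t + (c * Real.log (‖t⁻¹‖ ^ 2) + (c * Real.log 4 - M))) ?_ hU
    (fun t ht => ⟨ball_subset_closedBall ht.1, fun h => ht.2 (ball_subset_closedBall h)⟩) ?_ ?_ 1 ⟨by simp, by simpa using ha1.le⟩
  · simp at this; linarith
  · refine ContinuousOn.upperSemicontinuousOn ((hf.mono diff_subset).add fun t ht => ContinuousAt.continuousWithinAt ?_)
    have h1 : a ≤ ‖t‖ := by simpa using ht.2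
    have h3 : t ≠ 0 := norm_pos_iff.1 (ha.trans_le h1)
    have h4 : ‖t⁻¹‖ ^ 2 ≠ 0 := by simpa using h3
    have h5 : ContinuousAt (fun t : ℂ => ‖t⁻¹‖ ^ 2) t := ((continuousAt_inv₀ h3).norm).pow 2
    exact (continuousAt_const.mul (h5.log h4)).add continuousAt_const
  · intro t ht
    have h1 : a < ‖t‖ := by simpa using ht.2
    have h2 : ‖t‖ < 2 := by simpa using ht.1
    have h0 : t ≠ 0 := norm_pos_iff.1 (ha.trans h1)
    have h3 : LowH (fun τ => Real.log (‖(t + τ)⁻¹‖ ^ 2)) := by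
      have := LowH.log_normSq (m := 1) (g := fun _ τ => (t + τ)⁻¹) (fun _ => (analyticAt_const.add analyticAt_id).inv (by simpa using h0)) (by simpa using pow_pos (norm_pos_iff.2 h0) 2)
      simpa using this
    exact (hS t h2).addLow ((h3.smul hc.le).add (LowH.const _))
  · intro t ht
    have h1 : a ≤ ‖t‖ := by simpa using ht.1.2
    have h2 : ‖t‖ ≤ 2 := by simpa using ht.1.1
    by_cases h3 : ‖t‖ = 2
    · have := hM t h3
      rw [norm_inv, h3, inv_pow, Real.log_inv]; norm_num at *; linarith
    · have h4 : ‖t‖ = a := by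
        by_contra hne
        exact ht.2 ⟨by simpa using lt_of_le_of_ne h2 h3, by simpa using lt_of_le_of_ne h1 (Ne.symm hne)⟩
      have := hb t h4
      rw [norm_inv, h4]; linarith

lemma line_bot {E : Type*} [NormedAddCommGroup E] [NormedSpace ℂ E] [CompleteSpace E] {f : ℕ → E → ℝ} {v0 v1 : E} {ε : ℝ}
    (hf : ∀ k, ContinuousOn (f k) (ball v0 ε)) (hR : ∀ k, RP (f k) (ball v0 ε))
    (hm : ∀ z ∈ ball v0 ε, Antitone fun k => f k z) (hv1 : v1 ∈ ball v0 (ε / 8)) (hb : ∀ᶠ v in 𝓝 v1, ∀ L : ℝ, ∃ k, f k v < L)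
    {v : E} (hv : v ∈ ball v0 (ε / 8)) (L : ℝ) : ∃ k, f k v < L := by
  set l : ℂ → E := fun t => v1 + t • (v - v1) with hl
  have hlc : Continuous l := by fun_prop
  have hlb : ∀ t ∈ closedBall (0:ℂ) 2, l t ∈ ball v0 ε := by
    intro t ht
    rw [mem_ball, dist_eq_norm] at *
    have h1 : ‖t‖ ≤ 2 := by simpa using ht
    have h2 : ‖v - v1‖ ≤ ε / 4 := by
      rw [show v - v1 = (v - v0) - (v1 - v0) by abel]
      exact (norm_sub_le _ _).trans (by linarith)
    have h3 : l t - v0 = (v1 - v0) + t • (v - v1) := by simp only [hl]; abel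
    rw [h3]
    have h4 := norm_add_le (v1 - v0) (t • (v - v1))
    rw [norm_smul] at h4
    have h5 := mul_le_mul h1 h2 (norm_nonneg _) (by norm_num)
    have := norm_nonneg (v1 - v0)
    linarith
  have hgc : ∀ k, ContinuousOn (fun t => f k (l t)) (closedBall 0 2) := fun k => (hf k).comp hlc.continuousOn hlb
  have hev : ∀ᶠ t in 𝓝 (0:ℂ), ∀ L : ℝ, ∃ k, f k (l t) < L := by
    have : Tendsto l (𝓝 0) (𝓝 v1) := by simpa [hl] using hlc.tendsto 0
    exact this.eventually hb
  obtain ⟨d, hd, hd2⟩ := Metric.eventually_nhds_iff_ball.1 hev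
  obtain ⟨a, ha, ha1⟩ := exists_between (lt_min hd one_pos)
  obtain ⟨M, hM⟩ := (isCompact_closedBall (0:ℂ) 2).bddAbove_image (hgc 0)
  have hM' : ∀ t ∈ closedBall (0:ℂ) 2, f 0 (l t) ≤ M := fun t ht => hM (mem_image_of_mem _ ht)
  have hlog : 0 < Real.log 4 := Real.log_pos (by norm_num)
  set c := (|M - L| + 1) / Real.log 4 with hc
  have hc0 : 0 < c := by positivity
  have hcl : c * Real.log 4 = |M - L| + 1 := by rw [hc]; field_simp
  have hs2 : sphere (0:ℂ) a ⊆ closedBall 0 2 := fun t ht => by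
    have h1 : ‖t‖ = a := by simpa using ht
    have := ha1.trans_le (min_le_right _ _)
    simp; linarith
  obtain ⟨k, hk⟩ := dini_bot (isCompact_sphere (0:ℂ) a) (f := fun k t => f k (l t)) (fun k => (hgc k).mono hs2)
    (fun t ht => hm _ (hlb t (hs2 ht))) (fun t ht => hd2 t (by
      have h1 : ‖t‖ = a := by simpa using ht
      have := ha1.trans_le (min_le_left _ _)
      simp; linarith)) (M - c * Real.log 4 - c * Real.log ((a⁻¹) ^ 2))
  have := ann_bot ha (ha1.trans_le (min_le_right _ _)) hc0 (hgc k) ?_ ?_ (fun t ht => (hk t (by simpa using ht)).le) (M := M)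
  · refine ⟨k, ?_⟩
    have h1 : l 1 = v := by simp [hl]
    simp only [h1] at this
    have := le_abs_self (M - L)
    linarith
  · intro t ht
    refine (hR k).2 (fun τ => l (t + τ)) ?_ ?_
    · simp only [hl]
      exact (analyticAt_const.add ((analyticAt_const.add analyticAt_id).smul analyticAt_const))
    · simpa using hlb t (by simpa using ht.le)
  · intro t ht
    have ht' : t ∈ closedBall (0:ℂ) 2 := by simpa using ht.le
    exact (hm _ (hlb t ht') (Nat.zero_le k)).trans (hM' t ht')

section GLC
variable {X : Type*} [TopologicalSpace X]

lemma nice_bot {S : CSpace X} {u : ℕ → X → EReal} (hpsh : ∀ n, SpacePSHOn S (u n) univ) (hdec : ∀ x, Antitone fun n => u n x)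
    {U O : Set X} (hU : Nice S U) (hO : IsOpen O) (hne : (O ∩ U).Nonempty) (hOu : ∀ x ∈ O ∩ U, (⨅ n, u n x) = ⊥) : ∀ x ∈ U, (⨅ n, u n x) = ⊥ := by
  obtain ⟨hUo, c, hc, hUc, n, Ω, θ, hΩ, hcv, hθ, hθd, him⟩ := hU
  obtain ⟨x1, h1, h2⟩ := hne
  have h2' := h2
  rw [← him] at h2'
  obtain ⟨v1, hv1, rfl⟩ := h2'
  have hθU : ∀ v ∈ Ω, θ v ∈ U := fun v hv => him ▸ mem_image_of_mem _ hv
  have hca : ∀ v ∈ Ω, ContinuousAt θ v := fun v hv => hθ.continuousAt (hΩ.mem_nhds hv)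
  have key : ∀ v ∈ Ω, (⨅ n, u n (θ v)) = ⊥ := by
    refine nice_prop hΩ hcv hv1 (P := fun v => (⨅ n, u n (θ v)) = ⊥) ?_ ?_
    · filter_upwards [(hca v1 hv1).eventually_mem ((hO.inter hUo).mem_nhds ⟨h1, h2⟩)] with v hv using hOu _ hv
    · intro v0 hv0
      obtain ⟨V, hV, hVV, hxV, w, hw1, hw2, hw3, -, -, -⟩ := partB hpsh hdec hc (hUc (hθU v0 hv0))
      have h3 : ∀ᶠ v in 𝓝 v0, v ∈ Ω ∧ c.φ (θ v) ∈ V := by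
        filter_upwards [hΩ.mem_nhds hv0, (hca v0 hv0).eventually_mem ((chart_open c hV).mem_nhds ⟨hUc (hθU v0 hv0), hxV⟩)] with v h4 h5
        exact ⟨h4, h5.2⟩
      obtain ⟨ε, hε, h4⟩ := Metric.eventually_nhds_iff_ball.1 h3
      have hcomp : ∀ v ∈ ball v0 ε, ((⨅ n, u n (θ v)) = ⊥ ↔ ∀ L : ℝ, ∃ k, w k (c.φ (θ v)) < L) := by
        intro v hv
        rw [← hw3 _ (hUc (hθU v (h4 v hv).1)) (h4 v hv).2, iInf_bot_iff]
      have h8 : ball v0 (ε / 8) ⊆ ball v0 ε := ball_subset_ball (by linarith)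
      refine ⟨ε / 8, by positivity, fun v2 hv2 _ hP => ?_⟩
      filter_upwards [ball_mem_nhds v0 (show 0 < ε / 8 by positivity)] with v hv
      rw [hcomp v (h8 hv)]
      have hd : DifferentiableOn ℂ (fun v => c.φ (θ v)) (ball v0 ε) := hθd.mono fun v hv => (h4 v hv).1
      refine line_bot (f := fun k v => w k (c.φ (θ v))) (v0 := v0) (ε := ε) (fun k => (hw1 k).1.comp hd.continuousOn fun v hv => (h4 v hv).2)
        (fun k => (hw1 k).2.comp isOpen_ball hd fun v hv => (h4 v hv).2) (fun v hv => antitone_nat_of_succ_le fun k => hw2 k _ (h4 v hv).2) hv2 ?_ hv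
      filter_upwards [hP, isOpen_ball.mem_nhds (h8 hv2)] with v h9 h10
      exact (hcomp v h10).1 h9
  rw [← him]
  rintro _ ⟨v, hv, rfl⟩
  exact key v hv

lemma partA {S : CSpace X} {u : ℕ → X → EReal} (hpsh : ∀ n, SpacePSHOn S (u n) univ) (hdec : ∀ x, Antitone fun n => u n x)
    {O : Set X} (hO : IsOpen O) (hne : O.Nonempty) (hOu : ∀ x ∈ O, (⨅ n, u n x) = ⊥) :
    ∃ C, IsIrredComponentIn S C univ ∧ ∀ x ∈ C, (⨅ n, u n x) = ⊥ := by
  obtain ⟨x0, hx0⟩ := hne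
  obtain ⟨x1, hx1O, U1, hU1, hx1U⟩ := _root_.mem_closure_iff.1 (RegS.dense S x0) O hO hx0
  set rel : X → X → Prop := fun a b => ∃ U, Nice S U ∧ a ∈ U ∧ b ∈ U with hrel
  set R : Set X := {y | Relation.ReflTransGen rel x1 y} with hR
  have hx1R : x1 ∈ R := Relation.ReflTransGen.refl
  have hcl : ∀ U, Nice S U → ∀ a ∈ U, ∀ b ∈ U, a ∈ R → b ∈ R := fun U hU a ha b hb h => Relation.ReflTransGen.tail h ⟨U, hU, ha, hb⟩
  have hRR : R ⊆ RegS S := by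
    intro y hy
    rcases Relation.ReflTransGen.cases_tail hy with h | ⟨z, -, U, hU, -, h⟩
    · rw [h]; exact ⟨U1, hU1, hx1U⟩
    · exact ⟨U, hU, h⟩
  have hRo : IsOpen R := by
    rw [isOpen_iff_mem_nhds]
    intro y hy
    obtain ⟨U, hU, hyU⟩ := hRR hy
    filter_upwards [hU.1.mem_nhds hyU] with z hz using hcl U hU y hyU z hz hy
  have hRo' : IsOpen (RegS S \ R) := by
    rw [isOpen_iff_mem_nhds]
    rintro y ⟨⟨U, hU, hyU⟩, hy⟩
    filter_upwards [hU.1.mem_nhds hyU] with z hz using ⟨⟨U, hU, hz⟩, fun h => hy (hcl U hU z hz y hyU h)⟩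
  have hchain : ∀ (P : X → Prop), (∀ U O', Nice S U → IsOpen O' → (O' ∩ U).Nonempty → (∀ x ∈ O' ∩ U, P x) → ∀ x ∈ U, P x) →
      ∀ a ∈ R, (∀ᶠ x in 𝓝 a, P x) → ∀ b ∈ R, P b := by
    intro P hP a ha hPa b hb
    have hsymm : ∀ x y, rel x y → rel y x := fun x y ⟨U, h1, h2, h3⟩ => ⟨U, h1, h3, h2⟩
    have hab : Relation.ReflTransGen rel a b := ((haveI : Std.Symm rel := ⟨hsymm⟩; Std.Symm.symm _ _ ha : Relation.ReflTransGen rel a x1)).trans hb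
    have : ∀ᶠ x in 𝓝 b, P x := by
      induction hab with
      | refl => exact hPa
      | tail h1 h2 ih =>
        rename_i y z
        obtain ⟨U, hU, hy, hz⟩ := h2
        have hyR : y ∈ R := Relation.ReflTransGen.trans ha h1
        obtain ⟨O', h3, h4, h5⟩ := _root_.eventually_nhds_iff.1 (ih hyR)
        filter_upwards [hU.1.mem_nhds hz] with x hx
        exact hP U O' hU h4 ⟨y, h5, hy⟩ (fun x hx => h3 x hx.1) x hx
    exact this.self_of_nhds
  obtain ⟨hCa, hCp⟩ := clos_props hRo hRo'
  have hRR2 : IsOpen (RegS S \ (RegS S \ R)) := by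
    rw [diff_diff_cancel_left hRR]; exact hRo
  obtain ⟨hDa, -⟩ := clos_props hRo' hRR2
  have hRu : ∀ b ∈ R, (⨅ n, u n b) = ⊥ := by
    refine hchain (fun x => (⨅ n, u n x) = ⊥) (fun U O' hU hO' hne h => nice_bot hpsh hdec hU hO' hne h) x1 hx1R ?_
    filter_upwards [hO.mem_nhds hx1O] with x hx using hOu x hx
  refine ⟨closure R, ⟨⟨hCa, ⟨x1, subset_closure hx1R⟩, ?_⟩, ?_⟩, ?_⟩
  · intro A1 A2 h1 h2 h12
    by_cases hc : R ⊆ A1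
    · exact Or.inl (closure_minimal hc (analytic_closed h1))
    · right
      obtain ⟨a, ha, ha1⟩ := not_subset.1 hc
      refine closure_minimal (fun b hb => ?_) (analytic_closed h2)
      refine hchain (fun x => x ∈ A2) (fun U O' hU hO' hne h => nice_ident h2 hU hO' hne h) a ha ?_ b hb
      filter_upwards [hRo.mem_nhds ha, (analytic_closed h1).isOpen_compl.mem_nhds ha1] with x h3 h4
      exact (h12 (subset_closure h3)).resolve_left h4
  · intro C' hC' hsub
    refine Subset.antisymm ?_ hsub
    have hun : C' ⊆ closure R ∪ closure (RegS S \ R) := fun x _ => by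
      rw [← closure_union, union_diff_cancel hRR]
      exact RegS.dense S x
    rcases hC'.2.2 _ _ hCa hDa hun with h | h
    · exact h
    · exfalso
      obtain ⟨y, h1, h2⟩ := _root_.mem_closure_iff.1 (h (hsub (subset_closure hx1R))) R hRo hx1R
      exact h2.2 h1
  · intro x hx
    obtain ⟨c, hc, hxc⟩ := S.chart_cover x
    obtain ⟨V, hV, hVV, hxV, w, hw1, hw2, hw3, -, -, -⟩ := partB hpsh hdec hc hxc
    obtain ⟨K, hK, hKR, hpk⟩ := hCp c hc x hxc hx V hV hxV
    rw [← hw3 x hxc hxV, iInf_bot_iff]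
    intro L
    obtain ⟨k, hk⟩ := dini_bot hK (f := w) (fun k => (hw1 k).1.mono fun z hz => (hKR hz).2)
      (fun z hz => antitone_nat_of_succ_le fun k => hw2 k z (hKR hz).2) (fun z hz => by
        obtain ⟨⟨y, hy, rfl⟩, h2⟩ := hKR hz
        rw [← iInf_bot_iff, hw3 y hy.2 h2]
        exact hRu y hy.1) L
    obtain ⟨z, hz, hle⟩ := hpk (w k) (hw1 k).1 (hw1 k).2
    exact ⟨k, hle.trans_lt (hk z hz)⟩

end GLC
end

theorem psh_of_decreasing_infimum {X : Type*} [TopologicalSpace X] [T2Space X]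
    [SecondCountableTopology X] (S : CSpace X) (u : ℕ → X → EReal)
    (hpsh : ∀ n, SpacePSHOn S (u n) univ)
    (hdec : ∀ x, Antitone fun n => u n x)
    (hbot : ∀ C : Set X, IsIrredComponentIn S C univ → ∃ x ∈ C, (⨅ n, u n x) ≠ ⊥) :
    SpacePSHOn S (fun x => ⨅ n, u n x) univ := by
  refine ⟨fun x hx => (iInf_le _ 0).trans_lt ((hpsh 0).1 x hx), hbot, fun x _ => ?_⟩
  obtain ⟨c, hc, hx⟩ := S.chart_cover x
  obtain ⟨V, hV, hVV, hxV, w, hw1, hw2, hw3, hw4, hw5, hw6⟩ := partB hpsh hdec hc hx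
  refine ⟨c, hc, hx, V, hV, hVV, hxV, subset_univ _, fun z => ⨅ k, (w k z : EReal),
    ⟨fun z _ => (iInf_le _ 0).trans_lt (EReal.coe_lt_top _), hw5, ?_, hw6⟩, hw3⟩
  rintro ⟨U, hUV, hU, ⟨z, hz⟩, hb⟩
  have h1 : ∀ y ∈ U, y ∈ c.B := by
    intro y hy
    by_contra hyB
    obtain ⟨a, ha⟩ := hw4 y (hUV hy) hyB
    obtain ⟨k, hk⟩ := iInf_bot_iff.1 (hb y hy) a
    exact absurd (ha k) (not_le.2 hk)
  have h2 := h1 z hz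
  rw [← c.image_eq] at h2
  obtain ⟨x1, hx1, rfl⟩ := h2
  obtain ⟨C, hC, hC2⟩ := partA hpsh hdec (chart_open c hU) ⟨x1, hx1, hz⟩ fun y hy => by
    rw [← hw3 y hy.1 (hUV hy.2)]; exact hb _ hy.2
  obtain ⟨y, hy, hy2⟩ := hbot C hC
  exact hy2 (hC2 y hy)
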